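/- Fix β > 0. Let (θ_n)_{n≥1} be a sequence with θ_n ∈ (0,π] for all n and n·θ_n → +∞ as n → ∞. Then the random variables √(π²β/(2 ln(2+nθ_n))) · (N_n(0,θ_n) − nθ_n/(2π)), where for each n the point configuration is sampled from μ_{β,n}, converge in distribution as n → ∞ to a standard Gaussian random variable of mean zero and variance one. -/

import Mathlib

open MeasureTheory ProbabilityTheory Filter

noncomputable section

/-- The normalization constant `C_{β,n} = (2π)^n Γ(1+βn/2)/Γ(1+β/2)^n`. -/
def cbeConst (β : ℝ) (n : ℕ) : ℝ :=
  (2 * Real.pi) ^ n * Real.Gamma (1 + β * n / 2) / Real.Gamma (1 + β / 2) ^ n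

/-- The circular β-ensemble: the measure on `[0,2π)^n` with density
`(1/C_{β,n}) ∏_{j<k} |e^{iθ_j} − e^{iθ_k}|^β` with respect to Lebesgue measure. -/
def cbe (β : ℝ) (n : ℕ) : Measure (Fin n → ℝ) :=
  ((volume : Measure (Fin n → ℝ)).restrict
      (Set.univ.pi fun _ => Set.Ico 0 (2 * Real.pi))).withDensity
    (fun y => ENNReal.ofReal ((1 / cbeConst β n) *
      ∏ p ∈ Finset.univ.filter (fun p : Fin n × Fin n => p.1 < p.2),
        ‖Complex.exp (Complex.I * (y p.1 : ℂ)) - Complex.exp (Complex.I * (y p.2 : ℂ))‖ ^ β))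

/-- `countIn a b y` is the number of indices `j` with `y j ∈ [a, b)`. -/
def countIn {n : ℕ} (a b : ℝ) (y : Fin n → ℝ) : ℕ :=
  (Finset.univ.filter fun j => a ≤ y j ∧ y j < b).card

/-- The unnormalised radial density `(1 - |α|²)^(γ-1)` on the open unit disk. -/
def diskWeight (γ : ℝ) (α : ℂ) : ℝ := if ‖α‖ < 1 then (1 - ‖α‖ ^ 2) ^ (γ - 1) else 0

lemma diskWeight_nonneg (γ : ℝ) (α : ℂ) : 0 ≤ diskWeight γ α := by
  unfold diskWeight
  split_ifs with h
  · apply Real.rpow_nonneg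
    nlinarith [norm_nonneg α]
  · rfl

@[fun_prop]
lemma measurable_diskWeight (γ : ℝ) : Measurable (diskWeight γ) := by
  unfold diskWeight
  refine Measurable.ite (measurableSet_lt (by fun_prop) (by fun_prop)) ?_ measurable_const
  fun_prop

lemma lintegral_radial_diskWeight {γ : ℝ} (hγ : 0 < γ) :
    ∫⁻ r in Set.Ioo (0 : ℝ) 1, ENNReal.ofReal (r * (1 - r ^ 2) ^ (γ - 1)) =
      ENNReal.ofReal (1 / (2 * γ)) := by
  have hc : ContinuousOn (fun r : ℝ => -(1 - r ^ 2) ^ γ / (2 * γ)) (Set.Icc 0 1) := by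
    apply ContinuousOn.div_const
    apply ContinuousOn.neg
    exact ContinuousOn.rpow_const (by fun_prop) (fun x _ => Or.inr hγ.le)
  have hd : ∀ x ∈ Set.Ioo (0 : ℝ) 1,
      HasDerivAt (fun r : ℝ => -(1 - r ^ 2) ^ γ / (2 * γ)) (x * (1 - x ^ 2) ^ (γ - 1)) x := by
    intro x hx
    have h1 : (0 : ℝ) < 1 - x ^ 2 := by nlinarith [hx.1, hx.2]
    have h2 : HasDerivAt (fun r : ℝ => 1 - r ^ 2) (-(2 * x)) x := by
      simpa using (hasDerivAt_pow 2 x).const_sub 1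
    have h3 := ((h2.rpow_const (p := γ) (Or.inl h1.ne')).neg).div_const (2 * γ)
    refine h3.congr_deriv ?_
    rw [div_eq_iff (by positivity)]
    ring
  have hpos : ∀ x ∈ Set.Ioo (0 : ℝ) 1, 0 ≤ x * (1 - x ^ 2) ^ (γ - 1) := by
    intro x hx
    exact mul_nonneg hx.1.le (Real.rpow_nonneg (by nlinarith [hx.1, hx.2]) _)
  have hint := intervalIntegral.integrableOn_deriv_of_nonneg hc hd hpos
  have hval := intervalIntegral.integral_eq_sub_of_hasDerivAt_of_le zero_le_one hc hd
    ((intervalIntegrable_iff_integrableOn_Ioc_of_le zero_le_one).2 hint)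
  rw [← ofReal_integral_eq_lintegral_ofReal (hint.mono_set Set.Ioo_subset_Ioc_self)
    ((ae_restrict_mem measurableSet_Ioo).mono hpos)]
  congr 1
  rw [← integral_Ioc_eq_integral_Ioo, ← intervalIntegral.integral_of_le zero_le_one, hval]
  simp [Real.zero_rpow hγ.ne']
  field_simp

lemma lintegral_diskWeight {γ : ℝ} (hγ : 0 < γ) :
    ∫⁻ α : ℂ, ENNReal.ofReal (diskWeight γ α) = ENNReal.ofReal (Real.pi / γ) := by
  rw [← Complex.lintegral_comp_polarCoord_symm]
  have h1 : ∀ x ∈ polarCoord.target, ENNReal.ofReal x.1 •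
      ENNReal.ofReal (diskWeight γ (Complex.polarCoord.symm x)) =
      (Set.Ioo (0:ℝ) 1).indicator
        (fun r => ENNReal.ofReal (r * (1 - r ^ 2) ^ (γ - 1))) x.1 * 1 := by
    rintro ⟨r, t⟩ h
    simp only [polarCoord_target, Set.mem_prod, Set.mem_Ioi] at h
    have hn : ‖Complex.polarCoord.symm (r, t)‖ = r := by
      rw [Complex.norm_polarCoord_symm, abs_of_pos h.1]
    simp only [diskWeight, hn, Set.indicator, Set.mem_Ioo, h.1, true_and, smul_eq_mul, mul_one]
    split_ifs
    · rw [ENNReal.ofReal_mul h.1.le]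
    · simp
  rw [setLIntegral_congr_fun polarCoord.open_target.measurableSet h1, polarCoord_target,
    Measure.volume_eq_prod, ← Measure.prod_restrict,
    lintegral_prod_mul (f := (Set.Ioo (0:ℝ) 1).indicator
        (fun r => ENNReal.ofReal (r * (1 - r ^ 2) ^ (γ - 1)))) (g := fun _ => 1)
      (by
        apply Measurable.aemeasurable
        exact Measurable.indicator (by fun_prop) measurableSet_Ioo) aemeasurable_const,
    setLIntegral_indicator measurableSet_Ioo, Set.inter_eq_left.2 Set.Ioo_subset_Ioi_self,
    lintegral_radial_diskWeight hγ]
  simp only [lintegral_const, MeasurableSet.univ, Measure.restrict_apply, Set.univ_inter,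
    Real.volume_Ioo, one_mul]
  rw [← ENNReal.ofReal_mul (by positivity)]
  congr 1
  field_simp
  ring

lemma integrable_diskWeight {γ : ℝ} (hγ : 0 < γ) : Integrable (diskWeight γ) := by
  refine ⟨(measurable_diskWeight γ).aestronglyMeasurable, ?_⟩
  rw [hasFiniteIntegral_iff_ofReal (ae_of_all _ (diskWeight_nonneg γ)), lintegral_diskWeight hγ]
  exact ENNReal.ofReal_lt_top

lemma integral_diskWeight {γ : ℝ} (hγ : 0 < γ) : ∫ α, diskWeight γ α = Real.pi / γ := by
  rw [integral_eq_lintegral_of_nonneg_ae (ae_of_all _ (diskWeight_nonneg γ))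
    (measurable_diskWeight γ).aestronglyMeasurable, lintegral_diskWeight hγ,
    ENNReal.toReal_ofReal (by have := Real.pi_pos; positivity)]

/-- The probability measure on the unit disk with density `(γ/π) (1 - |α|²)^(γ-1)`. -/
def diskMeasure (γ : ℝ) : Measure ℂ :=
  volume.withDensity fun α => ENNReal.ofReal (γ / Real.pi * diskWeight γ α)

lemma lintegral_diskMeasure {γ : ℝ} (hγ : 0 < γ) {f : ℂ → ENNReal} (hf : Measurable f) :
    ∫⁻ α, f α ∂(diskMeasure γ) =
      ENNReal.ofReal (γ / Real.pi) * ∫⁻ α, ENNReal.ofReal (diskWeight γ α) * f α := by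
  rw [diskMeasure, lintegral_withDensity_eq_lintegral_mul _ (by fun_prop) hf,
    ← lintegral_const_mul _ (by fun_prop)]
  refine lintegral_congr fun α => ?_
  simp only [Pi.mul_apply]
  rw [ENNReal.ofReal_mul (by have := Real.pi_pos; positivity), mul_assoc]

lemma isProbabilityMeasure_diskMeasure {γ : ℝ} (hγ : 0 < γ) :
    IsProbabilityMeasure (diskMeasure γ) := by
  constructor
  have h := lintegral_diskMeasure hγ (f := fun _ => 1) measurable_const
  simp only [lintegral_const, one_mul, mul_one, lintegral_diskWeight hγ] at h
  rw [h, ← ENNReal.ofReal_mul (by have := Real.pi_pos; positivity)]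
  rw [show γ / Real.pi * (Real.pi / γ) = 1 by
    have := Real.pi_pos; field_simp]
  simp

lemma integral_diskMeasure {γ : ℝ} (hγ : 0 < γ) {E : Type*} [NormedAddCommGroup E]
    [NormedSpace ℝ E] (f : ℂ → E) :
    ∫ α, f α ∂(diskMeasure γ) = ∫ α, (γ / Real.pi * diskWeight γ α) • f α := by
  rw [diskMeasure, integral_withDensity_eq_integral_toReal_smul (by fun_prop)
    (ae_of_all _ fun _ => ENNReal.ofReal_lt_top)]
  refine integral_congr_ae (ae_of_all _ fun α => ?_)
  simp only
  rw [ENNReal.toReal_ofReal]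
  have := diskWeight_nonneg γ α
  have := Real.pi_pos
  positivity

lemma ae_norm_lt_one_diskMeasure (γ : ℝ) : ∀ᵐ α ∂(diskMeasure γ), ‖α‖ < 1 := by
  rw [diskMeasure, ae_withDensity_iff (by fun_prop)]
  refine ae_of_all _ fun α h => ?_
  by_contra h'
  exact h (by simp [diskWeight, h'])

lemma diskMeasure_map_mul {γ : ℝ} (u : ℂ) (hu : ‖u‖ = 1) :
    (diskMeasure γ).map (fun α => u * α) = diskMeasure γ := by
  have hmp : MeasurePreserving (fun α : ℂ => u * α) volume volume :=
    (rotation ⟨u, mem_sphere_zero_iff_norm.2 hu⟩).measurePreserving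
  ext s hs
  rw [Measure.map_apply (by fun_prop) hs, diskMeasure, withDensity_apply _ hs,
    withDensity_apply _ (hs.preimage (by fun_prop)), ← hmp.setLIntegral_comp_preimage hs
      (by fun_prop)]
  simp [diskWeight, hu]

lemma diskMeasure_map_conj {γ : ℝ} :
    (diskMeasure γ).map (starRingEnd ℂ) = diskMeasure γ := by
  have hmp : MeasurePreserving (starRingEnd ℂ) volume volume :=
    Complex.conjLIE.measurePreserving
  ext s hs
  rw [Measure.map_apply hmp.measurable hs, diskMeasure, withDensity_apply _ hs,
    withDensity_apply _ (hs.preimage hmp.measurable), ← hmp.setLIntegral_comp_preimage hs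
      (by fun_prop)]
  simp [diskWeight]

lemma diskWeight_mul_one_sub {γ : ℝ} (α : ℂ) :
    diskWeight γ α * (1 - ‖α‖ ^ 2) = diskWeight (γ + 1) α := by
  unfold diskWeight
  split_ifs with h
  · have h1 : (0 : ℝ) < 1 - ‖α‖ ^ 2 := by nlinarith [norm_nonneg α]
    rw [← Real.rpow_add_one h1.ne']
    congr 1
    ring
  · simp

lemma integral_norm_sq_diskMeasure {γ : ℝ} (hγ : 0 < γ) :
    ∫ α, ‖α‖ ^ 2 ∂(diskMeasure γ) = 1 / (γ + 1) := by
  have hγ1 : 0 < γ + 1 := by linarith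
  rw [integral_diskMeasure hγ]
  have : ∀ α : ℂ, (γ / Real.pi * diskWeight γ α) • ‖α‖ ^ 2 =
      γ / Real.pi * (diskWeight γ α - diskWeight (γ + 1) α) := by
    intro α
    rw [← diskWeight_mul_one_sub, smul_eq_mul]; ring
  simp_rw [this]
  rw [integral_const_mul, integral_sub (integrable_diskWeight hγ) (integrable_diskWeight hγ1),
    integral_diskWeight hγ, integral_diskWeight hγ1]
  have := Real.pi_pos
  field_simp
  ring

lemma integral_norm_pow_four_diskMeasure {γ : ℝ} (hγ : 0 < γ) :
    ∫ α, ‖α‖ ^ 4 ∂(diskMeasure γ) = 2 / ((γ + 1) * (γ + 2)) := by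
  have hγ1 : 0 < γ + 1 := by linarith
  have hγ2 : 0 < γ + 1 + 1 := by linarith
  rw [integral_diskMeasure hγ]
  have : ∀ α : ℂ, (γ / Real.pi * diskWeight γ α) • ‖α‖ ^ 4 =
      γ / Real.pi * (diskWeight γ α - 2 * diskWeight (γ + 1) α + diskWeight (γ + 1 + 1) α) := by
    intro α
    rw [← diskWeight_mul_one_sub (γ := γ + 1), ← diskWeight_mul_one_sub, smul_eq_mul]; ring
  simp_rw [this]
  have hsub : Integrable fun α : ℂ => diskWeight γ α - 2 * diskWeight (γ + 1) α :=
    (integrable_diskWeight hγ).sub ((integrable_diskWeight hγ1).const_mul 2)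
  rw [integral_const_mul, integral_add hsub (integrable_diskWeight hγ2),
    integral_sub (integrable_diskWeight hγ) ((integrable_diskWeight hγ1).const_mul 2),
    integral_const_mul,
    integral_diskWeight hγ, integral_diskWeight hγ1, integral_diskWeight hγ2]
  have := Real.pi_pos
  have : γ + 2 = γ + 1 + 1 := by ring
  rw [this]
  field_simp
  ring

lemma re_one_sub_pos {z : ℂ} (hz : ‖z‖ < 1) : 0 < (1 - z).re := by
  have := (Complex.abs_re_le_norm z).trans_lt hz
  simp only [Complex.sub_re, Complex.one_re]
  linarith [le_abs_self z.re]

lemma abs_arg_one_sub_add_im_le {z : ℂ} (hz : ‖z‖ < 1) :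
    |(1 - z).arg + z.im| ≤ 12 * ‖z‖ ^ 2 := by
  rcases le_total ‖z‖ (1 / 2) with h | h
  · have h1 := Complex.norm_log_one_add_sub_self_le (z := -z) (by simpa using hz)
    have h2 : (1 - z).arg + z.im = (Complex.log (1 + -z) - -z).im := by
      simp [Complex.log_im, sub_eq_add_neg]
    rw [h2]
    refine (Complex.abs_im_le_norm _).trans (h1.trans ?_)
    rw [norm_neg]
    have h3 : (1 - ‖z‖)⁻¹ ≤ 2 := by
      rw [inv_le_comm₀ (by linarith) (by norm_num)]
      linarith
    nlinarith [sq_nonneg ‖z‖]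
  · have h1 : |(1 - z).arg| ≤ Real.pi / 2 :=
      Complex.abs_arg_le_pi_div_two_iff.2 (re_one_sub_pos hz).le
    have h2 := (Complex.abs_im_le_norm z).trans hz.le
    have h3 := abs_add_le (1 - z).arg z.im
    nlinarith [Real.pi_lt_four]

lemma abs_arg_one_sub_le {z : ℂ} (hz : ‖z‖ < 1) : |(1 - z).arg| ≤ 13 * ‖z‖ := by
  have h1 := abs_arg_one_sub_add_im_le hz
  have h2 := Complex.abs_im_le_norm z
  have h3 : |(1 - z).arg| ≤ |(1 - z).arg + z.im| + |z.im| := by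
    simpa using abs_sub ((1 - z).arg + z.im) z.im
  nlinarith [norm_nonneg z]

/-- The increment of the relative Prüfer phase `x` produced by the coefficient `α`. -/
def phaseShift (x : ℝ) (α : ℂ) : ℝ :=
  -2 * (1 - α * Complex.exp (x * Complex.I)).arg + 2 * (1 - α).arg

@[fun_prop]
lemma measurable_arg_comp {Ω : Type*} [MeasurableSpace Ω] {f : Ω → ℂ} (hf : Measurable f) :
    Measurable fun x => (f x).arg :=
  Complex.measurable_arg.comp hf

@[fun_prop]
lemma measurable_phaseShift_comp {Ω : Type*} [MeasurableSpace Ω] {f : Ω → ℝ} {g : Ω → ℂ}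
    (hf : Measurable f) (hg : Measurable g) : Measurable fun ω => phaseShift (f ω) (g ω) := by
  unfold phaseShift
  fun_prop

lemma norm_mul_exp_I (α : ℂ) (x : ℝ) : ‖α * Complex.exp (x * Complex.I)‖ = ‖α‖ := by
  rw [norm_mul, Complex.norm_exp_ofReal_mul_I, mul_one]

lemma abs_phaseShift_le_norm {α : ℂ} (hα : ‖α‖ < 1) (x : ℝ) : |phaseShift x α| ≤ 52 * ‖α‖ := by
  have h1 := abs_arg_one_sub_le hα
  have h2 := abs_arg_one_sub_le (z := α * Complex.exp (x * Complex.I))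
    (by rwa [norm_mul_exp_I])
  rw [norm_mul_exp_I] at h2
  unfold phaseShift
  rw [abs_le] at *
  constructor <;> linarith

lemma abs_phaseShift_le (x : ℝ) (α : ℂ) : |phaseShift x α| ≤ 4 * Real.pi := by
  have h1 := Complex.abs_arg_le_pi (1 - α)
  have h2 := Complex.abs_arg_le_pi (1 - α * Complex.exp (x * Complex.I))
  unfold phaseShift
  rw [abs_le] at *
  constructor <;> linarith

lemma integrable_of_abs_le {Ω : Type*} [MeasurableSpace Ω] {μ : Measure Ω} [IsFiniteMeasure μ]
    {E : Type*} [NormedAddCommGroup E] {f : Ω → E} (hf : AEStronglyMeasurable f μ) {C : ℝ}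
    (h : ∀ᵐ x ∂μ, ‖f x‖ ≤ C) : Integrable f μ :=
  ⟨hf, HasFiniteIntegral.of_bounded h⟩

lemma integral_arg_one_sub {γ : ℝ} :
    ∫ α, (1 - α).arg ∂(diskMeasure γ) = 0 := by
  have h1 : ∫ α, (1 - α).arg ∂(diskMeasure γ) =
      ∫ α, (1 - starRingEnd ℂ α).arg ∂(diskMeasure γ) := by
    conv_lhs => rw [← diskMeasure_map_conj]
    rw [integral_map (by fun_prop) (Measurable.aestronglyMeasurable (by fun_prop))]
  have h2 : ∫ α, (1 - starRingEnd ℂ α).arg ∂(diskMeasure γ) =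
      ∫ α, -(1 - α).arg ∂(diskMeasure γ) := by
    refine integral_congr_ae ((ae_norm_lt_one_diskMeasure γ).mono fun α hα => ?_)
    have : 1 - starRingEnd ℂ α = starRingEnd ℂ (1 - α) := by simp
    simp only
    rw [this, Complex.arg_conj, if_neg]
    intro h
    have h3 := Complex.abs_arg_le_pi_div_two_iff.2 (re_one_sub_pos hα).le
    rw [h, abs_of_pos Real.pi_pos] at h3
    linarith [Real.pi_pos]
  rw [h2, integral_neg] at h1
  linarith

lemma integral_phaseShift {γ : ℝ} (hγ : 0 < γ) (x : ℝ) :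
    ∫ α, phaseShift x α ∂(diskMeasure γ) = 0 := by
  have := isProbabilityMeasure_diskMeasure hγ
  have h1 : ∫ α, (1 - α * Complex.exp (x * Complex.I)).arg ∂(diskMeasure γ) = 0 := by
    rw [← integral_arg_one_sub (γ := γ)]
    conv_rhs => rw [← diskMeasure_map_mul (Complex.exp (x * Complex.I))
      (Complex.norm_exp_ofReal_mul_I x)]
    rw [integral_map (by fun_prop) (Measurable.aestronglyMeasurable (by fun_prop))]
    simp_rw [mul_comm]
  unfold phaseShift
  rw [integral_add, integral_const_mul, integral_const_mul, h1, integral_arg_one_sub]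
  · simp
  · refine Integrable.const_mul (integrable_of_abs_le (Measurable.aestronglyMeasurable (by fun_prop)) (C := Real.pi)
      (ae_of_all _ fun α => ?_)) _
    exact Complex.abs_arg_le_pi _
  · refine Integrable.const_mul (integrable_of_abs_le (Measurable.aestronglyMeasurable (by fun_prop)) (C := Real.pi)
      (ae_of_all _ fun α => ?_)) _
    exact Complex.abs_arg_le_pi _

lemma integrable_norm_pow_diskMeasure {γ : ℝ} (hγ : 0 < γ) (k : ℕ) :
    Integrable (fun α : ℂ => ‖α‖ ^ k) (diskMeasure γ) := by
  have := isProbabilityMeasure_diskMeasure hγ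
  refine integrable_of_abs_le (Measurable.aestronglyMeasurable (by fun_prop)) (C := 1)
    ((ae_norm_lt_one_diskMeasure γ).mono fun α hα => ?_)
  rw [norm_pow, norm_norm]
  exact pow_le_one₀ (norm_nonneg _) hα.le

lemma integral_norm_sq_diskMeasure_le {γ : ℝ} (hγ : 0 < γ) :
    ∫ α, ‖α‖ ^ 2 ∂(diskMeasure γ) ≤ 1 / γ := by
  rw [integral_norm_sq_diskMeasure hγ]
  gcongr
  linarith

lemma integral_norm_cube_diskMeasure_le {γ : ℝ} (hγ : 0 < γ) :
    ∫ α, ‖α‖ ^ 3 ∂(diskMeasure γ) ≤ 2 / (γ * √γ) := by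
  have hs : 0 < √γ := Real.sqrt_pos.2 hγ
  have hss : √γ * √γ = γ := Real.mul_self_sqrt hγ.le
  have h1 : ∀ α : ℂ, ‖α‖ ^ 3 ≤ 1 / (2 * √γ) * ‖α‖ ^ 2 + √γ / 2 * ‖α‖ ^ 4 := by
    intro α
    have : 1 / (2 * √γ) * ‖α‖ ^ 2 + √γ / 2 * ‖α‖ ^ 4 - ‖α‖ ^ 3 =
        ‖α‖ ^ 2 * (1 - √γ * ‖α‖) ^ 2 / (2 * √γ) := by
      field_simp; ring
    have h2 : 0 ≤ ‖α‖ ^ 2 * (1 - √γ * ‖α‖) ^ 2 / (2 * √γ) := by positivity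
    linarith
  have h2 := integral_mono (integrable_norm_pow_diskMeasure hγ 3)
    (((integrable_norm_pow_diskMeasure hγ 2).const_mul (1 / (2 * √γ))).add
      ((integrable_norm_pow_diskMeasure hγ 4).const_mul (√γ / 2))) h1
  simp only [Pi.add_apply] at h2
  rw [integral_add ((integrable_norm_pow_diskMeasure hγ 2).const_mul (1 / (2 * √γ)))
      ((integrable_norm_pow_diskMeasure hγ 4).const_mul (√γ / 2)), integral_const_mul,
      integral_const_mul, integral_norm_pow_four_diskMeasure hγ] at h2
  have h3 := integral_norm_sq_diskMeasure_le hγ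
  have h4 : 2 / ((γ + 1) * (γ + 2)) ≤ 2 / (γ * γ) := by gcongr <;> linarith
  refine h2.trans ?_
  calc _ ≤ 1 / (2 * √γ) * (1 / γ) + √γ / 2 * (2 / (γ * γ)) := by gcongr
    _ = (3 / 2) / (γ * √γ) := by
      field_simp
      rw [sq, hss]; ring
    _ ≤ _ := by gcongr; norm_num

lemma integral_im_mul_sq {γ : ℝ} (hγ : 0 < γ) (c : ℂ) :
    ∫ α, (α * c).im ^ 2 ∂(diskMeasure γ) = ‖c‖ ^ 2 / (2 * (γ + 1)) := by
  have := isProbabilityMeasure_diskMeasure hγ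
  have hb : ∀ α : ℂ, ‖α‖ < 1 → ‖α * c‖ ≤ ‖c‖ := fun α hα => by
    rw [norm_mul]; nlinarith [norm_nonneg c]
  have h1 : ∫ α, (α * c).im ^ 2 ∂(diskMeasure γ) = ∫ α, (α * c).re ^ 2 ∂(diskMeasure γ) := by
    conv_lhs => rw [← diskMeasure_map_mul Complex.I (by simp)]
    rw [integral_map (by fun_prop) (Measurable.aestronglyMeasurable (by fun_prop))]
    simp [mul_assoc]
  have h2 : ∫ α, (α * c).re ^ 2 ∂(diskMeasure γ) + ∫ α, (α * c).im ^ 2 ∂(diskMeasure γ) =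
      ‖c‖ ^ 2 / (γ + 1) := by
    rw [← integral_add]
    · have : ∀ α : ℂ, (α * c).re ^ 2 + (α * c).im ^ 2 = ‖c‖ ^ 2 * ‖α‖ ^ 2 := fun α => by
        rw [← mul_pow, mul_comm ‖c‖, ← norm_mul, Complex.sq_norm, Complex.normSq_apply]; ring
      simp_rw [this]
      rw [integral_const_mul, integral_norm_sq_diskMeasure hγ]
      ring
    · refine integrable_of_abs_le (Measurable.aestronglyMeasurable (by fun_prop)) (C := ‖c‖ ^ 2)
        ((ae_norm_lt_one_diskMeasure γ).mono fun α hα => ?_)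
      rw [norm_pow]
      gcongr
      exact (Complex.abs_re_le_norm _).trans (hb α hα)
    · refine integrable_of_abs_le (Measurable.aestronglyMeasurable (by fun_prop)) (C := ‖c‖ ^ 2)
        ((ae_norm_lt_one_diskMeasure γ).mono fun α hα => ?_)
      rw [norm_pow]
      gcongr
      exact (Complex.abs_im_le_norm _).trans (hb α hα)
  rw [← h1] at h2
  rw [div_mul_eq_div_div_swap, ← h2]
  ring

lemma norm_exp_I_sub_one_sq (x : ℝ) :
    ‖Complex.exp (x * Complex.I) - 1‖ ^ 2 = 2 * (1 - Real.cos x) := by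
  rw [Complex.sq_norm, Complex.normSq_apply]
  simp only [Complex.sub_re, Complex.sub_im, Complex.exp_ofReal_mul_I_re,
    Complex.exp_ofReal_mul_I_im, Complex.one_re, Complex.one_im]
  nlinarith [Real.sin_sq_add_cos_sq x]

lemma integrable_phaseShift_pow {γ : ℝ} (hγ : 0 < γ) (x : ℝ) (k : ℕ) :
    Integrable (fun α => phaseShift x α ^ k) (diskMeasure γ) := by
  have := isProbabilityMeasure_diskMeasure hγ
  refine integrable_of_abs_le (Measurable.aestronglyMeasurable (by fun_prop)) (C := (4 * Real.pi) ^ k) (ae_of_all _ fun α => ?_)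
  rw [norm_pow]
  exact pow_le_pow_left₀ (norm_nonneg _) (abs_phaseShift_le x α) k

lemma integral_phaseShift_sq_le {γ : ℝ} (hγ : 0 < γ) (x : ℝ) :
    ∫ α, phaseShift x α ^ 2 ∂(diskMeasure γ) ≤ 52 ^ 2 / γ := by
  have h1 : ∀ᵐ α ∂(diskMeasure γ), phaseShift x α ^ 2 ≤ 52 ^ 2 * ‖α‖ ^ 2 := by
    refine (ae_norm_lt_one_diskMeasure γ).mono fun α hα => ?_
    rw [← mul_pow, ← sq_abs]
    exact pow_le_pow_left₀ (abs_nonneg _) (abs_phaseShift_le_norm hα x) 2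
  have h2 := integral_mono_ae (integrable_phaseShift_pow hγ x 2)
    ((integrable_norm_pow_diskMeasure hγ 2).const_mul (52 ^ 2)) h1
  rw [integral_const_mul] at h2
  have h3 := integral_norm_sq_diskMeasure_le hγ
  calc _ ≤ _ := h2
    _ ≤ 52 ^ 2 * (1 / γ) := by gcongr
    _ = _ := by ring

lemma abs_integral_phaseShift_sq_sub_le {γ : ℝ} (hγ : 0 < γ) (x : ℝ) :
    |∫ α, phaseShift x α ^ 2 ∂(diskMeasure γ) - 4 * (1 - Real.cos x) / (γ + 1)| ≤
      6000 / (γ * √γ) := by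
  have := isProbabilityMeasure_diskMeasure hγ
  set c : ℂ := Complex.exp (x * Complex.I) - 1 with hc
  have hL : ∫ α, 4 * (α * c).im ^ 2 ∂(diskMeasure γ) = 4 * (1 - Real.cos x) / (γ + 1) := by
    rw [integral_const_mul, integral_im_mul_sq hγ, hc, norm_exp_I_sub_one_sq]
    field_simp
  have hLi : Integrable (fun α => 4 * (α * c).im ^ 2) (diskMeasure γ) := by
    refine Integrable.const_mul (integrable_of_abs_le (Measurable.aestronglyMeasurable (by fun_prop)) (C := ‖c‖ ^ 2)
        ((ae_norm_lt_one_diskMeasure γ).mono fun α hα => ?_)) _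
    rw [norm_pow]
    gcongr
    refine (Complex.abs_im_le_norm _).trans ?_
    rw [norm_mul]; nlinarith [norm_nonneg c]
  rw [← hL, ← integral_sub (integrable_phaseShift_pow hγ x 2) hLi]
  have hb : ∀ᵐ α ∂(diskMeasure γ), ‖phaseShift x α ^ 2 - 4 * (α * c).im ^ 2‖ ≤
      3000 * ‖α‖ ^ 3 := by
    refine (ae_norm_lt_one_diskMeasure γ).mono fun α hα => ?_
    have h1 := abs_arg_one_sub_add_im_le hα
    have h2 := abs_arg_one_sub_add_im_le (z := α * Complex.exp (x * Complex.I))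
      (by rwa [norm_mul_exp_I])
    rw [norm_mul_exp_I] at h2
    have h3 : (α * c).im = (α * Complex.exp (x * Complex.I)).im - α.im := by
      rw [hc, mul_sub, mul_one, Complex.sub_im]
    have h4 : |phaseShift x α - 2 * (α * c).im| ≤ 48 * ‖α‖ ^ 2 := by
      rw [h3]
      unfold phaseShift
      rw [abs_le] at *
      constructor <;> linarith
    have h5 := abs_phaseShift_le_norm hα x
    have h6 : |2 * (α * c).im| ≤ 4 * ‖α‖ := by
      have h7 := Complex.abs_im_le_norm α
      have h8 := Complex.abs_im_le_norm (α * Complex.exp (x * Complex.I))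
      rw [norm_mul_exp_I] at h8
      rw [h3]
      rw [abs_le] at *
      constructor <;> linarith
    have h7 : phaseShift x α ^ 2 - 4 * (α * c).im ^ 2 =
        (phaseShift x α - 2 * (α * c).im) * (phaseShift x α + 2 * (α * c).im) := by ring
    rw [h7, Real.norm_eq_abs, abs_mul]
    calc _ ≤ 48 * ‖α‖ ^ 2 * (52 * ‖α‖ + 4 * ‖α‖) := by
          gcongr
          exact (abs_add_le _ _).trans (add_le_add h5 h6)
      _ = 2688 * ‖α‖ ^ 3 := by ring
      _ ≤ _ := by gcongr; norm_num
  have h1 := norm_integral_le_of_norm_le ((integrable_norm_pow_diskMeasure hγ 3).const_mul 3000) hb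
  rw [integral_const_mul] at h1
  refine h1.trans ?_
  have h2 := integral_norm_cube_diskMeasure_le hγ
  calc _ ≤ 3000 * (2 / (γ * √γ)) := by gcongr
    _ = _ := by ring

lemma norm_integral_exp_phaseShift_sub_one_le : ∃ C : ℝ, 0 < C ∧ ∀ γ : ℝ, 0 < γ → ∀ x μ : ℝ,
    |μ| ≤ 2 → ‖∫ α, Complex.exp (μ * phaseShift x α * Complex.I) ∂(diskMeasure γ) - 1‖ ≤ C / γ := by
  refine ⟨4 * Real.exp (8 * Real.pi) * 52 ^ 2, by positivity, fun γ hγ x μ hμ => ?_⟩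
  have := isProbabilityMeasure_diskMeasure hγ
  have hi : Integrable (fun α => Complex.exp (μ * phaseShift x α * Complex.I)) (diskMeasure γ) := by
    refine integrable_of_abs_le (Measurable.aestronglyMeasurable (by fun_prop)) (C := 1) (ae_of_all _ fun α => ?_)
    rw [← Complex.ofReal_mul, Complex.norm_exp_ofReal_mul_I]
  have hδ : Integrable (fun α => (phaseShift x α : ℂ)) (diskMeasure γ) := by
    simpa using (integrable_phaseShift_pow hγ x 1).ofReal (𝕜 := ℂ)
  have h0 : ∫ α, (phaseShift x α : ℂ) ∂(diskMeasure γ) = 0 := by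
    rw [integral_complex_ofReal, integral_phaseShift hγ, Complex.ofReal_zero]
  have h1 : ∫ α, Complex.exp (μ * phaseShift x α * Complex.I) ∂(diskMeasure γ) - 1 =
      ∫ α, (Complex.exp (μ * phaseShift x α * Complex.I) - 1 - μ * Complex.I * phaseShift x α)
        ∂(diskMeasure γ) := by
    have hs1 : Integrable (fun α => Complex.exp (μ * phaseShift x α * Complex.I) - 1)
      (diskMeasure γ) := hi.sub (integrable_const _)
    rw [integral_sub hs1 (hδ.const_mul _), integral_const_mul, h0,
      integral_sub hi (integrable_const _)]
    simp
  rw [h1]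
  have hb : ∀ α, ‖Complex.exp (μ * phaseShift x α * Complex.I) - 1
      - μ * Complex.I * phaseShift x α‖ ≤ 4 * Real.exp (8 * Real.pi) * phaseShift x α ^ 2 := by
    intro α
    have h2 := Complex.norm_exp_sub_sum_le_norm_mul_exp (μ * phaseShift x α * Complex.I) 2
    simp only [Finset.sum_range_succ, Finset.sum_range_zero] at h2
    have hn : ‖(μ * phaseShift x α * Complex.I : ℂ)‖ = |μ| * |phaseShift x α| := by
      simp
    rw [hn] at h2
    have h3 : |μ| * |phaseShift x α| ≤ 2 * |phaseShift x α| := by gcongr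
    have h4 : |μ| * |phaseShift x α| ≤ 8 * Real.pi := by
      linarith [abs_phaseShift_le x α]
    have e : Complex.exp (μ * phaseShift x α * Complex.I) - 1 - μ * Complex.I * phaseShift x α =
      Complex.exp (μ * phaseShift x α * Complex.I) - (0 + (μ * phaseShift x α * Complex.I) ^ 0 /
        (Nat.factorial 0 : ℂ) + (μ * phaseShift x α * Complex.I) ^ 1 / (Nat.factorial 1 : ℂ)) := by
      simp; ring
    rw [e]
    refine h2.trans ?_
    calc _ ≤ (2 * |phaseShift x α|) ^ 2 * Real.exp (8 * Real.pi) := by gcongr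
      _ = _ := by rw [mul_pow, sq_abs]; ring
  have h2 := norm_integral_le_of_norm_le ((integrable_phaseShift_pow hγ x 2).const_mul
    (4 * Real.exp (8 * Real.pi))) (ae_of_all _ hb)
  rw [integral_const_mul] at h2
  refine h2.trans ?_
  have h3 := integral_phaseShift_sq_le hγ x
  calc _ ≤ 4 * Real.exp (8 * Real.pi) * (52 ^ 2 / γ) := by gcongr
    _ = _ := by ring

lemma norm_integral_exp_phaseShift_expansion_le : ∃ C : ℝ, 0 < C ∧ ∀ γ : ℝ, 0 < γ → ∀ x μ : ℝ,
    |μ| ≤ 1 → ‖∫ α, Complex.exp (μ * phaseShift x α * Complex.I) ∂(diskMeasure γ) -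
      (1 - 2 * μ ^ 2 * (1 - Real.cos x) / (γ + 1) : ℝ)‖ ≤ C * μ ^ 2 / (γ * √γ) := by
  refine ⟨3000 + Real.exp (4 * Real.pi) * 52 ^ 3 * 2, by positivity, fun γ hγ x μ hμ => ?_⟩
  have := isProbabilityMeasure_diskMeasure hγ
  have hi : Integrable (fun α => Complex.exp (μ * phaseShift x α * Complex.I)) (diskMeasure γ) := by
    refine integrable_of_abs_le (Measurable.aestronglyMeasurable (by fun_prop)) (C := 1) (ae_of_all _ fun α => ?_)
    rw [← Complex.ofReal_mul, Complex.norm_exp_ofReal_mul_I]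
  have hδ : Integrable (fun α => (phaseShift x α : ℂ)) (diskMeasure γ) := by
    simpa using (integrable_phaseShift_pow hγ x 1).ofReal (𝕜 := ℂ)
  have hδ2 : Integrable (fun α => ((phaseShift x α ^ 2 : ℝ) : ℂ)) (diskMeasure γ) :=
    (integrable_phaseShift_pow hγ x 2).ofReal (𝕜 := ℂ)
  have h0 : ∫ α, (phaseShift x α : ℂ) ∂(diskMeasure γ) = 0 := by
    rw [integral_complex_ofReal, integral_phaseShift hγ, Complex.ofReal_zero]
  have h1 : ∫ α, Complex.exp (μ * phaseShift x α * Complex.I) ∂(diskMeasure γ) -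
      (1 - 2 * μ ^ 2 * (1 - Real.cos x) / (γ + 1) : ℝ) =
      ∫ α, (Complex.exp (μ * phaseShift x α * Complex.I) - 1 - μ * Complex.I * phaseShift x α
        + (μ ^ 2 / 2) * (phaseShift x α ^ 2 : ℝ)) ∂(diskMeasure γ)
       - ((μ ^ 2 / 2 * (∫ α, phaseShift x α ^ 2 ∂(diskMeasure γ) -
          4 * (1 - Real.cos x) / (γ + 1)) : ℝ) : ℂ) := by
    have hs1 : Integrable (fun α => Complex.exp (μ * phaseShift x α * Complex.I) - 1)
      (diskMeasure γ) := hi.sub (integrable_const _)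
    have hs2 : Integrable (fun α => Complex.exp (μ * phaseShift x α * Complex.I) - 1
      - μ * Complex.I * phaseShift x α) (diskMeasure γ) := hs1.sub (hδ.const_mul _)
    rw [integral_add hs2 (hδ2.const_mul _), integral_sub hs1 (hδ.const_mul _), integral_const_mul,
      h0, integral_sub hi (integrable_const _), integral_const_mul, integral_complex_ofReal]
    push_cast
    simp
    ring
  rw [h1]
  have hb : ∀ᵐ α ∂(diskMeasure γ), ‖Complex.exp (μ * phaseShift x α * Complex.I) - 1
      - μ * Complex.I * phaseShift x α + (μ ^ 2 / 2) * (phaseShift x α ^ 2 : ℝ)‖ ≤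
      μ ^ 2 * Real.exp (4 * Real.pi) * 52 ^ 3 * ‖α‖ ^ 3 := by
    refine (ae_norm_lt_one_diskMeasure γ).mono fun α hα => ?_
    have h2 := Complex.norm_exp_sub_sum_le_norm_mul_exp (μ * phaseShift x α * Complex.I) 3
    simp only [Finset.sum_range_succ, Finset.sum_range_zero] at h2
    have hn : ‖(μ * phaseShift x α * Complex.I : ℂ)‖ = |μ| * |phaseShift x α| := by
      simp
    rw [hn] at h2
    have h3 := abs_phaseShift_le_norm hα x
    have h4 : |μ| * |phaseShift x α| ≤ 4 * Real.pi := by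
      nlinarith [abs_phaseShift_le x α, abs_nonneg μ, abs_nonneg (phaseShift x α)]
    have e : Complex.exp (μ * phaseShift x α * Complex.I) - 1 - μ * Complex.I * phaseShift x α
        + (μ ^ 2 / 2) * (phaseShift x α ^ 2 : ℝ) =
      Complex.exp (μ * phaseShift x α * Complex.I) - (0 + (μ * phaseShift x α * Complex.I) ^ 0 /
        (Nat.factorial 0 : ℂ) + (μ * phaseShift x α * Complex.I) ^ 1 / (Nat.factorial 1 : ℂ) +
        (μ * phaseShift x α * Complex.I) ^ 2 / (Nat.factorial 2 : ℂ)) := by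
      simp [mul_pow]; ring
    rw [e]
    refine h2.trans ?_
    calc _ ≤ (|μ| * (52 * ‖α‖)) ^ 3 * Real.exp (4 * Real.pi) := by gcongr
      _ = |μ| * (μ ^ 2 * (52 ^ 3 * ‖α‖ ^ 3 * Real.exp (4 * Real.pi))) := by
        rw [← sq_abs μ]; ring
      _ ≤ 1 * (μ ^ 2 * (52 ^ 3 * ‖α‖ ^ 3 * Real.exp (4 * Real.pi))) := by gcongr
      _ = _ := by ring
  have h2 := norm_integral_le_of_norm_le ((integrable_norm_pow_diskMeasure hγ 3).const_mul
    (μ ^ 2 * Real.exp (4 * Real.pi) * 52 ^ 3)) hb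
  rw [integral_const_mul] at h2
  have h3 := integral_norm_cube_diskMeasure_le hγ
  have h4 := abs_integral_phaseShift_sq_sub_le hγ x
  refine (norm_sub_le _ _).trans ?_
  rw [Complex.norm_real, norm_mul, Real.norm_eq_abs, Real.norm_eq_abs,
    abs_of_nonneg (by positivity : 0 ≤ μ ^ 2 / 2)]
  calc _ ≤ μ ^ 2 * Real.exp (4 * Real.pi) * 52 ^ 3 * (2 / (γ * √γ)) +
        μ ^ 2 / 2 * (6000 / (γ * √γ)) := by
        gcongr
        exact h2.trans (by gcongr)
    _ = _ := by ring

lemma abs_rpow_ratio_sub_le {b : ℝ} (hb : 0 ≤ b) {k : ℕ} (hk : 1 ≤ k) :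
    |((k : ℝ) / (k + 1)) ^ b - (1 - b / k)| ≤ (b + b ^ 2) / k ^ 2 := by
  have hk0 : (0 : ℝ) < k := by exact_mod_cast hk
  have hlog1 : Real.log (((k : ℝ) + 1) / k) ≤ 1 / k := by
    have := Real.log_le_sub_one_of_pos (show 0 < ((k : ℝ) + 1) / k by positivity)
    refine this.trans (le_of_eq ?_)
    field_simp; ring
  have hlog2 : 1 / ((k : ℝ) + 1) ≤ Real.log (((k : ℝ) + 1) / k) := by
    have := Real.log_le_sub_one_of_pos (show 0 < (k : ℝ) / (k + 1) by positivity)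
    rw [← inv_div ((k : ℝ) + 1), Real.log_inv, inv_div] at this
    have h : (k : ℝ) / (k + 1) - 1 = -(1 / (k + 1)) := by field_simp; ring
    rw [h] at this
    linarith
  set y := b * Real.log (((k : ℝ) + 1) / k) with hy
  have hy0 : 0 ≤ y := mul_nonneg hb (le_trans (by positivity) hlog2)
  have hpow : ((k : ℝ) / (k + 1)) ^ b = Real.exp (-y) := by
    rw [Real.rpow_def_of_pos (by positivity), hy, ← inv_div, Real.log_inv]
    ring_nf
  have hyk : y ≤ b / k := by
    rw [hy]; calc _ ≤ b * (1 / k) := by gcongr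
      _ = _ := by ring
  have hyk2 : b / k - b / k ^ 2 ≤ y := by
    have h1 : (1 : ℝ) / k - 1 / k ^ 2 ≤ 1 / (k + 1) := by
      rw [div_sub_div _ _ (by positivity) (by positivity), div_le_div_iff₀ (by positivity) (by positivity)]
      nlinarith
    calc _ = b * (1 / k - 1 / k ^ 2) := by ring
      _ ≤ b * (1 / (k + 1)) := by gcongr
      _ ≤ _ := by rw [hy]; gcongr
  have he1 : 1 - y ≤ Real.exp (-y) := by linarith [Real.add_one_le_exp (-y)]
  have he2 : Real.exp (-y) ≤ 1 - y + y ^ 2 := by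
    have h1 : Real.exp (-y) * (1 + y) ≤ 1 := by
      calc _ ≤ Real.exp (-y) * Real.exp y := by
            gcongr; linarith [Real.add_one_le_exp y]
        _ = 1 := by rw [← Real.exp_add]; simp
    have h2 : 1 ≤ (1 - y + y ^ 2) * (1 + y) := by nlinarith [pow_nonneg hy0 3]
    nlinarith
  have hy2 : y ^ 2 ≤ b ^ 2 / k ^ 2 := by
    rw [← div_pow]; gcongr
  have e : (b + b ^ 2) / (k : ℝ) ^ 2 = b / k ^ 2 + b ^ 2 / k ^ 2 := by ring
  have : 0 ≤ b / (k : ℝ) ^ 2 := by positivity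
  rw [hpow, e, abs_le]
  constructor
  · linarith [sq_nonneg y, (by positivity : 0 ≤ b ^ 2 / (k : ℝ) ^ 2)]
  · linarith

lemma two_mul_div_pi_le_norm_exp_sub_one {t : ℝ} (ht0 : 0 < t) (ht : t ≤ Real.pi) :
    2 * t / Real.pi ≤ ‖Complex.exp (t * Complex.I) - 1‖ := by
  have h1 : 2 / Real.pi * (t / 2) ≤ Real.sin (t / 2) :=
    Real.mul_le_sin (by linarith) (by linarith)
  have h2 : ‖Complex.exp (t * Complex.I) - 1‖ = 2 * Real.sin (t / 2) := by
    have h3 := norm_exp_I_sub_one_sq t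
    have h4 : 2 * (1 - Real.cos t) = (2 * Real.sin (t / 2)) ^ 2 := by
      have := Real.cos_sq' (t / 2)
      have h5 := Real.cos_two_mul (t / 2)
      rw [mul_div_cancel₀ t (by norm_num)] at h5
      rw [h5]; nlinarith
    rw [h4] at h3
    refine (sq_eq_sq₀ (norm_nonneg _) ?_).1 h3
    have := Real.pi_pos
    have : 0 ≤ 2 / Real.pi * (t / 2) := by positivity
    linarith
  rw [h2]
  calc _ = 2 * (2 / Real.pi * (t / 2)) := by ring
    _ ≤ _ := by gcongr

lemma inv_mul_sqrt_le {k : ℕ} (hk : 1 ≤ k) :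
    1 / ((k : ℝ) * √k) ≤ 4 * (1 / √k - 1 / √((k + 1 : ℕ) : ℝ)) := by
  have hk0 : (1 : ℝ) ≤ k := by exact_mod_cast hk
  set a := √(k : ℝ) with ha
  set b := √((k + 1 : ℕ) : ℝ) with hb
  have ha2 : a ^ 2 = k := Real.sq_sqrt (by positivity)
  have hb2 : b ^ 2 = k + 1 := by rw [hb, Real.sq_sqrt (by positivity)]; push_cast; ring
  have ha0 : 0 < a := Real.sqrt_pos.2 (by linarith)
  have hb0 : 0 < b := Real.sqrt_pos.2 (by positivity)
  have hb' : b ≤ 3 / 2 * a := by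
    refine (sq_le_sq₀ hb0.le (by positivity)).1 ?_
    nlinarith
  have hab : a ≤ b := by
    refine (sq_le_sq₀ ha0.le hb0.le).1 ?_
    linarith
  have h1 : 1 / a - 1 / b = 1 / (a * b * (a + b)) := by
    rw [div_sub_div _ _ ha0.ne' hb0.ne', div_eq_div_iff (by positivity) (by positivity)]
    have : (b - a) * (a + b) = 1 := by nlinarith
    linear_combination (a * b) * this
  rw [h1, ← ha2]
  rw [mul_one_div, div_le_div_iff₀ (by positivity) (by positivity)]
  have : b * (a + b) ≤ 4 * a ^ 2 := by nlinarith
  nlinarith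

lemma sum_error_le {C r : ℝ} (hC : 0 ≤ C) (hr : 0 ≤ r) {k₀ : ℕ} (hk : 1 ≤ k₀) (hrk : r ≤ k₀) (n : ℕ) :
    ∑ k ∈ Finset.Ico k₀ n, C * (1 / ((k : ℝ) * √k) + r / k ^ 2) ≤ 6 * C := by
  rcases le_total k₀ n with hn | hn
  swap
  · rw [Finset.Ico_eq_empty_of_le hn]; simpa using hC
  have hk0 : (1 : ℝ) ≤ k₀ := by exact_mod_cast hk
  let F : ℕ → ℝ := fun j => -(C * (4 * (1 / √(j : ℝ)) + 2 * r * (1 / j)))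
  have h1 : ∀ k ∈ Finset.Ico k₀ n, C * (1 / ((k : ℝ) * √k) + r / k ^ 2) ≤
      F (k + 1)
      - F k := by
    intro k hkm
    have hk1 : 1 ≤ k := hk.trans (Finset.mem_Ico.1 hkm).1
    have hk1' : (1 : ℝ) ≤ k := by exact_mod_cast hk1
    have h2 := inv_mul_sqrt_le hk1
    have h3 : 1 / (k : ℝ) ^ 2 ≤ 2 * (1 / k - 1 / ((k + 1 : ℕ) : ℝ)) := by
      push_cast
      rw [div_sub_div _ _ (by positivity) (by positivity), mul_div_assoc', div_le_div_iff₀ (by positivity) (by positivity)]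
      nlinarith
    have h4 : r / (k : ℝ) ^ 2 ≤ r * (2 * (1 / k - 1 / ((k + 1 : ℕ) : ℝ))) := by
      rw [div_eq_mul_one_div]; gcongr
    calc _ ≤ C * (4 * (1 / √k - 1 / √((k + 1 : ℕ) : ℝ)) + r * (2 * (1 / k - 1 / ((k + 1 : ℕ) : ℝ)))) := by
          gcongr
      _ = _ := by simp only [F]; ring
  refine (Finset.sum_le_sum h1).trans ?_
  rw [Finset.sum_Ico_eq_sub _ hn, Finset.sum_range_sub F, Finset.sum_range_sub F]
  simp only [F]
  have h5 : 1 / √(k₀ : ℝ) ≤ 1 := by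
    rw [div_le_one (by positivity)]; exact Real.one_le_sqrt.2 hk0
  have h6 : r * (1 / k₀) ≤ 1 := by
    rw [mul_one_div, div_le_one (by positivity)]; exact hrk
  have h7 : 0 ≤ C * (4 * (1 / √(n : ℝ)) + 2 * r * (1 / n)) := by positivity
  have h8 : C * (4 * (1 / √(k₀ : ℝ)) + 2 * r * (1 / k₀)) ≤ C * (4 * 1 + 2 * 1) := by
    rw [mul_assoc 2]; gcongr
  linarith

/-- The second-moment coefficient of the phase recursion. -/
def phaseCoef (β l : ℝ) (k : ℕ) : ℝ := l ^ 2 / (k * (β / 2) + 1)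

section recursion

variable {β l : ℝ}

lemma phaseCoef_nonneg (hβ : 0 < β) (k : ℕ) : 0 ≤ phaseCoef β l k := by
  unfold phaseCoef; positivity

lemma phaseCoef_le (hβ : 0 < β) {k : ℕ} (hk : 1 ≤ k) : phaseCoef β l k ≤ 2 * l ^ 2 / (β * k) := by
  have hk0 : (1 : ℝ) ≤ k := by exact_mod_cast hk
  unfold phaseCoef
  rw [div_le_div_iff₀ (by positivity) (by positivity)]
  nlinarith [sq_nonneg l]

lemma phaseCoef_succ_le (hβ : 0 < β) {k : ℕ} (hk : 1 ≤ k) :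
    phaseCoef β l (k + 1) ≤ 2 * l ^ 2 / (β * k) := by
  refine (phaseCoef_le hβ (by omega)).trans ?_
  have hk0 : (1 : ℝ) ≤ k := by exact_mod_cast hk
  push_cast
  gcongr
  linarith

lemma abs_phaseCoef_succ_sub_le (hβ : 0 < β) {k : ℕ} (hk : 1 ≤ k) :
    |phaseCoef β l (k + 1) - phaseCoef β l k| ≤ 2 * l ^ 2 / (β * k ^ 2) := by
  have hk0 : (1 : ℝ) ≤ k := by exact_mod_cast hk
  unfold phaseCoef
  have e : l ^ 2 / (((k + 1 : ℕ) : ℝ) * (β / 2) + 1) - l ^ 2 / (k * (β / 2) + 1) =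
      -(l ^ 2 * (β / 2) / (((k + 1 : ℕ) * (β / 2) + 1) * (k * (β / 2) + 1))) := by
    push_cast
    field_simp
    ring
  rw [e, abs_neg, abs_of_nonneg (by positivity)]
  calc _ ≤ l ^ 2 * (β / 2) / ((k * (β / 2)) * (k * (β / 2))) := by
        push_cast
        gcongr <;> nlinarith
    _ = _ := by field_simp

lemma abs_rpow_ratio_sub_phaseCoef_le (hβ : 0 < β) (hl : |l| ≤ 1) {k : ℕ} (hk : 1 ≤ k) :
    |1 - 2 * phaseCoef β l k - ((k : ℝ) / (k + 1)) ^ (4 * l ^ 2 / β)| ≤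
      (4 / β + 24 / β ^ 2) * (l ^ 2 / k ^ 2) := by
  have hk0 : (1 : ℝ) ≤ k := by exact_mod_cast hk
  have hl2 : l ^ 2 ≤ 1 := (sq_le_one_iff_abs_le_one l).2 hl
  have h1 := abs_rpow_ratio_sub_le (b := 4 * l ^ 2 / β) (by positivity) hk
  have h2 : (4 * l ^ 2 / β + (4 * l ^ 2 / β) ^ 2) / (k : ℝ) ^ 2 ≤
      (4 / β + 16 / β ^ 2) * (l ^ 2 / k ^ 2) := by
    have : (4 * l ^ 2 / β) ^ 2 ≤ 16 / β ^ 2 * l ^ 2 := by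
      rw [div_pow, mul_pow]
      calc _ = 16 / β ^ 2 * (l ^ 2 * l ^ 2) := by ring
        _ ≤ 16 / β ^ 2 * (l ^ 2 * 1) := by gcongr
        _ = _ := by ring
    calc _ ≤ (4 * l ^ 2 / β + 16 / β ^ 2 * l ^ 2) / (k : ℝ) ^ 2 := by gcongr
      _ = _ := by ring
  have h3 : |4 * l ^ 2 / β / k - 2 * phaseCoef β l k| ≤ 8 / β ^ 2 * (l ^ 2 / k ^ 2) := by
    unfold phaseCoef
    have e : 4 * l ^ 2 / β / k - 2 * (l ^ 2 / (k * (β / 2) + 1)) =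
        2 * l ^ 2 / ((k * (β / 2)) * (k * (β / 2) + 1)) := by
      field_simp; ring
    rw [e, abs_of_nonneg (by positivity)]
    calc _ ≤ 2 * l ^ 2 / ((k * (β / 2)) * (k * (β / 2))) := by
          gcongr; linarith
      _ = _ := by field_simp; ring
  have e2 : 1 - 2 * phaseCoef β l k - ((k : ℝ) / (k + 1)) ^ (4 * l ^ 2 / β) =
      (4 * l ^ 2 / β / k - 2 * phaseCoef β l k) -
      (((k : ℝ) / (k + 1)) ^ (4 * l ^ 2 / β) - (1 - 4 * l ^ 2 / β / k)) := by ring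
  rw [e2]
  refine (abs_sub _ _).trans ?_
  have e3 : (4 / β + 24 / β ^ 2) * (l ^ 2 / (k : ℝ) ^ 2) =
    8 / β ^ 2 * (l ^ 2 / k ^ 2) + (4 / β + 16 / β ^ 2) * (l ^ 2 / k ^ 2) := by ring
  rw [e3]
  exact add_le_add h3 (h1.trans h2)

lemma norm_corrector_le (hβ : 0 < β) {t : ℝ} (ht0 : 0 < t) {k j : ℕ} (hk : 1 ≤ k)
    (hj : phaseCoef β l j ≤ 2 * l ^ 2 / (β * k)) {e : ℂ} (he : t / 2 ≤ ‖e‖) {x : ℂ} {b : ℝ}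
    (hx : ‖x‖ ≤ b) :
    ‖-(phaseCoef β l j : ℂ) / e * x‖ ≤ 4 * l ^ 2 / (β * k * t) * b := by
  have hk0 : (1 : ℝ) ≤ k := by exact_mod_cast hk
  rw [norm_mul, norm_div, norm_neg, Complex.norm_real, Real.norm_eq_abs,
    abs_of_nonneg (phaseCoef_nonneg hβ j)]
  calc _ ≤ (2 * l ^ 2 / (β * k)) / (t / 2) * b := by gcongr
    _ = _ := by field_simp; ring

/-- The constant in the one-step estimate of the corrected recursion. -/
def stepConst (β C₀ : ℝ) : ℝ :=
  C₀ + 8 * C₀ / β + 8 / β + 32 / β ^ 2 + (4 / β + 24 / β ^ 2) * (1 + 8 / β)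

lemma corrected_step (hβ : 0 < β) {C₀ : ℝ} (hC₀ : 0 ≤ C₀) {t : ℝ} (ht0 : 0 < t) (hl : |l| ≤ 1)
    {E F : ℂ} (hE : ‖E‖ = 1) (hF : ‖F‖ = 1) (hE1 : t / 2 ≤ ‖E - 1‖) (hF1 : t / 2 ≤ ‖F - 1‖)
    {k : ℕ} (hk : 1 ≤ k) (hkt : 1 / t ≤ k) {u p m u' p' m' : ℂ}
    (hu : ‖u‖ ≤ 1) (hp : ‖p‖ ≤ 1) (hm : ‖m‖ ≤ 1)
    (hu' : ‖u' - (u * (1 - 2 * phaseCoef β l k) + phaseCoef β l k * (p + m))‖ ≤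
      C₀ * l ^ 2 / (k * √k))
    (hp' : ‖p' - E * p‖ ≤ C₀ / k) (hm' : ‖m' - F * m‖ ≤ C₀ / k) :
    ‖(u' + -(phaseCoef β l (k + 1) : ℂ) / (E - 1) * p' +
        -(phaseCoef β l (k + 1) : ℂ) / (F - 1) * m') -
      (((k : ℝ) / (k + 1)) ^ (4 * l ^ 2 / β) : ℝ) *
        (u + -(phaseCoef β l k : ℂ) / (E - 1) * p + -(phaseCoef β l k : ℂ) / (F - 1) * m)‖ ≤
      stepConst β C₀ * l ^ 2 * (1 / ((k : ℝ) * √k) + (1 / t) / k ^ 2) := by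
  have hk0 : (1 : ℝ) ≤ k := by exact_mod_cast hk
  have hl2 : l ^ 2 ≤ 1 := (sq_le_one_iff_abs_le_one l).2 hl
  have hEn : E - 1 ≠ 0 := norm_pos_iff.1 (lt_of_lt_of_le (by positivity) hE1)
  have hFn : F - 1 ≠ 0 := norm_pos_iff.1 (lt_of_lt_of_le (by positivity) hF1)
  set c := phaseCoef β l k with hc
  set c' := phaseCoef β l (k + 1) with hc'
  set a := ((k : ℝ) / (k + 1)) ^ (4 * l ^ 2 / β) with ha
  set ru := u' - (u * (1 - 2 * c) + c * (p + m)) with hru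
  set rp := p' - E * p with hrp
  set rm := m' - F * m with hrm
  have hid : (u' + -(c' : ℂ) / (E - 1) * p' + -(c' : ℂ) / (F - 1) * m') -
      (a : ℂ) * (u + -(c : ℂ) / (E - 1) * p + -(c : ℂ) / (F - 1) * m) =
      ru + -(c' : ℂ) / (E - 1) * rp + -(c' : ℂ) / (F - 1) * rm
      + -((c' - c : ℝ) : ℂ) / (E - 1) * (E * p) + -((c' - c : ℝ) : ℂ) / (F - 1) * (F * m)
      + 2 * c * (-(c : ℂ) / (E - 1) * p) + 2 * c * (-(c : ℂ) / (F - 1) * m)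
      + ((1 - 2 * c - a : ℝ) : ℂ) * (u + -(c : ℂ) / (E - 1) * p + -(c : ℂ) / (F - 1) * m) := by
    rw [hru, hrp, hrm]
    push_cast
    field_simp
    ring
  have b2 := norm_corrector_le hβ ht0 hk (phaseCoef_succ_le (l := l) hβ hk) hE1 hp'
  have b3 := norm_corrector_le hβ ht0 hk (phaseCoef_succ_le (l := l) hβ hk) hF1 hm'
  have b4 : ∀ {e x : ℂ}, t / 2 ≤ ‖e‖ → ‖x‖ ≤ 1 →
      ‖-((c' - c : ℝ) : ℂ) / e * x‖ ≤ 4 * l ^ 2 / (β * k ^ 2 * t) := by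
    intro e x he hx
    rw [norm_mul, norm_div, norm_neg, Complex.norm_real, Real.norm_eq_abs]
    calc _ ≤ (2 * l ^ 2 / (β * k ^ 2)) / (t / 2) * 1 := by
          gcongr
          exact abs_phaseCoef_succ_sub_le hβ hk
      _ = _ := by field_simp; ring
  have b4E : ‖E * p‖ ≤ 1 := by rw [norm_mul, hE, one_mul]; exact hp
  have b4F : ‖F * m‖ ≤ 1 := by rw [norm_mul, hF, one_mul]; exact hm
  have b5E := norm_corrector_le hβ ht0 hk (phaseCoef_le (l := l) hβ hk) hE1 hp
  have b5F := norm_corrector_le hβ ht0 hk (phaseCoef_le (l := l) hβ hk) hF1 hm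
  rw [← hc, mul_one] at b5E b5F
  have b6 : ∀ {x : ℂ}, ‖x‖ ≤ 4 * l ^ 2 / (β * k * t) →
      ‖2 * (c : ℂ) * x‖ ≤ 16 / β ^ 2 * l ^ 2 * ((1 / t) / k ^ 2) := by
    intro x hx
    rw [norm_mul, norm_mul, Complex.norm_real, Real.norm_eq_abs,
      abs_of_nonneg (phaseCoef_nonneg hβ k), Complex.norm_ofNat]
    calc _ ≤ 2 * (2 * l ^ 2 / (β * k)) * (4 * l ^ 2 / (β * k * t)) := by
          gcongr
          exact phaseCoef_le hβ hk
      _ = 16 / β ^ 2 * (l ^ 2 * l ^ 2) * ((1 / t) / k ^ 2) := by field_simp; ring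
      _ ≤ 16 / β ^ 2 * (l ^ 2 * 1) * ((1 / t) / k ^ 2) := by gcongr
      _ = _ := by ring
  have b7 : 4 * l ^ 2 / (β * k * t) ≤ 4 / β := by
    have : 1 ≤ k * t := by
      rw [div_le_iff₀ ht0] at hkt; exact hkt
    calc _ ≤ 4 * 1 / (β * 1) := by rw [mul_assoc]; gcongr
      _ = _ := by ring
  have b8 : ‖u + -(c : ℂ) / (E - 1) * p + -(c : ℂ) / (F - 1) * m‖ ≤ 1 + 8 / β := by
    refine (norm_add₃_le).trans ?_
    calc _ ≤ 1 + 4 / β + 4 / β := by gcongr <;> [exact b5E.trans b7; exact b5F.trans b7]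
      _ = _ := by ring
  have hs : 1 / (k : ℝ) ^ 2 ≤ 1 / (k * √k) := by
    rw [sq]; gcongr
    exact Real.sqrt_le_self_iff.2 (Or.inr hk0)
  have b9 : ‖((1 - 2 * c - a : ℝ) : ℂ) *
      (u + -(c : ℂ) / (E - 1) * p + -(c : ℂ) / (F - 1) * m)‖ ≤
      (4 / β + 24 / β ^ 2) * (1 + 8 / β) * l ^ 2 * (1 / (k * √k)) := by
    rw [norm_mul, Complex.norm_real, Real.norm_eq_abs]
    calc _ ≤ (4 / β + 24 / β ^ 2) * (l ^ 2 / k ^ 2) * (1 + 8 / β) := by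
          gcongr
          exact abs_rpow_ratio_sub_phaseCoef_le hβ hl hk
      _ = (4 / β + 24 / β ^ 2) * (1 + 8 / β) * l ^ 2 * (1 / k ^ 2) := by ring
      _ ≤ _ := by gcongr
  rw [hid]
  have n1 := norm_add_le (ru + -(c' : ℂ) / (E - 1) * rp + -(c' : ℂ) / (F - 1) * rm
      + -((c' - c : ℝ) : ℂ) / (E - 1) * (E * p) + -((c' - c : ℝ) : ℂ) / (F - 1) * (F * m)
      + 2 * c * (-(c : ℂ) / (E - 1) * p) + 2 * c * (-(c : ℂ) / (F - 1) * m))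
      (((1 - 2 * c - a : ℝ) : ℂ) * (u + -(c : ℂ) / (E - 1) * p + -(c : ℂ) / (F - 1) * m))
  have n2 := norm_add_le (ru + -(c' : ℂ) / (E - 1) * rp + -(c' : ℂ) / (F - 1) * rm
      + -((c' - c : ℝ) : ℂ) / (E - 1) * (E * p) + -((c' - c : ℝ) : ℂ) / (F - 1) * (F * m)
      + 2 * c * (-(c : ℂ) / (E - 1) * p)) (2 * c * (-(c : ℂ) / (F - 1) * m))
  have n3 := norm_add_le (ru + -(c' : ℂ) / (E - 1) * rp + -(c' : ℂ) / (F - 1) * rm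
      + -((c' - c : ℝ) : ℂ) / (E - 1) * (E * p) + -((c' - c : ℝ) : ℂ) / (F - 1) * (F * m))
      (2 * c * (-(c : ℂ) / (E - 1) * p))
  have n4 := norm_add_le (ru + -(c' : ℂ) / (E - 1) * rp + -(c' : ℂ) / (F - 1) * rm
      + -((c' - c : ℝ) : ℂ) / (E - 1) * (E * p)) (-((c' - c : ℝ) : ℂ) / (F - 1) * (F * m))
  have n5 := norm_add_le (ru + -(c' : ℂ) / (E - 1) * rp + -(c' : ℂ) / (F - 1) * rm)
      (-((c' - c : ℝ) : ℂ) / (E - 1) * (E * p))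
  have n6 := norm_add₃_le (a := ru) (b := -(c' : ℂ) / (E - 1) * rp) (c := -(c' : ℂ) / (F - 1) * rm)
  have m4 := b4 hE1 b4E
  have m5 := b4 hF1 b4F
  have m6 := b6 b5E
  have m7 := b6 b5F
  have hX : 0 ≤ 1 / ((k : ℝ) * √k) := by positivity
  have hY : 0 ≤ (1 / t) / (k : ℝ) ^ 2 := by positivity
  have e1 : C₀ * l ^ 2 / (k * √k) = C₀ * l ^ 2 * (1 / (k * √k)) := by ring
  have e2 : 4 * l ^ 2 / (β * k * t) * (C₀ / k) = 4 * C₀ / β * l ^ 2 * ((1 / t) / k ^ 2) := by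
    field_simp
  have e3 : 4 * l ^ 2 / (β * k ^ 2 * t) = 4 / β * l ^ 2 * ((1 / t) / k ^ 2) := by field_simp
  rw [e1] at hu'
  rw [e2] at b2 b3
  rw [e3] at m4 m5
  have tot : ‖ru + -(c' : ℂ) / (E - 1) * rp + -(c' : ℂ) / (F - 1) * rm
      + -((c' - c : ℝ) : ℂ) / (E - 1) * (E * p) + -((c' - c : ℝ) : ℂ) / (F - 1) * (F * m)
      + 2 * c * (-(c : ℂ) / (E - 1) * p) + 2 * c * (-(c : ℂ) / (F - 1) * m)
      + ((1 - 2 * c - a : ℝ) : ℂ) * (u + -(c : ℂ) / (E - 1) * p + -(c : ℂ) / (F - 1) * m)‖ ≤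
      (C₀ + (4 / β + 24 / β ^ 2) * (1 + 8 / β)) * l ^ 2 * (1 / (k * √k)) +
      (8 * C₀ / β + 8 / β + 32 / β ^ 2) * l ^ 2 * ((1 / t) / k ^ 2) := by
    linear_combination n1 + n2 + n3 + n4 + n5 + n6 + hu' + b2 + b3 + m4 + m5 + m6 + m7 + b9
  refine tot.trans ?_
  rw [mul_add (stepConst β C₀ * l ^ 2)]
  unfold stepConst
  have : 0 ≤ (4 / β + 24 / β ^ 2) * (1 + 8 / β) := by positivity
  have : 0 ≤ 8 * C₀ / β := by positivity
  have : 0 ≤ 8 / β := by positivity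
  have : 0 ≤ 32 / β ^ 2 := by positivity
  refine add_le_add (mul_le_mul_of_nonneg_right (mul_le_mul_of_nonneg_right ?_ (sq_nonneg l)) hX)
    (mul_le_mul_of_nonneg_right (mul_le_mul_of_nonneg_right ?_ (sq_nonneg l)) hY) <;> linarith

lemma stepConst_nonneg (hβ : 0 < β) {C₀ : ℝ} (hC₀ : 0 ≤ C₀) : 0 ≤ stepConst β C₀ := by
  unfold stepConst; positivity

lemma norm_sub_rpow_le_of_recursion (hβ : 0 < β) {C₀ : ℝ} (hC₀ : 0 ≤ C₀) {t : ℝ} (ht0 : 0 < t)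
    (hl : |l| ≤ 1) {E F : ℂ} (hE : ‖E‖ = 1) (hF : ‖F‖ = 1) (hE1 : t / 2 ≤ ‖E - 1‖)
    (hF1 : t / 2 ≤ ‖F - 1‖) {u p m : ℕ → ℂ}
    (hu : ∀ k, ‖u k‖ ≤ 1) (hp : ∀ k, ‖p k‖ ≤ 1) (hm : ∀ k, ‖m k‖ ≤ 1)
    (hu' : ∀ k, 1 ≤ k → ‖u (k + 1) - (u k * (1 - 2 * phaseCoef β l k) +
      phaseCoef β l k * (p k + m k))‖ ≤ C₀ * l ^ 2 / (k * √k))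
    (hp' : ∀ k, 1 ≤ k → ‖p (k + 1) - E * p k‖ ≤ C₀ / k)
    (hm' : ∀ k, 1 ≤ k → ‖m (k + 1) - F * m k‖ ≤ C₀ / k)
    {k₀ n : ℕ} (hk₀ : 1 ≤ k₀) (hkt : 1 / t ≤ k₀) (hn : k₀ ≤ n) :
    ‖u n - (((k₀ : ℝ) / n) ^ (4 * l ^ 2 / β) : ℝ)‖ ≤
      ‖u k₀ - 1‖ + (6 * stepConst β C₀ + 16 / β) * l ^ 2 := by
  set b := 4 * l ^ 2 / β with hb
  have hb0 : 0 ≤ b := by positivity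
  have hk₀' : (1 : ℝ) ≤ k₀ := by exact_mod_cast hk₀
  let Z : ℕ → ℂ := fun k => u k + -(phaseCoef β l k : ℂ) / (E - 1) * p k +
        -(phaseCoef β l k : ℂ) / (F - 1) * m k
  have hZu : ∀ k, k₀ ≤ k → ‖Z k - u k‖ ≤ 8 / β * l ^ 2 := by
    intro k hk
    have hk1 : 1 ≤ k := hk₀.trans hk
    have hk1' : (1 : ℝ) ≤ k := by exact_mod_cast hk1
    have hkt' : 1 / t ≤ k := hkt.trans (by exact_mod_cast hk)
    have b5E := norm_corrector_le hβ ht0 hk1 (phaseCoef_le (l := l) hβ hk1) hE1 (hp k)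
    have b5F := norm_corrector_le hβ ht0 hk1 (phaseCoef_le (l := l) hβ hk1) hF1 (hm k)
    have b7 : 4 * l ^ 2 / (β * k * t) ≤ 4 / β * l ^ 2 := by
      have : 1 ≤ k * t := by
        rw [div_le_iff₀ ht0] at hkt'; exact hkt'
      calc _ ≤ 4 * l ^ 2 / (β * 1) := by rw [mul_assoc]; gcongr
        _ = _ := by ring
    have e : Z k - u k = -(phaseCoef β l k : ℂ) / (E - 1) * p k +
        -(phaseCoef β l k : ℂ) / (F - 1) * m k := by simp only [Z]; ring
    rw [e]
    refine (norm_add_le _ _).trans ?_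
    rw [mul_one] at b5E b5F
    calc _ ≤ 4 / β * l ^ 2 + 4 / β * l ^ 2 := add_le_add (b5E.trans b7) (b5F.trans b7)
      _ = _ := by ring
  have hD : ∀ n, k₀ ≤ n → ‖Z n - (((k₀ : ℝ) / n) ^ b : ℝ) * Z k₀‖ ≤
      ∑ k ∈ Finset.Ico k₀ n, (stepConst β C₀ * l ^ 2) * (1 / ((k : ℝ) * √k) + (1 / t) / k ^ 2) := by
    intro n hn
    induction n, hn using Nat.le_induction with
    | base => simp [div_self (by positivity : (k₀ : ℝ) ≠ 0)]
    | succ k hk ih =>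
      have hk1 : 1 ≤ k := hk₀.trans hk
      have hk1' : (1 : ℝ) ≤ k := by exact_mod_cast hk1
      have hkt' : 1 / t ≤ k := hkt.trans (by exact_mod_cast hk)
      have hs := corrected_step hβ hC₀ ht0 hl hE hF hE1 hF1 hk1 hkt' (hu k) (hp k) (hm k)
        (hu' k hk1) (hp' k hk1) (hm' k hk1)
      rw [Finset.sum_Ico_succ_top hk]
      have e0 : ((k₀ : ℝ) / (k + 1 : ℕ)) ^ b = ((k : ℝ) / (k + 1)) ^ b * ((k₀ : ℝ) / k) ^ b := by
        rw [← Real.mul_rpow (by positivity) (by positivity)]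
        congr 1
        push_cast
        field_simp
      have ha1 : ((k : ℝ) / (k + 1)) ^ b ≤ 1 :=
        Real.rpow_le_one (by positivity) ((div_le_one (by positivity)).2 (by linarith)) hb0
      have e1 : Z (k + 1) - (((k₀ : ℝ) / (k + 1 : ℕ)) ^ b : ℝ) * Z k₀ =
        (((k : ℝ) / (k + 1)) ^ b : ℝ) * (Z k - (((k₀ : ℝ) / k) ^ b : ℝ) * Z k₀) +
        (Z (k + 1) - (((k : ℝ) / (k + 1)) ^ b : ℝ) * Z k) := by
        rw [e0]; push_cast; ring
      rw [e1]
      refine (norm_add_le _ _).trans (add_le_add ?_ hs)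
      rw [norm_mul, Complex.norm_real, Real.norm_eq_abs,
        abs_of_nonneg (Real.rpow_nonneg (by positivity) _)]
      refine le_trans ?_ ih
      exact mul_le_of_le_one_left (norm_nonneg _) ha1
  have h1 := (hD n hn).trans (sum_error_le (mul_nonneg (stepConst_nonneg hβ hC₀) (sq_nonneg l))
    (by positivity) hk₀ hkt n)
  have h2 := hZu n hn
  have h3 := hZu k₀ le_rfl
  set A := ((k₀ : ℝ) / n) ^ b with hA
  have hn0 : (k₀ : ℝ) ≤ n := by exact_mod_cast hn
  have hA0 : 0 ≤ A := Real.rpow_nonneg (by positivity) _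
  have hA1 : A ≤ 1 := Real.rpow_le_one (by positivity) ((div_le_one (by linarith)).2 hn0) hb0
  have e : u n - (A : ℂ) = -(Z n - u n) + (Z n - A * Z k₀) + A * (Z k₀ - u k₀) + A * (u k₀ - 1) := by
    ring
  have hAm : ∀ x : ℂ, ‖A * x‖ ≤ ‖x‖ := fun x => by
    rw [norm_mul, Complex.norm_real, Real.norm_eq_abs, abs_of_nonneg hA0]
    exact mul_le_of_le_one_left (norm_nonneg _) hA1
  rw [e]
  refine (norm_add_le _ _).trans ?_
  have n1 := norm_add₃_le (a := -(Z n - u n)) (b := Z n - A * Z k₀) (c := A * (Z k₀ - u k₀))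
  rw [norm_neg] at n1
  have n2 := hAm (Z k₀ - u k₀)
  have n3 := hAm (u k₀ - 1)
  linear_combination n1 + n2 + n3 + h1 + h2 + h3

end recursion

/-- The law of the relative Prüfer phase after `m` steps. -/
def phaseLaw (β t : ℝ) : ℕ → Measure ℝ
  | 0 => Measure.dirac t
  | m + 1 => ((phaseLaw β t m).prod (diskMeasure ((m + 1 : ℕ) * (β / 2)))).map
      fun p => t + p.1 + phaseShift p.1 p.2

lemma hasDerivAt_add_phaseShift {α : ℂ} (hα : ‖α‖ < 1) (x : ℝ) :
    HasDerivAt (fun x => x + phaseShift x α)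
      ((1 - ‖α‖ ^ 2) / ‖1 - α * Complex.exp (x * Complex.I)‖ ^ 2) x := by
  have h1 : HasDerivAt (fun y : ℝ => 1 - α * Complex.exp (y * Complex.I))
      (-(α * (Complex.exp (x * Complex.I) * Complex.I))) x := by
    have : HasDerivAt (fun y : ℝ => (y : ℂ) * Complex.I) Complex.I x := by
      simpa using (Complex.ofRealCLM.hasDerivAt (x := x)).mul_const Complex.I
    exact ((this.cexp).const_mul α).const_sub 1
  have hw : ‖α * Complex.exp (x * Complex.I)‖ < 1 := by rwa [norm_mul_exp_I]
  have hpos := re_one_sub_pos hw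
  have h2 := h1.clog_real (Or.inl hpos)
  have h3 : HasDerivAt (fun y : ℝ => (1 - α * Complex.exp (y * Complex.I)).arg)
      ((-(α * (Complex.exp (x * Complex.I) * Complex.I))) /
        (1 - α * Complex.exp (x * Complex.I))).im x := by
    have := (Complex.imCLM.hasFDerivAt.comp_hasDerivAt x h2)
    simpa [Function.comp_def, Complex.log_im] using this
  have h4 := (hasDerivAt_id x).add ((h3.const_mul (-2)).add_const (2 * (1 - α).arg))
  refine HasDerivAt.congr_deriv (f' := _) (by exact h4) ?_
  set w := α * Complex.exp (x * Complex.I) with hw'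
  have hn : ‖α‖ ^ 2 = Complex.normSq w := by
    rw [← Complex.sq_norm, hw', norm_mul_exp_I]
  have e : -(α * (Complex.exp (x * Complex.I) * Complex.I)) = -(w * Complex.I) := by
    rw [hw']; ring
  have hne : Complex.normSq (1 - w) ≠ 0 := by
    rw [Complex.normSq_eq_zero.ne]
    intro h
    rw [h] at hpos
    simp at hpos
  rw [e, hn, Complex.sq_norm, Complex.div_im]
  field_simp
  simp only [Complex.normSq_apply, Complex.neg_re, Complex.neg_im, Complex.mul_re, Complex.mul_im,
    Complex.I_re, Complex.I_im, Complex.sub_re, Complex.sub_im, Complex.one_re, Complex.one_im]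
  ring

lemma add_phaseShift_nonneg {α : ℂ} (hα : ‖α‖ < 1) {x : ℝ} (hx : 0 ≤ x) :
    0 ≤ x + phaseShift x α := by
  have hm : Monotone fun x => x + phaseShift x α := by
    refine monotone_of_deriv_nonneg (fun x => (hasDerivAt_add_phaseShift hα x).differentiableAt)
      fun x => ?_
    rw [(hasDerivAt_add_phaseShift hα x).deriv]
    have : ‖α‖ ^ 2 ≤ 1 := pow_le_one₀ (norm_nonneg _) hα.le
    exact div_nonneg (by linarith) (by positivity)
  have h0 : (0 : ℝ) + phaseShift 0 α = 0 := by simp [phaseShift]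
  have := hm hx
  simp only [h0] at this
  exact this

section

variable {β t : ℝ}

lemma isProbabilityMeasure_phaseLaw (hβ : 0 < β) (m : ℕ) :
    IsProbabilityMeasure (phaseLaw β t m) := by
  induction m with
  | zero => rw [phaseLaw]; infer_instance
  | succ m ih =>
    rw [phaseLaw]
    have := isProbabilityMeasure_diskMeasure (γ := (m + 1 : ℕ) * (β / 2)) (by positivity)
    exact Measure.isProbabilityMeasure_map (by fun_prop)

lemma ae_phaseLaw (hβ : 0 < β) (ht : 0 ≤ t) (m : ℕ) :
    ∀ᵐ x ∂(phaseLaw β t m), 0 ≤ x ∧ x ≤ (m + 1) * (t + 4 * Real.pi) := by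
  induction m with
  | zero =>
    rw [phaseLaw, ae_dirac_iff (p := fun x => 0 ≤ x ∧ x ≤ ((0 : ℕ) + 1) * (t + 4 * Real.pi))
      (measurableSet_Ici.inter measurableSet_Iic)]
    exact ⟨ht, by push_cast; linarith [Real.pi_pos]⟩
  | succ m ih =>
    have := isProbabilityMeasure_phaseLaw (t := t) hβ m
    have := isProbabilityMeasure_diskMeasure (γ := (m + 1 : ℕ) * (β / 2)) (by positivity)
    rw [phaseLaw, ae_map_iff
      (p := fun x => 0 ≤ x ∧ x ≤ ((m + 1 : ℕ) + 1) * (t + 4 * Real.pi)) (by fun_prop)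
      (measurableSet_Ici.inter measurableSet_Iic)]
    filter_upwards [Measure.quasiMeasurePreserving_fst.ae ih,
      Measure.quasiMeasurePreserving_snd.ae (ae_norm_lt_one_diskMeasure _)] with p h1 h2
    have h3 := add_phaseShift_nonneg h2 h1.1
    have h4 := (abs_le.1 (abs_phaseShift_le p.1 p.2)).2
    refine ⟨by linarith, ?_⟩
    push_cast
    linarith [h1.2]

lemma integral_phaseLaw_succ (hβ : 0 < β) (m : ℕ) {E : Type*} [NormedAddCommGroup E]
    [NormedSpace ℝ E] {f : ℝ → E} (hf : StronglyMeasurable f)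
    (hi : Integrable f (phaseLaw β t (m + 1))) :
    ∫ x, f x ∂(phaseLaw β t (m + 1)) =
      ∫ x, ∫ α, f (t + x + phaseShift x α) ∂(diskMeasure ((m + 1 : ℕ) * (β / 2)))
        ∂(phaseLaw β t m) := by
  have := isProbabilityMeasure_phaseLaw (t := t) hβ m
  have := isProbabilityMeasure_diskMeasure (γ := (m + 1 : ℕ) * (β / 2)) (by positivity)
  rw [phaseLaw] at hi ⊢
  rw [integral_map (by fun_prop) hf.aestronglyMeasurable, integral_prod]
  exact (integrable_map_measure hf.aestronglyMeasurable (by fun_prop)).1 hi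

lemma integrable_id_phaseLaw (hβ : 0 < β) (ht : 0 ≤ t) (m : ℕ) :
    Integrable (fun x : ℝ => x) (phaseLaw β t m) := by
  have := isProbabilityMeasure_phaseLaw (t := t) hβ m
  refine integrable_of_abs_le (by fun_prop) (C := (m + 1) * (t + 4 * Real.pi))
    ((ae_phaseLaw hβ ht m).mono fun x hx => ?_)
  rw [Real.norm_eq_abs, abs_of_nonneg hx.1]
  exact hx.2

lemma integral_id_phaseLaw (hβ : 0 < β) (ht : 0 ≤ t) (m : ℕ) :
    ∫ x, x ∂(phaseLaw β t m) = (m + 1) * t := by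
  induction m with
  | zero => rw [phaseLaw, integral_dirac]; simp
  | succ m ih =>
    have := isProbabilityMeasure_phaseLaw (t := t) hβ m
    have hγ : 0 < ((m + 1 : ℕ) : ℝ) * (β / 2) := by positivity
    have := isProbabilityMeasure_diskMeasure hγ
    rw [integral_phaseLaw_succ (f := fun x => x) hβ m stronglyMeasurable_id (integrable_id_phaseLaw hβ ht _)]
    have h1 : ∀ x, ∫ α, (t + x + phaseShift x α) ∂(diskMeasure ((m + 1 : ℕ) * (β / 2))) =
        t + x := by
      intro x
      have hi : Integrable (fun α => phaseShift x α) (diskMeasure ((m + 1 : ℕ) * (β / 2))) := by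
        simpa using integrable_phaseShift_pow hγ x 1
      rw [integral_add (integrable_const _) hi, integral_phaseShift hγ, add_zero,
        integral_const, probReal_univ, one_smul]
    simp_rw [h1]
    rw [integral_add (integrable_const _) (integrable_id_phaseLaw hβ ht _), ih]
    simp
    ring

lemma integral_abs_sub_phaseLaw_le (hβ : 0 < β) (ht : 0 ≤ t) (m : ℕ) :
    ∫ x, |x - (m + 1) * t| ∂(phaseLaw β t m) ≤ 2 * ((m + 1) * t) := by
  have := isProbabilityMeasure_phaseLaw (t := t) hβ m
  have hi := integrable_id_phaseLaw (t := t) hβ ht m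
  calc _ ≤ ∫ x, (x + (m + 1) * t) ∂(phaseLaw β t m) := by
        refine integral_mono_ae ((hi.sub (integrable_const _)).abs) (hi.add (integrable_const _))
          ((ae_phaseLaw hβ ht m).mono fun x hx => ?_)
        have : 0 ≤ (m + 1) * t := by positivity
        simp only [abs_le]
        constructor <;> linarith [hx.1]
    _ = _ := by
        rw [integral_add hi (integrable_const _), integral_id_phaseLaw hβ ht]
        simp
        ring

/-- Twisted characteristic functions of the phase laws; the index `k` counts points. -/
def phaseChar (β t l j : ℝ) (k : ℕ) : ℂ :=
  ∫ x, Complex.exp (((l + j) * x - l * k * t : ℝ) * Complex.I) ∂(phaseLaw β t (k - 1))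

lemma norm_phaseChar_le (hβ : 0 < β) (l j : ℝ) (k : ℕ) : ‖phaseChar β t l j k‖ ≤ 1 := by
  have := isProbabilityMeasure_phaseLaw (t := t) hβ (k - 1)
  refine (norm_integral_le_of_norm_le_const (C := 1) (ae_of_all _ fun x => ?_)).trans ?_
  · rw [Complex.norm_exp_ofReal_mul_I]
  · simp

lemma integrable_exp_ofReal_mul_I {Ω : Type*} [MeasurableSpace Ω] {μ : Measure Ω}
    [IsFiniteMeasure μ] {f : Ω → ℝ} (hf : Measurable f) :
    Integrable (fun x => Complex.exp (f x * Complex.I)) μ :=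
  integrable_of_abs_le (Measurable.aestronglyMeasurable (by fun_prop)) (C := 1)
    (ae_of_all _ fun x => by rw [Complex.norm_exp_ofReal_mul_I])

lemma phaseChar_succ (hβ : 0 < β) (l j : ℝ) (m : ℕ) :
    phaseChar β t l j (m + 1 + 1) = Complex.exp ((j * t : ℝ) * Complex.I) *
      ∫ x, Complex.exp (((l + j) * x - l * (m + 1 : ℕ) * t : ℝ) * Complex.I) *
        (∫ α, Complex.exp ((l + j : ℝ) * phaseShift x α * Complex.I)
          ∂(diskMeasure ((m + 1 : ℕ) * (β / 2)))) ∂(phaseLaw β t m) := by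
  have := isProbabilityMeasure_phaseLaw (t := t) hβ (m + 1)
  unfold phaseChar
  rw [Nat.add_sub_cancel, integral_phaseLaw_succ hβ m (Measurable.stronglyMeasurable (by fun_prop))
    (integrable_exp_ofReal_mul_I (by fun_prop)), ← integral_const_mul]
  congr 1
  ext x
  rw [← integral_const_mul, ← integral_const_mul]
  congr 1
  ext α
  rw [← Complex.exp_add, ← Complex.exp_add]
  congr 1
  push_cast
  ring

end

section

variable {β t : ℝ}

lemma norm_exp_mul_integral_sub_le {μ : Measure ℝ} [IsProbabilityMeasure μ] {f : ℝ → ℝ}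
    (hf : Measurable f) {g h : ℝ → ℂ} (hg : Measurable g) (hh : Measurable h) {B : ℝ}
    (hgh : ∀ x, ‖g x - h x‖ ≤ B) (hb : ∃ B', ∀ x, ‖h x‖ ≤ B') :
    ‖∫ x, Complex.exp (f x * Complex.I) * g x ∂μ - ∫ x, Complex.exp (f x * Complex.I) * h x ∂μ‖
      ≤ B := by
  obtain ⟨B', hB'⟩ := hb
  have hn : ∀ x, ‖Complex.exp (f x * Complex.I)‖ = 1 := fun x => Complex.norm_exp_ofReal_mul_I _
  have i1 : Integrable (fun x => Complex.exp (f x * Complex.I) * g x) μ := by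
    refine integrable_of_abs_le (Measurable.aestronglyMeasurable (by fun_prop)) (C := B + B')
      (ae_of_all _ fun x => ?_)
    rw [norm_mul, hn, one_mul]
    calc _ = ‖(g x - h x) + h x‖ := by ring_nf
      _ ≤ _ := (norm_add_le _ _).trans (add_le_add (hgh x) (hB' x))
  have i2 : Integrable (fun x => Complex.exp (f x * Complex.I) * h x) μ := by
    refine integrable_of_abs_le (Measurable.aestronglyMeasurable (by fun_prop)) (C := B')
      (ae_of_all _ fun x => ?_)
    rw [norm_mul, hn, one_mul]
    exact hB' x
  rw [← integral_sub i1 i2]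
  refine (norm_integral_le_of_norm_le_const (C := B) (ae_of_all _ fun x => ?_)).trans (by simp)
  rw [← mul_sub, norm_mul, hn, one_mul]
  exact hgh x

lemma measurable_integral_exp_phaseShift {γ : ℝ} (hγ : 0 < γ) (μ : ℝ) :
    Measurable fun x => ∫ α, Complex.exp (μ * phaseShift x α * Complex.I) ∂(diskMeasure γ) := by
  have := isProbabilityMeasure_diskMeasure hγ
  refine StronglyMeasurable.measurable (StronglyMeasurable.integral_prod_right'
    (f := fun p : ℝ × ℂ => Complex.exp (μ * phaseShift p.1 p.2 * Complex.I)) ?_)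
  exact Measurable.stronglyMeasurable (by fun_prop)

lemma exists_norm_phaseChar_twisted_le (hβ : 0 < β) : ∃ C : ℝ, 0 ≤ C ∧ ∀ t l j : ℝ, |l| ≤ 1 →
    |j| ≤ 1 → ∀ k : ℕ, 1 ≤ k → ‖phaseChar β t l j (k + 1) -
      Complex.exp ((j * t : ℝ) * Complex.I) * phaseChar β t l j k‖ ≤ C / k := by
  obtain ⟨C, hC, h⟩ := norm_integral_exp_phaseShift_sub_one_le
  refine ⟨2 * C / β, by positivity, fun t l j hl hj k hk => ?_⟩
  obtain ⟨m, rfl⟩ : ∃ m, k = m + 1 := ⟨k - 1, by omega⟩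
  have hγ : 0 < ((m + 1 : ℕ) : ℝ) * (β / 2) := by positivity
  have := isProbabilityMeasure_phaseLaw (t := t) hβ m
  rw [phaseChar_succ hβ, ← mul_sub, norm_mul, Complex.norm_exp_ofReal_mul_I, one_mul]
  have hlj : |l + j| ≤ 2 := (abs_add_le l j).trans (by linarith)
  have := norm_exp_mul_integral_sub_le (μ := phaseLaw β t m)
    (f := fun x => (l + j) * x - l * (m + 1 : ℕ) * t) (by fun_prop)
    (measurable_integral_exp_phaseShift hγ (l + j)) (h := fun _ => 1) measurable_const
    (fun x => h _ hγ x _ hlj) ⟨1, by simp⟩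
  simp only [mul_one] at this
  unfold phaseChar
  rw [Nat.add_sub_cancel]
  refine this.trans (le_of_eq ?_)
  field_simp

lemma exists_norm_phaseChar_succ_le (hβ : 0 < β) : ∃ C : ℝ, 0 ≤ C ∧ ∀ t l : ℝ, |l| ≤ 1 →
    ∀ k : ℕ, 1 ≤ k → ‖phaseChar β t l 0 (k + 1) -
      (phaseChar β t l 0 k * (1 - 2 * phaseCoef β l k) +
        phaseCoef β l k * (phaseChar β t l 1 k + phaseChar β t l (-1) k))‖ ≤
      C * l ^ 2 / (k * √k) := by
  obtain ⟨C, hC, h⟩ := norm_integral_exp_phaseShift_expansion_le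
  refine ⟨C / (β / 2 * √(β / 2)), by positivity, fun t l hl k hk => ?_⟩
  obtain ⟨m, rfl⟩ : ∃ m, k = m + 1 := ⟨k - 1, by omega⟩
  set k : ℕ := m + 1 with hkm
  have hγ : 0 < (k : ℝ) * (β / 2) := by positivity
  have := isProbabilityMeasure_phaseLaw (t := t) hβ m
  set c := phaseCoef β l k with hc
  set f : ℝ → ℝ := fun x => (l + 0) * x - l * k * t with hf
  have key : phaseChar β t l 0 k * (1 - 2 * c) + c * (phaseChar β t l 1 k + phaseChar β t l (-1) k)
      = ∫ x, Complex.exp (f x * Complex.I) *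
        ((1 - 2 * l ^ 2 * (1 - Real.cos x) / (k * (β / 2) + 1) : ℝ) : ℂ) ∂(phaseLaw β t m) := by
    unfold phaseChar
    rw [show k - 1 = m from rfl]
    have i : ∀ j : ℝ, Integrable (fun x : ℝ => Complex.exp (((l + j) * x - l * k * t : ℝ) * Complex.I))
        (phaseLaw β t m) := fun j => integrable_exp_ofReal_mul_I (by fun_prop)
    have i' : Integrable (fun x : ℝ => Complex.exp (((l + 1) * x - l * k * t : ℝ) * Complex.I) +
        Complex.exp (((l + -1) * x - l * k * t : ℝ) * Complex.I)) (phaseLaw β t m) :=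
      (i 1).add (i (-1))
    rw [← integral_mul_const, ← integral_add (i 1) (i (-1)), ← integral_const_mul,
      ← integral_add ((i 0).mul_const _) (i'.const_mul _)]
    congr 1
    ext x
    have e1 : Complex.exp (((l + 1) * x - l * k * t : ℝ) * Complex.I) =
        Complex.exp (f x * Complex.I) * Complex.exp (x * Complex.I) := by
      rw [← Complex.exp_add]; congr 1; simp only [f]; push_cast; ring
    have e2 : Complex.exp (((l + -1) * x - l * k * t : ℝ) * Complex.I) =
        Complex.exp (f x * Complex.I) * Complex.exp (-x * Complex.I) := by
      rw [← Complex.exp_add]; congr 1; simp only [f]; push_cast; ring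
    have e3 : (Real.cos x : ℂ) = (Complex.exp (x * Complex.I) + Complex.exp (-x * Complex.I)) / 2 := by
      rw [Complex.ofReal_cos, Complex.cos]
    have e4 : ((1 - 2 * l ^ 2 * (1 - Real.cos x) / (k * (β / 2) + 1) : ℝ) : ℂ) =
        1 - 2 * c + 2 * c * (Real.cos x : ℂ) := by
      rw [hc]; unfold phaseCoef; push_cast; ring
    rw [e1, e2, e4, e3]
    ring
  rw [key, phaseChar_succ hβ]
  have e5 : Complex.exp ((0 * t : ℝ) * Complex.I) = 1 := by simp
  rw [e5, one_mul, add_zero]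
  have hcos : ∀ x : ℝ, ‖((1 - 2 * l ^ 2 * (1 - Real.cos x) / (k * (β / 2) + 1) : ℝ) : ℂ)‖ ≤
      1 + 2 * l ^ 2 * 2 / (k * (β / 2) + 1) := by
    intro x
    rw [Complex.norm_real, Real.norm_eq_abs]
    have h1 : |1 - Real.cos x| ≤ 2 := by
      rw [abs_le]; constructor <;> linarith [Real.neg_one_le_cos x, Real.cos_le_one x]
    refine (abs_sub _ _).trans ?_
    rw [abs_one, abs_div, abs_mul, abs_of_nonneg (by positivity : 0 ≤ 2 * l ^ 2),
      abs_of_pos (by positivity : 0 < (k : ℝ) * (β / 2) + 1)]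
    gcongr
  have := norm_exp_mul_integral_sub_le (μ := phaseLaw β t m)
    (f := fun x => l * x - l * k * t) (by fun_prop)
    (measurable_integral_exp_phaseShift hγ l)
    (h := fun x => ((1 - 2 * l ^ 2 * (1 - Real.cos x) / (k * (β / 2) + 1) : ℝ) : ℂ))
    (by fun_prop) (fun x => h _ hγ x _ hl) ⟨_, hcos⟩
  simp only [hf, add_zero]
  refine this.trans (le_of_eq ?_)
  rw [Real.sqrt_mul (by positivity)]
  field_simp

/-- The characteristic function of the centred relative phase is close to a power law. -/
theorem exists_norm_phaseChar_sub_rpow_le (hβ : 0 < β) : ∃ C : ℝ, 0 ≤ C ∧ ∀ t l : ℝ, 0 < t →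
    t ≤ Real.pi → |l| ≤ 1 → ∀ k₀ n : ℕ, 1 ≤ k₀ → 1 / t ≤ k₀ → k₀ ≤ n →
    ‖phaseChar β t l 0 n - (((k₀ : ℝ) / n) ^ (4 * l ^ 2 / β) : ℝ)‖ ≤
      2 * |l| * (k₀ * t) + C * l ^ 2 := by
  obtain ⟨C₁, hC₁, h₁⟩ := exists_norm_phaseChar_twisted_le hβ
  obtain ⟨C₂, hC₂, h₂⟩ := exists_norm_phaseChar_succ_le hβ
  have hmax : 0 ≤ max C₁ C₂ := le_max_of_le_left hC₁
  refine ⟨6 * stepConst β (max C₁ C₂) + 16 / β,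
    add_nonneg (mul_nonneg (by norm_num) (stepConst_nonneg hβ hmax)) (by positivity),
    fun t l ht0 ht hl k₀ n hk₀ hkt hn => ?_⟩
  have hE1 : ∀ s : ℝ, |s| = t → t / 2 ≤ ‖Complex.exp (s * Complex.I) - 1‖ := by
    intro s hs
    have h := two_mul_div_pi_le_norm_exp_sub_one ht0 ht
    have h' : ‖Complex.exp (s * Complex.I) - 1‖ = ‖Complex.exp (t * Complex.I) - 1‖ := by
      refine (sq_eq_sq₀ (norm_nonneg _) (norm_nonneg _)).1 ?_
      rw [norm_exp_I_sub_one_sq, norm_exp_I_sub_one_sq, ← hs, Real.cos_abs]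
    rw [h']
    refine le_trans ?_ h
    rw [div_le_div_iff₀ (by norm_num) Real.pi_pos]
    nlinarith [Real.pi_lt_four]
  refine (norm_sub_rpow_le_of_recursion (u := phaseChar β t l 0) (p := phaseChar β t l 1)
    (m := phaseChar β t l (-1)) hβ hmax ht0 hl
    (Complex.norm_exp_ofReal_mul_I (1 * t)) (Complex.norm_exp_ofReal_mul_I (-1 * t))
    (hE1 _ (by rw [one_mul, abs_of_pos ht0])) (hE1 _ (by rw [neg_one_mul, abs_neg, abs_of_pos ht0]))
    (fun k => norm_phaseChar_le hβ _ _ _) (fun k => norm_phaseChar_le hβ _ _ _)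
    (fun k => norm_phaseChar_le hβ _ _ _) (fun k hk => (h₂ t l hl k hk).trans ?_)
    (fun k hk => (h₁ t l 1 hl (by simp) k hk).trans ?_)
    (fun k hk => (h₁ t l (-1) hl (by simp) k hk).trans ?_) hk₀ hkt hn).trans ?_
  · gcongr; exact le_max_right _ _
  · gcongr; exact le_max_left _ _
  · gcongr; exact le_max_left _ _
  · gcongr
    obtain ⟨m, rfl⟩ : ∃ m, k₀ = m + 1 := ⟨k₀ - 1, by omega⟩
    have := isProbabilityMeasure_phaseLaw (t := t) hβ m
    unfold phaseChar
    rw [Nat.add_sub_cancel]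
    have e : (1 : ℂ) = ∫ x, 1 ∂(phaseLaw β t m) := by simp
    conv_lhs => rw [e]
    rw [← integral_sub (integrable_exp_ofReal_mul_I (by fun_prop)) (integrable_const _)]
    have hi := integrable_id_phaseLaw (t := t) hβ ht0.le m
    have hb : ∀ x : ℝ, ‖Complex.exp (((l + 0) * x - l * (m + 1 : ℕ) * t : ℝ) * Complex.I) - 1‖ ≤
        |l| * |x - (m + 1) * t| := by
      intro x
      rw [mul_comm _ Complex.I]
      refine (Real.norm_exp_I_mul_ofReal_sub_one_le).trans (le_of_eq ?_)
      rw [Real.norm_eq_abs, ← abs_mul]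
      congr 1
      push_cast
      ring
    refine (norm_integral_le_of_norm_le
      (((hi.sub (integrable_const _)).abs).const_mul _) (ae_of_all _ hb)).trans ?_
    rw [integral_const_mul]
    have := integral_abs_sub_phaseLaw_le hβ ht0.le (t := t) m
    push_cast
    calc _ ≤ |l| * (2 * ((m + 1) * t)) := by gcongr; exact this
      _ = _ := by ring

end

section szego

open Polynomial in
/-- The polynomial with leading coefficient `p` and lower coefficients `v`. -/
def pol (p : ℂ) {m : ℕ} (v : Fin m → ℂ) : ℂ[X] := C p * X ^ m + ∑ i, C (v i) * X ^ (i : ℕ)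

/-- The value at `z` of the polynomial with leading coefficient `p` and lower coefficients `v`. -/
def ev (p : ℂ) {m : ℕ} (v : Fin m → ℂ) (z : ℂ) : ℂ := p * z ^ m + ∑ i, v i * z ^ (i : ℕ)

/-- The value at `z` of the reversed polynomial. -/
def evs (p : ℂ) {m : ℕ} (v : Fin m → ℂ) (z : ℂ) : ℂ :=
  starRingEnd ℂ p + ∑ i, starRingEnd ℂ (v i) * z ^ (m - (i : ℕ))

/-- The conjugate reversal of a coefficient vector. -/
def conjRev {m : ℕ} (v : Fin m → ℂ) : Fin m → ℂ := fun i => starRingEnd ℂ (v i.rev)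

/-- One step of the Szegő recursion on lower coefficients. -/
def szego (p : ℂ) {m : ℕ} (α : ℂ) (v : Fin m → ℂ) : Fin (m + 1) → ℂ :=
  Fin.cons (-(starRingEnd ℂ α * starRingEnd ℂ p)) fun i => v i - starRingEnd ℂ α * conjRev v i

/-- The Verblunsky coefficient read off from the constant coefficient. -/
def verb (p : ℂ) {m : ℕ} (v : Fin (m + 1) → ℂ) : ℂ := -(starRingEnd ℂ (v 0) / p)

/-- The inverse Szegő step. -/
def strip (p : ℂ) {m : ℕ} (v : Fin (m + 1) → ℂ) : Fin m → ℂ := fun i =>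
  (Fin.tail v i + starRingEnd ℂ (verb p v) * conjRev (Fin.tail v) i) / (1 - ‖verb p v‖ ^ 2 : ℝ)

variable {p : ℂ} {m : ℕ}

lemma eval_pol (v : Fin m → ℂ) (z : ℂ) : (pol p v).eval z = ev p v z := by
  simp [pol, ev, Polynomial.eval_finsetSum]

lemma natDegree_pol (hp : p ≠ 0) (v : Fin m → ℂ) : (pol p v).natDegree = m ∧
    (pol p v).leadingCoeff = p := by
  have hd : (∑ i, Polynomial.C (v i) * Polynomial.X ^ (i : ℕ)).degree <
      (Polynomial.C p * Polynomial.X ^ m).degree := by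
    rw [Polynomial.degree_C_mul_X_pow m hp]
    exact Polynomial.degree_sum_fin_lt v
  constructor
  · unfold pol
    rw [Polynomial.natDegree_add_eq_left_of_degree_lt hd, Polynomial.natDegree_C_mul_X_pow m p hp]
  · unfold pol
    rw [Polynomial.leadingCoeff_add_of_degree_lt' hd, Polynomial.leadingCoeff_C_mul_X_pow]

lemma exists_roots_of_poly {f : Polynomial ℂ} (hd : f.natDegree = m) :
    ∃ a : Fin m → ℂ, f = Polynomial.C f.leadingCoeff * ∏ l, (Polynomial.X - Polynomial.C (a l)) := by
  have hs := IsAlgClosed.splits f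
  have hc : f.roots.card = m := by rw [← hd]; exact hs.natDegree_eq_card_roots.symm
  obtain ⟨L, hL⟩ := Quot.exists_rep f.roots
  have hL' : (L : Multiset ℂ) = f.roots := hL
  have hlen : L.length = m := by rw [← hc, ← hL']; rfl
  refine ⟨fun l => L.get (l.cast hlen.symm), ?_⟩
  conv_lhs => rw [hs.eq_prod_roots, ← hL']
  congr 1
  subst hlen
  rw [Multiset.map_coe, Multiset.prod_coe]
  exact (Fin.prod_univ_fun_getElem L fun x => Polynomial.X - Polynomial.C x).symm

lemma ev_exists_roots (hp : p ≠ 0) (v : Fin m → ℂ) :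
    ∃ a : Fin m → ℂ, ∀ z, ev p v z = p * ∏ l, (z - a l) := by
  obtain ⟨hd, hlc⟩ := natDegree_pol hp v
  obtain ⟨a, ha⟩ := exists_roots_of_poly hd
  refine ⟨a, fun z => ?_⟩
  rw [← eval_pol, ha, hlc]
  simp [Polynomial.eval_prod]

lemma evs_eq_of_ne_zero (v : Fin m → ℂ) {z : ℂ} (hz : z ≠ 0) :
    evs p v z = z ^ m * starRingEnd ℂ (ev p v (starRingEnd ℂ z)⁻¹) := by
  unfold ev evs
  simp only [map_add, map_mul, map_sum, map_pow, map_inv₀, Complex.conj_conj]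
  rw [mul_add, Finset.mul_sum]
  congr 1
  · rw [inv_pow, mul_left_comm, mul_inv_cancel₀ (pow_ne_zero _ hz), mul_one]
  · refine Finset.sum_congr rfl fun i _ => ?_
    rw [pow_sub₀ z hz i.2.le, inv_pow]
    ring

lemma conj_inv_of_norm_eq_one {z : ℂ} (hz : ‖z‖ = 1) : (starRingEnd ℂ z)⁻¹ = z := by
  rw [← Complex.inv_eq_conj hz, inv_inv]

lemma evs_eq_of_norm_eq_one (v : Fin m → ℂ) {z : ℂ} (hz : ‖z‖ = 1) :
    evs p v z = z ^ m * starRingEnd ℂ (ev p v z) := by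
  rw [evs_eq_of_ne_zero v (by rintro rfl; simp at hz), conj_inv_of_norm_eq_one hz]

lemma continuous_ev (v : Fin m → ℂ) : Continuous (ev p v) := by unfold ev; fun_prop

lemma continuous_evs (v : Fin m → ℂ) : Continuous (evs p v) := by unfold evs; fun_prop

lemma evs_zero (v : Fin m → ℂ) : evs p v 0 = starRingEnd ℂ p := by
  unfold evs
  rw [Finset.sum_eq_zero, add_zero]
  intro i _
  rw [zero_pow (by have := i.2; omega), mul_zero]

lemma evs_eq_prod {v a : Fin m → ℂ} (h : ∀ z, ev p v z = p * ∏ l, (z - a l)) (z : ℂ) :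
    evs p v z = starRingEnd ℂ p * ∏ l, (1 - starRingEnd ℂ (a l) * z) := by
  have h1 : ∀ z : ℂ, z ≠ 0 → evs p v z = starRingEnd ℂ p * ∏ l, (1 - starRingEnd ℂ (a l) * z) := by
    intro z hz
    rw [evs_eq_of_ne_zero v hz, h, map_mul, map_prod, mul_left_comm]
    congr 1
    have : z ^ m = ∏ _l : Fin m, z := by simp
    rw [this, ← Finset.prod_mul_distrib]
    refine Finset.prod_congr rfl fun l _ => ?_
    simp only [map_sub, map_inv₀, Complex.conj_conj]
    field_simp
  by_cases hz : z = 0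
  · subst hz; simp [evs_zero]
  · exact h1 z hz

lemma ev_szego (α : ℂ) (v : Fin m → ℂ) (z : ℂ) :
    ev p (szego p α v) z = z * ev p v z - starRingEnd ℂ α * evs p v z := by
  unfold ev evs szego conjRev
  rw [Fin.sum_univ_succ]
  simp only [Fin.cons_zero, Fin.cons_succ, Fin.val_zero, Fin.val_succ, pow_zero]
  have h : ∑ i : Fin m, starRingEnd ℂ (v i) * z ^ (m - (i : ℕ)) =
      ∑ i : Fin m, starRingEnd ℂ (v i.rev) * z ^ ((i : ℕ) + 1) := by
    rw [← Equiv.sum_comp Fin.revPerm]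
    refine Finset.sum_congr rfl fun i _ => ?_
    simp only [Fin.revPerm_apply, Fin.val_rev]
    congr 2
    have := i.2; omega
  rw [h, mul_add, mul_add, Finset.mul_sum, Finset.mul_sum]
  have : ∑ i : Fin m, (v i - starRingEnd ℂ α * starRingEnd ℂ (v i.rev)) * z ^ ((i : ℕ) + 1) =
      ∑ i : Fin m, z * (v i * z ^ (i : ℕ)) -
      ∑ i : Fin m, starRingEnd ℂ α * (starRingEnd ℂ (v i.rev) * z ^ ((i : ℕ) + 1)) := by
    rw [← Finset.sum_sub_distrib]
    refine Finset.sum_congr rfl fun i _ => ?_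
    ring
  rw [this]
  ring

lemma evs_szego (α : ℂ) (v : Fin m → ℂ) (z : ℂ) :
    evs p (szego p α v) z = evs p v z - α * (z * ev p v z) := by
  by_cases hz : z = 0
  · subst hz; simp [evs_zero]
  rw [evs_eq_of_ne_zero _ hz, ev_szego, evs_eq_of_ne_zero v hz,
    evs_eq_of_ne_zero v (z := (starRingEnd ℂ z)⁻¹) (by simpa using hz)]
  simp only [map_sub, map_mul, map_inv₀, Complex.conj_conj, inv_inv, map_pow, inv_pow]
  field_simp
  ring

lemma verb_szego (hp : p ≠ 0) (α : ℂ) (v : Fin m → ℂ) : verb p (szego p α v) = α := by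
  simp only [verb, szego, Fin.cons_zero, map_neg, map_mul, Complex.conj_conj]
  field_simp

lemma strip_szego (hp : p ≠ 0) {α : ℂ} (hα : ‖α‖ < 1) (v : Fin m → ℂ) :
    strip p (szego p α v) = v := by
  ext i
  have h1 : (1 - ‖α‖ ^ 2 : ℝ) ≠ 0 := by nlinarith [norm_nonneg α]
  have h2 : ((‖α‖ : ℂ)) ^ 2 = α * starRingEnd ℂ α := by rw [Complex.mul_conj']
  unfold strip
  rw [verb_szego hp, div_eq_iff (by exact_mod_cast h1)]
  simp only [szego, Fin.tail, Fin.cons_succ, conjRev, map_sub, map_mul, Complex.conj_conj,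
    Fin.rev_rev]
  push_cast
  rw [h2]
  ring

lemma szego_strip (hp : p ≠ 0) {v : Fin (m + 1) → ℂ} (hα : ‖verb p v‖ < 1) :
    szego p (verb p v) (strip p v) = v := by
  have h1 : (1 - ‖verb p v‖ ^ 2 : ℝ) ≠ 0 := by nlinarith [norm_nonneg (verb p v)]
  have h2 : ((‖verb p v‖ : ℂ)) ^ 2 = verb p v * starRingEnd ℂ (verb p v) := by
    rw [Complex.mul_conj']
  have h3 : (1 - verb p v * starRingEnd ℂ (verb p v)) ≠ 0 := by
    rw [← h2]; exact_mod_cast h1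
  ext i
  refine Fin.cases ?_ (fun i => ?_) i
  · simp [szego, verb, hp]
  · simp only [szego, Fin.cons_succ, strip, conjRev, map_div₀, map_add, map_mul, Complex.conj_conj,
      Fin.rev_rev, Complex.conj_ofReal, Fin.tail]
    push_cast
    rw [h2]
    generalize verb p v = α at *
    rw [← mul_div_assoc, div_sub_div_same, div_eq_iff h3]
    ring

end szego

section szego

variable {p : ℂ} {m : ℕ}

/-- The polynomial has degree `m` and all its roots lie in the open unit disk. -/
def IsGood (p : ℂ) {m : ℕ} (v : Fin m → ℂ) : Prop := p ≠ 0 ∧ ∀ z : ℂ, 1 ≤ ‖z‖ → ev p v z ≠ 0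

lemma IsGood.exists_roots {v : Fin m → ℂ} (h : IsGood p v) :
    ∃ a : Fin m → ℂ, (∀ z, ev p v z = p * ∏ l, (z - a l)) ∧ ∀ l, ‖a l‖ < 1 := by
  obtain ⟨a, ha⟩ := ev_exists_roots h.1 v
  refine ⟨a, ha, fun l => ?_⟩
  by_contra! hl
  refine h.2 (a l) hl ?_
  rw [ha, Finset.prod_eq_zero (Finset.mem_univ l) (sub_self _), mul_zero]

lemma normSq_one_sub_sub_normSq (a z : ℂ) :
    ‖1 - starRingEnd ℂ a * z‖ ^ 2 - ‖z - a‖ ^ 2 = (1 - ‖a‖ ^ 2) * (1 - ‖z‖ ^ 2) := by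
  simp only [← Complex.normSq_eq_norm_sq, Complex.normSq_apply, Complex.sub_re, Complex.sub_im,
    Complex.mul_re, Complex.mul_im, Complex.conj_re, Complex.conj_im, Complex.one_re,
    Complex.one_im]
  ring

lemma norm_sub_le_norm_one_sub {a z : ℂ} (ha : ‖a‖ < 1) (hz : ‖z‖ ≤ 1) :
    ‖z - a‖ ≤ ‖1 - starRingEnd ℂ a * z‖ := by
  have h := normSq_one_sub_sub_normSq a z
  have h1 : 0 ≤ (1 - ‖a‖ ^ 2) * (1 - ‖z‖ ^ 2) :=
    mul_nonneg (by nlinarith [norm_nonneg a]) (by nlinarith [norm_nonneg z])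
  exact le_of_sq_le_sq (by linarith) (norm_nonneg _)

lemma norm_one_sub_le_norm_sub {a z : ℂ} (ha : ‖a‖ < 1) (hz : 1 ≤ ‖z‖) :
    ‖1 - starRingEnd ℂ a * z‖ ≤ ‖z - a‖ := by
  have h := normSq_one_sub_sub_normSq a z
  have h1 : 0 ≤ (1 - ‖a‖ ^ 2) * (‖z‖ ^ 2 - 1) :=
    mul_nonneg (by nlinarith [norm_nonneg a]) (by nlinarith [norm_nonneg z])
  exact le_of_sq_le_sq (by linarith) (norm_nonneg _)

lemma IsGood.norm_ev_le {v : Fin m → ℂ} (h : IsGood p v) {z : ℂ} (hz : ‖z‖ ≤ 1) :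
    ‖ev p v z‖ ≤ ‖evs p v z‖ := by
  obtain ⟨a, ha, ha1⟩ := h.exists_roots
  rw [ha, evs_eq_prod ha, norm_mul, norm_mul, RCLike.norm_conj, norm_prod, norm_prod]
  gcongr with l
  exact norm_sub_le_norm_one_sub (ha1 l) hz

lemma IsGood.norm_evs_le {v : Fin m → ℂ} (h : IsGood p v) {z : ℂ} (hz : 1 ≤ ‖z‖) :
    ‖evs p v z‖ ≤ ‖ev p v z‖ := by
  obtain ⟨a, ha, ha1⟩ := h.exists_roots
  rw [ha, evs_eq_prod ha, norm_mul, norm_mul, RCLike.norm_conj, norm_prod, norm_prod]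
  gcongr with l
  exact norm_one_sub_le_norm_sub (ha1 l) hz

lemma IsGood.evs_ne_zero {v : Fin m → ℂ} (h : IsGood p v) {z : ℂ} (hz : ‖z‖ ≤ 1) :
    evs p v z ≠ 0 := by
  obtain ⟨a, ha, ha1⟩ := h.exists_roots
  rw [evs_eq_prod ha]
  refine mul_ne_zero (by simpa using h.1) (Finset.prod_ne_zero_iff.2 fun l _ => ?_)
  intro h0
  have h1 : ‖starRingEnd ℂ (a l) * z‖ = 1 := by rw [← sub_eq_zero.1 h0, norm_one]
  rw [norm_mul, RCLike.norm_conj] at h1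
  nlinarith [ha1 l, norm_nonneg z, norm_nonneg (a l)]

lemma ev_zero (v : Fin (m + 1) → ℂ) : ev p v 0 = v 0 := by
  simp [ev, Fin.sum_univ_succ]

lemma IsGood.norm_verb_lt_one {v : Fin (m + 1) → ℂ} (h : IsGood p v) : ‖verb p v‖ < 1 := by
  obtain ⟨a, ha, ha1⟩ := h.exists_roots
  have h0 := ha 0
  rw [ev_zero] at h0
  have hp : 0 < ‖p‖ := norm_pos_iff.2 h.1
  rw [verb, norm_neg, norm_div, RCLike.norm_conj, h0, norm_mul, mul_div_cancel_left₀ _ hp.ne',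
    norm_prod, Fin.prod_univ_succ]
  simp only [zero_sub, norm_neg]
  calc ‖a 0‖ * ∏ i : Fin m, ‖a i.succ‖ ≤ ‖a 0‖ * 1 := by
        gcongr
        exact Finset.prod_le_one (fun _ _ => norm_nonneg _) fun i _ => (ha1 _).le
    _ < 1 := by simpa using ha1 0

lemma ev_eq_strip {v : Fin (m + 1) → ℂ} (hp : p ≠ 0) (hα : ‖verb p v‖ < 1) (z : ℂ) :
    ev p v z = z * ev p (strip p v) z - starRingEnd ℂ (verb p v) * evs p (strip p v) z := by
  conv_lhs => rw [← szego_strip hp hα, ev_szego]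

lemma evs_eq_strip {v : Fin (m + 1) → ℂ} (hp : p ≠ 0) (hα : ‖verb p v‖ < 1) (z : ℂ) :
    evs p v z = evs p (strip p v) z - verb p v * (z * ev p (strip p v) z) := by
  conv_lhs => rw [← szego_strip hp hα, evs_szego]

lemma IsGood.strip {v : Fin (m + 1) → ℂ} (h : IsGood p v) : IsGood p (strip p v) := by
  have hα := h.norm_verb_lt_one
  refine ⟨h.1, fun z hz h0 => ?_⟩
  have h1 := ev_eq_strip h.1 hα z
  have h2 := evs_eq_strip h.1 hα z
  rw [h0] at h1 h2
  have h3 : ev p v z = - (starRingEnd ℂ (verb p v) * evs p v z) := by rw [h1, h2]; ring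
  have h4 := h.norm_evs_le hz
  have h5 := norm_pos_iff.2 (h.2 z hz)
  rw [h3, norm_neg, norm_mul, RCLike.norm_conj] at h4 h5
  have h6 : 0 < ‖evs p v z‖ := by
    by_contra! h7
    have : ‖evs p v z‖ = 0 := le_antisymm h7 (norm_nonneg _)
    rw [this] at h5; simp at h5
  nlinarith

lemma isGood_of_strip {v : Fin (m + 1) → ℂ} (hα : ‖verb p v‖ < 1) (h : IsGood p (strip p v)) :
    IsGood p v := by
  refine ⟨h.1, fun z hz h0 => ?_⟩
  have h1 := ev_eq_strip h.1 hα z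
  rw [h0] at h1
  have h2 : z * ev p (_root_.strip p v) z =
      starRingEnd ℂ (verb p v) * evs p (_root_.strip p v) z := by linear_combination -h1
  have h3 := congrArg norm h2
  rw [norm_mul, norm_mul, RCLike.norm_conj] at h3
  have h4 := h.norm_evs_le hz
  have h5 := norm_pos_iff.2 (h.2 z hz)
  nlinarith [norm_nonneg (verb p v), norm_nonneg (evs p (_root_.strip p v) z)]

/-- The product of the powers `(1 - |α_k|²)^{k+1}` of the Verblunsky coefficients. -/
def rho (p : ℂ) : ∀ m : ℕ, (Fin m → ℂ) → ℝ
  | 0, _ => 1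
  | m + 1, v => (1 - ‖verb p v‖ ^ 2) ^ (m + 1) * rho p m (strip p v)

lemma IsGood.rho_pos : ∀ {m : ℕ} {v : Fin m → ℂ}, IsGood p v → 0 < rho p m v
  | 0, _, _ => one_pos
  | m + 1, v, h => by
    have := h.norm_verb_lt_one
    exact mul_pos (pow_pos (by nlinarith [norm_nonneg (verb p v)]) _) h.strip.rho_pos

lemma IsGood.prod_norm_evs : ∀ {m : ℕ} {v a : Fin m → ℂ}, IsGood p v →
    (∀ z, ev p v z = p * ∏ l, (z - a l)) → ∏ l, ‖evs p v (a l)‖ = ‖p‖ ^ m * rho p m v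
  | 0, v, a, _, _ => by simp [rho]
  | m + 1, v, a', h, ha' => by
    have hα := h.norm_verb_lt_one
    obtain ⟨a, ha⟩ := ev_exists_roots h.1 (_root_.strip p v)
    have ih := IsGood.prod_norm_evs h.strip ha
    have hr' : ∀ l, ev p v (a' l) = 0 := fun l => by
      rw [ha', Finset.prod_eq_zero (Finset.mem_univ l) (sub_self _), mul_zero]
    have hr : ∀ l, ev p (_root_.strip p v) (a l) = 0 := fun l => by
      rw [ha, Finset.prod_eq_zero (Finset.mem_univ l) (sub_self _), mul_zero]
    have h1 : ∀ l, ‖evs p v (a' l)‖ =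
        (1 - ‖verb p v‖ ^ 2) * ‖evs p (_root_.strip p v) (a' l)‖ := by
      intro l
      have e1 := ev_eq_strip h.1 hα (a' l)
      have e2 := evs_eq_strip h.1 hα (a' l)
      rw [hr'] at e1
      have e3 : evs p v (a' l) = ((1 - ‖verb p v‖ ^ 2 : ℝ) : ℂ) *
          evs p (_root_.strip p v) (a' l) := by
        push_cast
        rw [← Complex.mul_conj']
        linear_combination e2 + verb p v * e1
      rw [e3, norm_mul, Complex.norm_real, Real.norm_of_nonneg]
      nlinarith [norm_nonneg (verb p v)]
    have h2 : ∀ l, ‖p‖ * ∏ k, ‖1 - starRingEnd ℂ (a l) * a' k‖ =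
        ‖evs p (_root_.strip p v) (a l)‖ := by
      intro l
      have e2 := evs_eq_strip h.1 hα (a l)
      rw [hr, mul_zero, mul_zero, sub_zero] at e2
      rw [← e2, evs_eq_prod ha', norm_mul, RCLike.norm_conj, norm_prod]
      congr 1
      refine Finset.prod_congr rfl fun k _ => ?_
      rw [← RCLike.norm_conj]
      simp only [map_sub, map_one, map_mul, Complex.conj_conj]
      rw [mul_comm]
    calc ∏ l, ‖evs p v (a' l)‖
        = (1 - ‖verb p v‖ ^ 2) ^ (m + 1) * ∏ k, ‖evs p (_root_.strip p v) (a' k)‖ := by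
          rw [Finset.prod_congr rfl fun l _ => h1 l, Finset.prod_mul_distrib]; simp
      _ = (1 - ‖verb p v‖ ^ 2) ^ (m + 1) *
          (‖p‖ ^ (m + 1) * ∏ l, ∏ k, ‖1 - starRingEnd ℂ (a l) * a' k‖) := by
          congr 1
          simp only [evs_eq_prod ha, norm_mul, RCLike.norm_conj, norm_prod]
          rw [Finset.prod_mul_distrib, Finset.prod_comm]; simp
      _ = (1 - ‖verb p v‖ ^ 2) ^ (m + 1) * (‖p‖ * ∏ l, ‖evs p (_root_.strip p v) (a l)‖) := by
          congr 1
          rw [← Finset.prod_congr rfl fun l _ => h2 l, Finset.prod_mul_distrib]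
          simp
          ring
      _ = ‖p‖ ^ (m + 1) * rho p (m + 1) v := by
          rw [ih, rho]; ring

lemma verb_neg (v : Fin (m + 1) → ℂ) : verb (-p) (-v) = verb p v := by
  simp [verb]

lemma conjRev_neg (v : Fin m → ℂ) : conjRev (-v) = - conjRev v := by
  ext i; simp [conjRev]

lemma strip_neg (v : Fin (m + 1) → ℂ) : strip (-p) (-v) = - strip p v := by
  ext i
  have : Fin.tail (-v) = - Fin.tail v := rfl
  simp only [strip, verb_neg, this, conjRev_neg, Pi.neg_apply]
  ring

lemma ev_neg (v : Fin m → ℂ) (z : ℂ) : ev (-p) (-v) z = - ev p v z := by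
  simp [ev]; ring

lemma evs_neg (v : Fin m → ℂ) (z : ℂ) : evs (-p) (-v) z = - evs p v z := by
  simp [evs]; ring

/-- The weight of a coefficient vector in Szegő coordinates. -/
def wt (β : ℝ) (p : ℂ) : ∀ m : ℕ, (Fin m → ℂ) → ℝ
  | 0, _ => 1
  | m + 1, v => diskWeight ((m + 1 : ℕ) * (β / 2 - 1) + 1) (verb p v) * wt β p m (strip p v)

lemma wt_nonneg (β : ℝ) (p : ℂ) : ∀ (m : ℕ) (v : Fin m → ℂ), 0 ≤ wt β p m v
  | 0, _ => zero_le_one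
  | m + 1, _ => mul_nonneg (diskWeight_nonneg _ _) (wt_nonneg β p m _)

lemma wt_neg (β : ℝ) (p : ℂ) : ∀ (m : ℕ) (v : Fin m → ℂ), wt β (-p) m (-v) = wt β p m v
  | 0, _ => rfl
  | m + 1, v => by simp only [wt, verb_neg, strip_neg, wt_neg β p m]

lemma IsGood.wt_eq (β : ℝ) : ∀ {m : ℕ} {v : Fin m → ℂ}, IsGood p v →
    wt β p m v = rho p m v ^ (β / 2 - 1)
  | 0, _, _ => by simp [wt, rho]
  | m + 1, v, h => by
    have h1 := h.norm_verb_lt_one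
    have h2 : 0 < 1 - ‖verb p v‖ ^ 2 := by nlinarith [norm_nonneg (verb p v)]
    rw [wt, rho, diskWeight, if_pos h1, h.strip.wt_eq β,
      Real.mul_rpow (pow_nonneg h2.le _) h.strip.rho_pos.le, ← Real.rpow_natCast (1 - ‖verb p v‖ ^ 2),
      ← Real.rpow_mul h2.le]
    congr 2
    ring

lemma wt_eq_zero (β : ℝ) (hp : p ≠ 0) : ∀ {m : ℕ} {v : Fin m → ℂ}, ¬ IsGood p v → wt β p m v = 0
  | 0, v, h => by
    refine absurd ⟨hp, fun z _ => ?_⟩ h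
    simpa [ev] using hp
  | m + 1, v, h => by
    by_cases hα : ‖verb p v‖ < 1
    · rw [wt, wt_eq_zero β hp (fun h' => h (isGood_of_strip hα h')), mul_zero]
    · rw [wt, diskWeight, if_neg hα, zero_mul]

/-- The value at `1` of the Blaschke-type quotient, with a default value. -/
def uval (p : ℂ) {m : ℕ} (v : Fin m → ℂ) : ℂ :=
  if evs p v 1 = 0 then 1 else ev p v 1 / evs p v 1

lemma norm_uval (p : ℂ) (v : Fin m → ℂ) : ‖uval p v‖ = 1 := by
  unfold uval
  split_ifs with h
  · simp
  · have : ‖evs p v 1‖ = ‖ev p v 1‖ := by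
      rw [evs_eq_of_norm_eq_one v (by simp)]; simp
    rw [norm_div, ← this, div_self (norm_ne_zero_iff.2 h)]

lemma uval_neg (p : ℂ) (v : Fin m → ℂ) : uval (-p) (-v) = uval p v := by
  simp [uval, ev_neg, evs_neg]

/-- The relative Prüfer phase between `1` and `e^{it}`. -/
def phs (p : ℂ) (t : ℝ) : ∀ m : ℕ, (Fin m → ℂ) → ℝ
  | 0, _ => t
  | m + 1, v => t + phs p t m (strip p v) +
      phaseShift (phs p t m (strip p v)) (verb p v * uval p (strip p v))

lemma phs_neg (p : ℂ) (t : ℝ) : ∀ (m : ℕ) (v : Fin m → ℂ), phs (-p) t m (-v) = phs p t m v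
  | 0, _ => rfl
  | m + 1, v => by simp only [phs, verb_neg, strip_neg, phs_neg p t m, uval_neg]

end szego

section haar

lemma lintegral_eq_det_mul_lintegral_comp {E : Type*} [NormedAddCommGroup E] [NormedSpace ℝ E]
    [FiniteDimensional ℝ E] [MeasurableSpace E] [BorelSpace E] (μ : Measure E)
    [μ.IsAddHaarMeasure] (L : E →ₗ[ℝ] E) (hL : LinearMap.det L ≠ 0) {F : E → ENNReal}
    (hF : Measurable F) :
    ∫⁻ w, F w ∂μ = ENNReal.ofReal |LinearMap.det L| * ∫⁻ v, F (L v) ∂μ := by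
  have h := Measure.map_linearMap_addHaar_eq_smul_addHaar μ hL
  have hLm : Measurable L := L.continuous_of_finiteDimensional.measurable
  rw [← lintegral_map hF hLm, h, lintegral_smul_measure, smul_eq_mul, ← mul_assoc,
    ← ENNReal.ofReal_mul (abs_nonneg _), ← abs_mul, mul_inv_cancel₀ hL]
  simp

lemma lintegral_fin_cons {m : ℕ} {F : (Fin (m + 1) → ℂ) → ENNReal} (hF : Measurable F) :
    ∫⁻ v, F v = ∫⁻ a : ℂ, ∫⁻ w : Fin m → ℂ, F (Fin.cons a w) := by
  have h := volume_preserving_piFinSuccAbove (fun _ : Fin (m + 1) => ℂ) 0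
  have hs := h.symm
  rw [← hs.lintegral_comp hF, Measure.volume_eq_prod, lintegral_prod]
  · simp [MeasurableEquiv.piFinSuccAbove_symm_apply]
    rfl
  · exact (hF.comp (MeasurableEquiv.measurable _)).aemeasurable

lemma lintegral_eq_normSq_mul {p : ℂ} (hp : p ≠ 0) {F : ℂ → ENNReal} (hF : Measurable F) :
    ∫⁻ a, F a = ENNReal.ofReal (‖p‖ ^ 2) *
      ∫⁻ α, F (-(starRingEnd ℂ α * starRingEnd ℂ p)) := by
  have hdet : LinearMap.det (LinearMap.mul ℝ ℂ (-starRingEnd ℂ p)) = ‖p‖ ^ 2 := by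
    have := Algebra.norm_apply ℝ (-starRingEnd ℂ p)
    rw [Algebra.norm_complex_eq] at this
    rw [← Complex.normSq_eq_norm_sq, ← Complex.normSq_conj, ← Complex.normSq_neg]
    exact this.symm
  have hp' : ‖p‖ ^ 2 ≠ 0 := by simpa using hp
  rw [lintegral_eq_det_mul_lintegral_comp volume (LinearMap.mul ℝ ℂ (-starRingEnd ℂ p))
    (by rw [hdet]; exact hp') hF, hdet, abs_of_nonneg (by positivity)]
  congr 1
  have hmp : MeasurePreserving (starRingEnd ℂ) volume volume :=
    Complex.conjLIE.measurePreserving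
  rw [← hmp.lintegral_comp]
  · refine lintegral_congr fun a => ?_
    congr 1
    simp; ring
  · have : Measurable fun a : ℂ => (LinearMap.mul ℝ ℂ (-starRingEnd ℂ p)) a := by
      simp only [LinearMap.mul_apply']
      fun_prop
    exact hF.comp this

lemma det_sub_eq_of_anticommute {E : Type*} [AddCommGroup E] [Module ℝ E]
    (A J J' : E →ₗ[ℝ] E) (hJ : J ∘ₗ J' = LinearMap.id) (hJ' : J' ∘ₗ J = LinearMap.id)
    (h : J ∘ₗ A ∘ₗ J' = -A) :
    LinearMap.det (LinearMap.id - A) ^ 2 = LinearMap.det (LinearMap.id - A ∘ₗ A) := by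
  have h1 : LinearMap.det (LinearMap.id - A) = LinearMap.det (LinearMap.id + A) := by
    have e := LinearMap.det_conj (LinearMap.id - A) (LinearEquiv.ofLinearMap J J' hJ hJ')
    rw [← e]
    congr 1
    ext x
    have hx := LinearMap.congr_fun h x
    have hx' := LinearMap.congr_fun hJ x
    simp only [LinearMap.comp_apply, LinearMap.neg_apply, LinearMap.id_apply] at hx hx'
    simp [hx, hx']
  have h2 : (LinearMap.id - A) ∘ₗ (LinearMap.id + A) = LinearMap.id - A ∘ₗ A := by
    ext x; simp; abel
  rw [← h2, LinearMap.det_comp, ← h1, sq]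

end haar

section szego

variable {p : ℂ} {m : ℕ}

/-- The antilinear part of the Szegő step. -/
def szegoMap (m : ℕ) (α : ℂ) : (Fin m → ℂ) →ₗ[ℝ] (Fin m → ℂ) where
  toFun v := fun i => starRingEnd ℂ α * conjRev v i
  map_add' v w := by ext i; simp [conjRev, mul_add]
  map_smul' c v := by ext i; simp [conjRev]; ring

lemma det_id_sub_szegoMap {α : ℂ} (hα : ‖α‖ < 1) :
    |LinearMap.det (LinearMap.id - szegoMap m α)| = (1 - ‖α‖ ^ 2) ^ m := by
  have h0 : 0 < 1 - ‖α‖ ^ 2 := by nlinarith [norm_nonneg α]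
  let J : (Fin m → ℂ) →ₗ[ℝ] (Fin m → ℂ) :=
    (LinearMap.lsmul ℂ (Fin m → ℂ) Complex.I).restrictScalars ℝ
  have hJa : ∀ v i, J v i = Complex.I * v i := fun v i => rfl
  have h := det_sub_eq_of_anticommute (szegoMap m α) J (-J)
    (by ext v i; simp [hJa, ← mul_assoc]) (by ext v i; simp [hJa, ← mul_assoc])
    (by
      refine LinearMap.ext fun v => funext fun i => ?_
      simp only [LinearMap.comp_apply, hJa, LinearMap.neg_apply, szegoMap, conjRev,
        LinearMap.coe_mk, AddHom.coe_mk, Pi.neg_apply, map_neg, map_mul, Complex.conj_I]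
      linear_combination (starRingEnd ℂ α * starRingEnd ℂ (v i.rev)) * Complex.I_mul_I)
  have h2 : LinearMap.id - szegoMap m α ∘ₗ szegoMap m α =
      (1 - ‖α‖ ^ 2 : ℝ) • (LinearMap.id : (Fin m → ℂ) →ₗ[ℝ] (Fin m → ℂ)) := by
    refine LinearMap.ext fun v => funext fun i => ?_
    simp only [LinearMap.sub_apply, LinearMap.comp_apply, LinearMap.id_apply, szegoMap, conjRev,
        LinearMap.coe_mk, AddHom.coe_mk, Pi.sub_apply, map_mul, Complex.conj_conj, Fin.rev_rev,
        LinearMap.smul_apply, Pi.smul_apply, Complex.real_smul]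
    push_cast
    rw [← Complex.mul_conj']
    ring
  rw [h2, LinearMap.det_smul, LinearMap.det_id, mul_one, Module.finrank_pi_fintype] at h
  simp only [Complex.finrank_real_complex, Finset.sum_const, Finset.card_univ, Fintype.card_fin,
    smul_eq_mul] at h
  rw [pow_mul, ← sq_abs] at h
  exact (pow_left_inj₀ (abs_nonneg _) (by positivity) two_ne_zero).1 h

variable {Ω : Type*} [MeasurableSpace Ω]

@[fun_prop]
lemma measurable_ev {P : Ω → ℂ} {V : Ω → Fin m → ℂ} {z : Ω → ℂ} (hP : Measurable P)
    (hV : Measurable V) (hz : Measurable z) : Measurable fun x => ev (P x) (V x) (z x) := by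
  unfold ev; fun_prop

lemma measurable_conj : Measurable (starRingEnd ℂ) := Complex.continuous_conj.measurable

@[fun_prop]
lemma measurable_conj_comp {f : Ω → ℂ} (hf : Measurable f) :
    Measurable fun x => starRingEnd ℂ (f x) := measurable_conj.comp hf

@[fun_prop]
lemma measurable_evs {P : Ω → ℂ} {V : Ω → Fin m → ℂ} {z : Ω → ℂ} (hP : Measurable P)
    (hV : Measurable V) (hz : Measurable z) : Measurable fun x => evs (P x) (V x) (z x) := by
  unfold evs; fun_prop

@[fun_prop]
lemma measurable_verb {P : Ω → ℂ} {V : Ω → Fin (m + 1) → ℂ} (hP : Measurable P)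
    (hV : Measurable V) : Measurable fun x => verb (P x) (V x) := by
  unfold verb; fun_prop

@[fun_prop]
lemma measurable_strip {P : Ω → ℂ} {V : Ω → Fin (m + 1) → ℂ} (hP : Measurable P)
    (hV : Measurable V) : Measurable fun x => strip (P x) (V x) := by
  unfold strip conjRev Fin.tail; fun_prop

@[fun_prop]
lemma measurable_uval {P : Ω → ℂ} {V : Ω → Fin m → ℂ} (hP : Measurable P)
    (hV : Measurable V) : Measurable fun x => uval (P x) (V x) := by
  unfold uval
  exact Measurable.ite (measurableSet_eq_fun (by fun_prop) (by fun_prop)) (by fun_prop)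
    (by fun_prop)

@[fun_prop]
lemma measurable_wt (β : ℝ) : ∀ {m : ℕ} {P : Ω → ℂ} {V : Ω → Fin m → ℂ}, Measurable P →
    Measurable V → Measurable fun x => wt β (P x) m (V x)
  | 0, _, _, _, _ => by simp only [wt]; fun_prop
  | m + 1, P, V, hP, hV => by
    simp only [wt]
    exact ((measurable_diskWeight _).comp (by fun_prop)).mul
      (measurable_wt β hP (measurable_strip hP hV))

@[fun_prop]
lemma measurable_phs (t : ℝ) : ∀ {m : ℕ} {P : Ω → ℂ} {V : Ω → Fin m → ℂ}, Measurable P →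
    Measurable V → Measurable fun x => phs (P x) t m (V x)
  | 0, _, _, _, _ => by simp only [phs]; fun_prop
  | m + 1, P, V, hP, hV => by
    simp only [phs]
    have := measurable_phs t hP (measurable_strip hP hV)
    fun_prop

lemma lintegral_diskWeight_mul_rotate {γ : ℝ} (hγ : 0 < γ) {u : ℂ} (hu : ‖u‖ = 1)
    {f : ℂ → ENNReal} (hf : Measurable f) :
    ∫⁻ α, ENNReal.ofReal (diskWeight γ α) * f (α * u) =
      ENNReal.ofReal (Real.pi / γ) * ∫⁻ α, f α ∂(diskMeasure γ) := by
  rw [← diskMeasure_map_mul u hu, lintegral_map hf (by fun_prop),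
    lintegral_diskMeasure hγ (by fun_prop), ← mul_assoc,
    ← ENNReal.ofReal_mul (by have := Real.pi_pos; positivity)]
  have : Real.pi / γ * (γ / Real.pi) = 1 := by
    have := Real.pi_pos; field_simp
  rw [this]
  simp [mul_comm u]

/-- The normalizing constant of the weight. -/
def wtConst (β : ℝ) (p : ℂ) (m : ℕ) : ℝ :=
  ∏ k ∈ Finset.range m, (‖p‖ ^ 2 * (Real.pi / ((k + 1 : ℕ) * (β / 2))))

lemma lintegral_wt {β : ℝ} (hβ : 0 < β) (hp : p ≠ 0) (t : ℝ) : ∀ (m : ℕ) {g : ℝ → ENNReal},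
    Measurable g → ∫⁻ v, ENNReal.ofReal (wt β p m v) * g (phs p t m v) =
      ENNReal.ofReal (wtConst β p m) * ∫⁻ x, g x ∂(phaseLaw β t m)
  | 0, g, hg => by
    simp [wt, phs, phaseLaw, lintegral_dirac' _ hg, wtConst, volume_pi]
  | m + 1, g, hg => by
    set γ : ℝ := (m + 1 : ℕ) * (β / 2) with hγd
    have hγ : 0 < γ := by positivity
    have := isProbabilityMeasure_phaseLaw (t := t) hβ m
    have := isProbabilityMeasure_diskMeasure hγ
    have step : ∀ α : ℂ, ∫⁻ w : Fin m → ℂ,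
        ENNReal.ofReal (wt β p (m + 1) (Fin.cons (-(starRingEnd ℂ α * starRingEnd ℂ p)) w)) *
          g (phs p t (m + 1) (Fin.cons (-(starRingEnd ℂ α * starRingEnd ℂ p)) w)) =
        ∫⁻ v : Fin m → ℂ, ENNReal.ofReal (diskWeight γ α) * (ENNReal.ofReal (wt β p m v) *
          g (t + phs p t m v + phaseShift (phs p t m v) (α * uval p v))) := by
      intro α
      have hverb : ∀ w : Fin m → ℂ,
          verb p (Fin.cons (-(starRingEnd ℂ α * starRingEnd ℂ p)) w) = α := by
        intro w
        simp only [verb, Fin.cons_zero, map_neg, map_mul, Complex.conj_conj]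
        field_simp
      by_cases hα : ‖α‖ < 1
      · have h0 : 0 < 1 - ‖α‖ ^ 2 := by nlinarith [norm_nonneg α]
        have hdet := det_id_sub_szegoMap (m := m) hα
        have hmeas : Measurable fun w : Fin m → ℂ =>
            (Fin.cons (-(starRingEnd ℂ α * starRingEnd ℂ p)) w : Fin (m + 1) → ℂ) := by
          refine measurable_pi_lambda _ fun i => ?_
          refine Fin.cases ?_ (fun i => ?_) i
          · simp
          · simp only [Fin.cons_succ]; fun_prop
        rw [lintegral_eq_det_mul_lintegral_comp volume (LinearMap.id - szegoMap m α) (by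
          intro h; rw [h, abs_zero] at hdet; exact (pow_pos h0 m).ne hdet) (by fun_prop), hdet,
          ← lintegral_const_mul' _ _ ENNReal.ofReal_ne_top]
        refine lintegral_congr fun v => ?_
        have e : (Fin.cons (-(starRingEnd ℂ α * starRingEnd ℂ p))
            ((LinearMap.id - szegoMap m α : (Fin m → ℂ) →ₗ[ℝ] (Fin m → ℂ)) v) : Fin (m + 1) → ℂ) = szego p α v := rfl
        rw [e, wt, phs, verb_szego hp, strip_szego hp hα,
          ENNReal.ofReal_mul (diskWeight_nonneg _ _), ← mul_assoc, ← mul_assoc, ← mul_assoc,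
          ← ENNReal.ofReal_mul (by positivity)]
        congr 4
        rw [diskWeight, diskWeight, if_pos hα, if_pos hα, ← Real.rpow_natCast,
          ← Real.rpow_add h0]
        congr 1
        rw [hγd]; push_cast; ring
      · simp only [wt, hverb]
        simp [diskWeight, hα]
    rw [lintegral_fin_cons (by fun_prop), lintegral_eq_normSq_mul hp, lintegral_congr step,
      lintegral_lintegral_swap]
    · have h2 : ∀ v : Fin m → ℂ, ∫⁻ α, ENNReal.ofReal (diskWeight γ α) *
          (ENNReal.ofReal (wt β p m v) *
            g (t + phs p t m v + phaseShift (phs p t m v) (α * uval p v))) =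
          ENNReal.ofReal (Real.pi / γ) * (ENNReal.ofReal (wt β p m v) *
            ∫⁻ α, g (t + phs p t m v + phaseShift (phs p t m v) α) ∂(diskMeasure γ)) := by
        intro v
        rw [lintegral_diskWeight_mul_rotate hγ (norm_uval p v)
          (f := fun α => ENNReal.ofReal (wt β p m v) *
            g (t + phs p t m v + phaseShift (phs p t m v) α)) (by fun_prop),
          lintegral_const_mul _ (by fun_prop)]
      have hG : Measurable fun x : ℝ => ∫⁻ α, g (t + x + phaseShift x α) ∂(diskMeasure γ) :=
        Measurable.lintegral_prod_right' (f := fun q : ℝ × ℂ => g (t + q.1 + phaseShift q.1 q.2))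
          (by fun_prop)
      rw [lintegral_congr h2, lintegral_const_mul' _ _ ENNReal.ofReal_ne_top,
        lintegral_wt hβ hp t m hG, phaseLaw, lintegral_map hg (by fun_prop),
        lintegral_prod _ (by fun_prop), ← mul_assoc, ← mul_assoc,
        ← ENNReal.ofReal_mul (by positivity), ← ENNReal.ofReal_mul (by positivity)]
      congr 2
      rw [wtConst, wtConst, Finset.prod_range_succ, hγd]
      ring
    · have := measurable_diskWeight γ
      exact Measurable.aemeasurable (by fun_prop)
    · refine Measurable.lintegral_prod_right' (f := fun q : ℂ × (Fin m → ℂ) =>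
        ENNReal.ofReal (wt β p (m + 1) (Fin.cons q.1 q.2)) *
          g (phs p t (m + 1) (Fin.cons q.1 q.2))) ?_
      have hmeas : Measurable fun q : ℂ × (Fin m → ℂ) =>
          (Fin.cons q.1 q.2 : Fin (m + 1) → ℂ) := by
        refine measurable_pi_lambda _ fun i => ?_
        refine Fin.cases ?_ (fun i => ?_) i
        · simp only [Fin.cons_zero]; fun_prop
        · simp only [Fin.cons_succ]; fun_prop
      fun_prop

end szego

section phase

variable {p : ℂ} {m : ℕ}

/-- The quotient `z P(z) / P*(z)`. -/
def blas (p : ℂ) {m : ℕ} (v : Fin m → ℂ) (z : ℂ) : ℂ := z * ev p v z / evs p v z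

/-- The continuous argument of the reversed polynomial on the closed unit disk. -/
def argPol (p : ℂ) : ∀ m : ℕ, (Fin m → ℂ) → ℂ → ℝ
  | 0, _, _ => 0
  | m + 1, v, z => argPol p m (strip p v) z +
      Complex.arg (1 - verb p v * blas p (strip p v) z)

lemma IsGood.norm_blas_le {v : Fin m → ℂ} (h : IsGood p v) {z : ℂ} (hz : ‖z‖ ≤ 1) :
    ‖blas p v z‖ ≤ ‖z‖ := by
  have h1 := norm_pos_iff.2 (h.evs_ne_zero hz)
  rw [blas, norm_div, norm_mul, div_le_iff₀ h1]
  exact mul_le_mul_of_nonneg_left (h.norm_ev_le hz) (norm_nonneg z)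

lemma IsGood.continuousOn_blas {v : Fin m → ℂ} (h : IsGood p v) :
    ContinuousOn (blas p v) (Metric.closedBall 0 1) := by
  unfold blas
  refine ContinuousOn.div (continuous_id.mul (continuous_ev v)).continuousOn
    (continuous_evs v).continuousOn fun z hz => h.evs_ne_zero (by simpa using hz)

lemma re_one_sub_mul_pos {α b : ℂ} (hα : ‖α‖ < 1) (hb : ‖b‖ ≤ 1) : 0 < (1 - α * b).re := by
  have : (α * b).re ≤ ‖α * b‖ := Complex.re_le_norm _
  rw [norm_mul] at this
  simp only [Complex.sub_re, Complex.one_re]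
  nlinarith [norm_nonneg α]

lemma IsGood.continuousOn_argPol : ∀ {m : ℕ} {v : Fin m → ℂ}, IsGood p v →
    ContinuousOn (argPol p m v) (Metric.closedBall 0 1)
  | 0, _, _ => by simp only [argPol]; fun_prop
  | m + 1, v, h => by
    refine h.strip.continuousOn_argPol.add fun z hz => ?_
    have hz' : ‖z‖ ≤ 1 := by simpa using hz
    refine ContinuousAt.comp_continuousWithinAt (f := fun z => 1 - verb p v *
      blas p (_root_.strip p v) z) (Complex.continuousAt_arg ?_) ?_
    · exact Or.inl (re_one_sub_mul_pos h.norm_verb_lt_one ((h.strip.norm_blas_le hz').trans hz'))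
    · have := h.strip.continuousOn_blas z hz
      fun_prop

lemma argPol_zero (p : ℂ) : ∀ {m : ℕ} (v : Fin m → ℂ), argPol p m v 0 = 0
  | 0, _ => rfl
  | m + 1, v => by simp [argPol, argPol_zero p, blas]

lemma IsGood.evs_eq_exp_argPol {z : ℂ} (hz : ‖z‖ ≤ 1) : ∀ {m : ℕ} {v : Fin m → ℂ}, IsGood p v →
    ∃ r : ℝ, 0 < r ∧
      evs p v z = starRingEnd ℂ p * (r * Complex.exp (argPol p m v z * Complex.I))
  | 0, v, _ => ⟨1, one_pos, by simp [evs, argPol]⟩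
  | m + 1, v, h => by
    obtain ⟨r, hr, e⟩ := h.strip.evs_eq_exp_argPol hz
    have hα := h.norm_verb_lt_one
    have h0 := h.strip.evs_ne_zero hz
    set w := 1 - verb p v * blas p (_root_.strip p v) z with hw
    have hre : 0 < w.re := re_one_sub_mul_pos hα ((h.strip.norm_blas_le hz).trans hz)
    have hw0 : w ≠ 0 := by intro h; rw [h] at hre; simp at hre
    refine ⟨r * ‖w‖, mul_pos hr (norm_pos_iff.2 hw0), ?_⟩
    have e1 : evs p v z = evs p (_root_.strip p v) z * w := by
      rw [evs_eq_strip h.1 hα, hw, blas]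
      field_simp
    rw [e1, e, argPol, ← hw]
    conv_lhs => rw [← Complex.norm_mul_exp_arg_mul_I w]
    push_cast
    rw [add_mul, Complex.exp_add]
    ring

lemma norm_exp_ofReal (t : ℝ) : ‖Complex.exp (t * Complex.I)‖ = 1 := Complex.norm_exp_ofReal_mul_I t

lemma IsGood.blas_eq {v : Fin m → ℂ} (h : IsGood p v) {z : ℂ} (hz : ‖z‖ = 1) :
    blas p v z = z ^ (m + 1) * (p / starRingEnd ℂ p) *
      Complex.exp (-2 * argPol p m v z * Complex.I) := by
  obtain ⟨r, hr, e⟩ := h.evs_eq_exp_argPol hz.le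
  have h0 := h.evs_ne_zero hz.le
  have hp : starRingEnd ℂ p ≠ 0 := by simpa using h.1
  have hzz : z * starRingEnd ℂ z = 1 := by rw [Complex.mul_conj', hz]; simp
  have hev : ev p v z = z ^ m * starRingEnd ℂ (evs p v z) := by
    rw [evs_eq_of_norm_eq_one v hz, map_mul, map_pow, Complex.conj_conj, ← mul_assoc, ← mul_pow,
      hzz, one_pow, one_mul]
  rw [blas, div_eq_iff h0, hev, e]
  simp only [map_mul, Complex.conj_conj, Complex.conj_ofReal, ← Complex.exp_conj, Complex.conj_I]
  have : Complex.exp (argPol p m v z * -Complex.I) =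
      Complex.exp (-2 * argPol p m v z * Complex.I) * Complex.exp (argPol p m v z * Complex.I) := by
    rw [← Complex.exp_add]; congr 1; ring
  rw [this]
  field_simp
  ring

lemma IsGood.phs_eq (t : ℝ) : ∀ {m : ℕ} {v : Fin m → ℂ}, IsGood p v →
    phs p t m v = (m + 1) * t - 2 * argPol p m v (Complex.exp (t * Complex.I)) +
      2 * argPol p m v 1
  | 0, v, _ => by simp [phs, argPol]
  | m + 1, v, h => by
    have ih := h.strip.phs_eq t
    have h0 := h.strip.evs_ne_zero (z := 1) (by simp)
    have hu : uval p (_root_.strip p v) = blas p (_root_.strip p v) 1 := by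
      rw [uval, if_neg h0, blas, one_mul]
    have h1 := h.strip.blas_eq (z := 1) (by simp)
    have h2 := h.strip.blas_eq (norm_exp_ofReal t)
    have h3 : uval p (_root_.strip p v) * Complex.exp (phs p t m (_root_.strip p v) * Complex.I) =
        blas p (_root_.strip p v) (Complex.exp (t * Complex.I)) := by
      rw [hu, h1, h2, ← Complex.exp_nat_mul, one_pow, one_mul, mul_assoc, ← Complex.exp_add,
        mul_comm (Complex.exp _) (p / _), mul_assoc (p / _), ← Complex.exp_add, ih]
      congr 2
      push_cast
      ring
    rw [phs, phaseShift, argPol, argPol, mul_assoc (verb p v), h3, hu, ih]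
    push_cast
    ring

lemma eq_zero_of_continuousOn_of_int {f : ℝ → ℝ} (hf : ContinuousOn f (Set.Icc 0 1))
    (h0 : f 0 = 0) (hk : ∀ r ∈ Set.Icc (0 : ℝ) 1, ∃ k : ℤ, f r = k * (2 * Real.pi)) : f 1 = 0 := by
  have hpi := Real.pi_pos
  have key : ∀ c : ℝ, (c = Real.pi ∨ c = -Real.pi) → ∀ r ∈ Set.Icc (0 : ℝ) 1, f r ≠ c := by
    intro c hc r hr h
    obtain ⟨k, hk⟩ := hk r hr
    rw [h] at hk
    rcases hc with rfl | rfl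
    · have h1 : (1 : ℝ) = k * 2 := by
        have : Real.pi * 1 = Real.pi * (k * 2) := by linarith
        exact mul_left_cancel₀ hpi.ne' this
      have : (1 : ℤ) = k * 2 := by exact_mod_cast h1
      omega
    · have h1 : (-1 : ℝ) = k * 2 := by
        have : Real.pi * (-1) = Real.pi * (k * 2) := by linarith
        exact mul_left_cancel₀ hpi.ne' this
      have : (-1 : ℤ) = k * 2 := by exact_mod_cast h1
      omega
  obtain ⟨k, hk1⟩ := hk 1 (by simp)
  rcases lt_trichotomy k 0 with h | h | h
  · exfalso
    have h2 : (k : ℝ) ≤ -1 := by exact_mod_cast (by omega : k ≤ -1)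
    have := intermediate_value_Icc' zero_le_one hf
    obtain ⟨r, hr, hr'⟩ := this (show -Real.pi ∈ _ from ⟨by rw [hk1]; nlinarith, by linarith⟩)
    exact key _ (Or.inr rfl) r hr hr'
  · rw [hk1, h]; simp
  · exfalso
    have h2 : (1 : ℝ) ≤ k := by exact_mod_cast (by omega : 1 ≤ k)
    have := intermediate_value_Icc zero_le_one hf
    obtain ⟨r, hr, hr'⟩ := this (show Real.pi ∈ _ from ⟨by linarith, by rw [hk1]; nlinarith⟩)
    exact key _ (Or.inl rfl) r hr hr'

lemma exists_int_of_prod_exp {ι : Type*} (s : Finset ι) (w : ι → ℂ) (hw : ∀ i ∈ s, w i ≠ 0)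
    {r x : ℝ} (hr : 0 < r) {y : ℂ} (hy : y ≠ 0)
    (h : r * Complex.exp (x * Complex.I) * y = ∏ i ∈ s, w i) :
    ∃ k : ℤ, x + y.arg - ∑ i ∈ s, (w i).arg = k * (2 * Real.pi) := by
  have h1 : ∏ i ∈ s, w i = ((∏ i ∈ s, ‖w i‖ : ℝ) : ℂ) *
      Complex.exp ((∑ i ∈ s, (w i).arg : ℝ) * Complex.I) := by
    push_cast
    rw [Finset.sum_mul, Complex.exp_sum, ← Finset.prod_mul_distrib]
    exact Finset.prod_congr rfl fun i _ => (Complex.norm_mul_exp_arg_mul_I _).symm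
  have h2 : r * Complex.exp (x * Complex.I) * y =
      ((r * ‖y‖ : ℝ) : ℂ) * Complex.exp ((x + y.arg : ℝ) * Complex.I) := by
    conv_lhs => rw [← Complex.norm_mul_exp_arg_mul_I y]
    push_cast
    rw [add_mul, Complex.exp_add]
    ring
  have hR : 0 < r * ‖y‖ := mul_pos hr (norm_pos_iff.2 hy)
  have hS : 0 < ∏ i ∈ s, ‖w i‖ := Finset.prod_pos fun i hi => norm_pos_iff.2 (hw i hi)
  rw [h1, h2] at h
  have h3 := congrArg norm h
  rw [norm_mul, norm_mul, norm_exp_ofReal, norm_exp_ofReal, mul_one, mul_one, Complex.norm_real,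
    Complex.norm_real, Real.norm_of_nonneg hR.le, Real.norm_of_nonneg hS.le] at h3
  rw [← h3] at h
  have h4 := mul_left_cancel₀ (by exact_mod_cast hR.ne') h
  obtain ⟨k, hk⟩ := Complex.exp_eq_exp_iff_exists_int.1 h4
  refine ⟨k, ?_⟩
  have h5 : (((x + y.arg : ℝ) : ℂ)) = ((∑ i ∈ s, (w i).arg + k * (2 * Real.pi) : ℝ) : ℂ) := by
    apply mul_right_cancel₀ Complex.I_ne_zero
    rw [hk]; push_cast; ring
  have h6 : x + y.arg = ∑ i ∈ s, (w i).arg + k * (2 * Real.pi) := by exact_mod_cast h5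
  linarith

lemma arg_one_sub_exp {y : ℝ} (h0 : 0 < y) (h1 : y < 2 * Real.pi) :
    Complex.arg (1 - Complex.exp (y * Complex.I)) = (y - Real.pi) / 2 := by
  have hs : 0 < 2 * Real.sin (y / 2) :=
    mul_pos two_pos (Real.sin_pos_of_pos_of_lt_pi (by linarith) (by linarith))
  have e : 1 - Complex.exp (y * Complex.I) = ((2 * Real.sin (y / 2) : ℝ) : ℂ) *
      Complex.exp ((((y - Real.pi) / 2 : ℝ) : ℂ) * Complex.I) := by
    have ey : (y : ℝ) = 2 * (y / 2) := by ring
    have e2 : (y - Real.pi) / 2 = y / 2 - Real.pi / 2 := by ring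
    rw [e2]
    apply Complex.ext
    · rw [Complex.re_ofReal_mul, Complex.exp_ofReal_mul_I_re, Complex.sub_re, Complex.one_re,
        Complex.exp_ofReal_mul_I_re, Real.cos_sub_pi_div_two]
      conv_lhs => rw [ey, Real.cos_two_mul]
      nlinarith [Real.sin_sq_add_cos_sq (y / 2)]
    · rw [Complex.im_ofReal_mul, Complex.exp_ofReal_mul_I_im, Complex.sub_im, Complex.one_im,
        Complex.exp_ofReal_mul_I_im, Real.sin_sub_pi_div_two]
      conv_lhs => rw [ey, Real.sin_two_mul]
      ring
  rw [e, Complex.arg_real_mul _ hs, Complex.arg_exp_mul_I, toIocMod_eq_self]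
  constructor <;> linarith

lemma re_one_sub_mul_pos' {u z : ℂ} (hu : ‖u‖ = 1) (hz : ‖z‖ ≤ 1) (h : u * z ≠ 1) :
    0 < (1 - u * z).re := by
  have h1 : ‖u * z‖ ≤ 1 := by rw [norm_mul, hu, one_mul]; exact hz
  have h2 : Complex.normSq (u * z) ≤ 1 := by
    rw [Complex.normSq_eq_norm_sq]; exact pow_le_one₀ (norm_nonneg _) h1
  rw [Complex.normSq_apply] at h2
  by_contra! h3
  simp only [Complex.sub_re, Complex.one_re] at h3
  apply h
  have h4 : (u * z).re = 1 := by nlinarith [mul_self_nonneg (u * z).im]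
  have h5 : (u * z).im = 0 := by
    rw [h4] at h2
    nlinarith [mul_self_nonneg (u * z).im]
  apply Complex.ext <;> simp [h4, h5]

lemma IsGood.argPol_eq {v : Fin m → ℂ} (h : IsGood p v) {ε c : ℂ} (hε : ε * ε = 1)
    {u : Fin (m + 1) → ℂ} (hu : ∀ j, ‖u j‖ = 1)
    (hq : ∀ z, z * ev p v z + ε * evs p v z = c * ∏ j, (z - u j)) {ζ : ℂ} (hζ : ‖ζ‖ = 1)
    (hζu : ∀ j, ζ ≠ u j) :
    argPol p m v ζ = ∑ j, Complex.arg (1 - starRingEnd ℂ (u j) * ζ) -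
        Complex.arg (1 - (-ε) * blas p v ζ) ∧ 0 < (1 - (-ε) * blas p v ζ).re := by
  have hεn : ‖-ε‖ = 1 := by
    have h1 := congrArg norm hε
    rw [norm_mul, norm_one] at h1
    rw [norm_neg]
    nlinarith [norm_nonneg ε]
  have hε0 : ε ≠ 0 := by rintro rfl; simp at hε
  have huu : ∀ j, starRingEnd ℂ (u j) * u j = 1 := fun j => by
    rw [mul_comm, Complex.mul_conj', hu]; simp
  have h0 := hq 0
  simp only [zero_mul, zero_add, evs_zero, zero_sub] at h0
  have hp : starRingEnd ℂ p ≠ 0 := by simpa using h.1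
  have hc : c ≠ 0 := by
    rintro rfl
    rw [zero_mul] at h0
    exact mul_ne_zero hε0 hp h0
  have hprod : ∀ z : ℂ, ∏ j, (z - u j) = (∏ j, (-u j)) * ∏ j, (1 - starRingEnd ℂ (u j) * z) := by
    intro z
    rw [← Finset.prod_mul_distrib]
    refine Finset.prod_congr rfl fun j _ => ?_
    linear_combination (-z) * huu j
  have hmain : ∀ z : ℂ, ‖z‖ ≤ 1 → evs p v z * (1 - (-ε) * blas p v z) =
      starRingEnd ℂ p * ∏ j, (1 - starRingEnd ℂ (u j) * z) := by
    intro z hz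
    have e0 := h.evs_ne_zero hz
    have e1 := hq z
    rw [hprod] at e1
    have e2 : evs p v z * (1 - (-ε) * blas p v z) = evs p v z + ε * (z * ev p v z) := by
      rw [blas]; field_simp; ring
    rw [e2]
    apply mul_left_cancel₀ hε0
    linear_combination (z * ev p v z) * hε + e1 -
      (∏ j, (1 - starRingEnd ℂ (u j) * z)) * h0
  have hne : ∀ r ∈ Set.Icc (0 : ℝ) 1, ∀ j, starRingEnd ℂ (u j) * ((r : ℂ) * ζ) ≠ 1 := by
    intro r hr j h1
    have h2 := congrArg norm h1
    rw [norm_mul, norm_mul, RCLike.norm_conj, hu, hζ, Complex.norm_real, norm_one,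
      Real.norm_of_nonneg hr.1, one_mul, mul_one] at h2
    apply hζu j
    rw [h2] at h1
    have h3 := congrArg (u j * ·) h1
    simp only [Complex.ofReal_one, one_mul, mul_one] at h3
    rw [← mul_assoc, mul_comm (u j), huu, one_mul] at h3
    exact h3
  have hnr : ∀ r ∈ Set.Icc (0 : ℝ) 1, ‖(r : ℂ) * ζ‖ ≤ 1 := by
    intro r hr
    rw [norm_mul, hζ, Complex.norm_real, Real.norm_of_nonneg hr.1, mul_one]; exact hr.2
  have hw : ∀ r ∈ Set.Icc (0 : ℝ) 1, ∀ j, 0 < (1 - starRingEnd ℂ (u j) * ((r : ℂ) * ζ)).re :=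
    fun r hr j => re_one_sub_mul_pos' (by rw [RCLike.norm_conj, hu]) (hnr r hr) (hne r hr j)
  have hw0 : ∀ r ∈ Set.Icc (0 : ℝ) 1, ∀ j, 1 - starRingEnd ℂ (u j) * ((r : ℂ) * ζ) ≠ 0 :=
    fun r hr j h => by have := hw r hr j; rw [h] at this; simp at this
  have hb0 : ∀ r ∈ Set.Icc (0 : ℝ) 1, 1 - (-ε) * blas p v ((r : ℂ) * ζ) ≠ 0 := by
    intro r hr h1
    have e := hmain _ (hnr r hr)
    rw [h1, mul_zero] at e
    exact mul_ne_zero hp (Finset.prod_ne_zero_iff.2 fun j _ => hw0 r hr j) e.symm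
  have hb : ∀ r ∈ Set.Icc (0 : ℝ) 1, 0 < (1 - (-ε) * blas p v ((r : ℂ) * ζ)).re := by
    intro r hr
    refine re_one_sub_mul_pos' hεn ((h.norm_blas_le (hnr r hr)).trans (hnr r hr)) ?_
    intro h1
    exact hb0 r hr (by rw [h1, sub_self])
  have hcont : Continuous fun r : ℝ => (r : ℂ) * ζ := by fun_prop
  have hmaps : Set.MapsTo (fun r : ℝ => (r : ℂ) * ζ) (Set.Icc 0 1) (Metric.closedBall 0 1) :=
    fun r hr => by simpa using hnr r hr
  have hf : ContinuousOn (fun r : ℝ => argPol p m v ((r : ℂ) * ζ) +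
      Complex.arg (1 - (-ε) * blas p v ((r : ℂ) * ζ)) -
      ∑ j, Complex.arg (1 - starRingEnd ℂ (u j) * ((r : ℂ) * ζ))) (Set.Icc 0 1) := by
    refine ((h.continuousOn_argPol.comp hcont.continuousOn hmaps).add fun r hr => ?_).sub
      (continuousOn_finsetSum _ fun j _ r hr => ?_)
    · refine ContinuousAt.comp_continuousWithinAt (f := fun r : ℝ => 1 - (-ε) *
        blas p v ((r : ℂ) * ζ)) (Complex.continuousAt_arg (Or.inl (hb r hr))) ?_
      exact continuousWithinAt_const.sub (continuousWithinAt_const.mul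
        ((h.continuousOn_blas.comp hcont.continuousOn hmaps) r hr))
    · refine ContinuousAt.comp_continuousWithinAt (f := fun r : ℝ => 1 - starRingEnd ℂ (u j) *
        ((r : ℂ) * ζ)) (Complex.continuousAt_arg (Or.inl (hw r hr j))) ?_
      exact Continuous.continuousWithinAt (by fun_prop)
  have key := eq_zero_of_continuousOn_of_int hf (by simp [argPol_zero, blas]) (by
    intro r hr
    obtain ⟨ρ, hρ, e⟩ := h.evs_eq_exp_argPol (hnr r hr)
    refine exists_int_of_prod_exp _ _ (fun j _ => hw0 r hr j) hρ (hb0 r hr) ?_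
    have e1 := hmain _ (hnr r hr)
    rw [e, mul_assoc] at e1
    exact mul_left_cancel₀ hp e1)
  have h1 := hb 1 (by simp)
  simp only [Complex.ofReal_one, one_mul] at key h1
  exact ⟨by linarith, h1⟩

lemma IsGood.abs_phs_sub_count_le {v : Fin m → ℂ} (h : IsGood p v) {ε c : ℂ} (hε : ε * ε = 1)
    {θ : Fin (m + 1) → ℝ} (hθ : ∀ j, θ j ∈ Set.Ioo 0 (2 * Real.pi))
    (hq : ∀ z, z * ev p v z + ε * evs p v z = c * ∏ j, (z - Complex.exp (θ j * Complex.I)))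
    {t : ℝ} (ht : t ∈ Set.Ioo 0 (2 * Real.pi)) (hθt : ∀ j, θ j ≠ t) :
    |phs p t m v - 2 * Real.pi * countIn 0 t θ| ≤ 2 * Real.pi := by
  have hconj : ∀ j, starRingEnd ℂ (Complex.exp (θ j * Complex.I)) =
      Complex.exp (-(θ j) * Complex.I) := fun j => by
    rw [← Complex.exp_conj, map_mul, Complex.conj_ofReal, Complex.conj_I]; congr 1; ring
  have hper : ∀ x : ℝ, Complex.exp ((x + 2 * Real.pi : ℝ) * Complex.I) =
      Complex.exp (x * Complex.I) := fun x => by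
    push_cast
    rw [add_mul, Complex.exp_add, Complex.exp_two_pi_mul_I, mul_one]
  have a1 : ∀ j, Complex.arg (1 - starRingEnd ℂ (Complex.exp (θ j * Complex.I)) * 1) =
      (Real.pi - θ j) / 2 := by
    intro j
    have := arg_one_sub_exp (y := -θ j + 2 * Real.pi) (by linarith [(hθ j).2])
      (by linarith [(hθ j).1])
    rw [hper] at this
    rw [mul_one, hconj]
    push_cast at this
    rw [this]; ring
  have a2 : ∀ j, Complex.arg (1 - starRingEnd ℂ (Complex.exp (θ j * Complex.I)) *
      Complex.exp (t * Complex.I)) =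
      (t - θ j + Real.pi) / 2 - if (0 ≤ θ j ∧ θ j < t) then Real.pi else 0 := by
    intro j
    have e : starRingEnd ℂ (Complex.exp (θ j * Complex.I)) * Complex.exp (t * Complex.I) =
        Complex.exp ((t - θ j : ℝ) * Complex.I) := by
      rw [hconj, ← Complex.exp_add]; congr 1; push_cast; ring
    rw [e]
    rcases lt_or_gt_of_ne (hθt j) with h1 | h1
    · rw [if_pos ⟨(hθ j).1.le, h1⟩, arg_one_sub_exp (by linarith)
        (by linarith [ht.2, (hθ j).1])]
      ring
    · rw [if_neg (fun h2 => absurd h2.2 (by linarith)), ← hper,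
        arg_one_sub_exp (by linarith [ht.1, (hθ j).2]) (by linarith)]
      ring
  have inj : ∀ x : ℝ, x ∈ Set.Ico 0 (2 * Real.pi) → (∀ j, θ j ≠ x) → ∀ j,
      Complex.exp (x * Complex.I) ≠ Complex.exp (θ j * Complex.I) := by
    intro x hx hne j he
    obtain ⟨k, hk⟩ := Complex.exp_eq_exp_iff_exists_int.1 he
    have h1 : (x : ℂ) = ((θ j + k * (2 * Real.pi) : ℝ) : ℂ) := by
      apply mul_right_cancel₀ Complex.I_ne_zero
      rw [hk]; push_cast; ring
    have h2 : x = θ j + k * (2 * Real.pi) := by exact_mod_cast h1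
    have hpi := Real.pi_pos
    have hj := hθ j
    have h3 : k = 0 := by
      have b1 : (k : ℝ) < 1 := by
        by_contra! h; nlinarith [hx.2, hj.1]
      have b2 : (-1 : ℝ) < k := by
        by_contra! h; nlinarith [hx.1, hj.2]
      have b1' : k < 1 := by exact_mod_cast b1
      have b2' : -1 < k := by exact_mod_cast b2
      omega
    rw [h3] at h2
    exact hne j (by simp [h2])
  have i1 := h.argPol_eq hε (fun j => norm_exp_ofReal (θ j)) hq (ζ := 1) (by simp)
    (by simpa using inj 0 ⟨le_rfl, Real.two_pi_pos⟩ fun j => (hθ j).1.ne')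
  have i2 := h.argPol_eq hε (fun j => norm_exp_ofReal (θ j)) hq (norm_exp_ofReal t)
    (inj t ⟨ht.1.le, ht.2⟩ hθt)
  have r1 := Complex.abs_arg_le_pi_div_two_iff.2 i1.2.le
  have r2 := Complex.abs_arg_le_pi_div_two_iff.2 i2.2.le
  have hcount : (∑ j, if (0 ≤ θ j ∧ θ j < t) then Real.pi else 0) = countIn 0 t θ * Real.pi := by
    rw [← Finset.sum_filter, Finset.sum_const, nsmul_eq_mul]; rfl
  have s1 : ∑ j : Fin (m + 1), (Real.pi - θ j) / 2 =
      (m + 1) * (Real.pi / 2) - (∑ j, θ j) / 2 := by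
    rw [Finset.sum_div]
    simp only [sub_div, Finset.sum_sub_distrib]
    simp
  have s2 : ∑ j : Fin (m + 1), (t - θ j + Real.pi) / 2 =
      (m + 1) * ((t + Real.pi) / 2) - (∑ j, θ j) / 2 := by
    rw [Finset.sum_div]
    have : ∀ j, (t - θ j + Real.pi) / 2 = (t + Real.pi) / 2 - θ j / 2 := fun j => by ring
    simp only [this, Finset.sum_sub_distrib]
    simp
  have e1 := i1.1
  have e2 := i2.1
  simp only [a1, a2, Finset.sum_sub_distrib, hcount, s1, s2] at e1 e2
  rw [h.phs_eq t, e1, e2]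
  rw [abs_le] at r1 r2 ⊢
  constructor <;> nlinarith [r1.1, r1.2, r2.1, r2.2]

end phase

section coords

variable {n : ℕ}

/-- The point of the unit circle with angle `θ j`. -/
def zpt (θ : Fin n → ℝ) (j : Fin n) : ℂ := Complex.exp (θ j * Complex.I)

/-- The half-angle phase normalizing `∏ (z - z_k)`. -/
def kap (θ : Fin n → ℝ) : ℂ := Complex.exp ((-(∑ j, θ j) / 2 : ℝ) * Complex.I)

/-- The normalized monic product omitting the `j`-th point. -/
def qj (θ : Fin n → ℝ) (j : Fin n) (x : ℂ) : ℂ :=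
  kap θ * ∏ k ∈ Finset.univ.erase j, (x - zpt θ k)

/-- Evaluation of a coefficient vector. -/
def evc (c : Fin n → ℂ) (x : ℂ) : ℂ := ∑ i, c i * x ^ (i : ℕ)

/-- The modulus of the Vandermonde determinant. -/
def vdm (θ : Fin n → ℝ) : ℝ := ∏ i, ∏ j ∈ Finset.Ioi i, ‖zpt θ j - zpt θ i‖

lemma norm_zpt (θ : Fin n → ℝ) (j : Fin n) : ‖zpt θ j‖ = 1 := norm_exp_ofReal _

lemma norm_kap (θ : Fin n → ℝ) : ‖kap θ‖ = 1 := norm_exp_ofReal _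

lemma kap_ne_zero (θ : Fin n → ℝ) : kap θ ≠ 0 := Complex.exp_ne_zero _

lemma prod_norm_sub_eq_vdm_sq (θ : Fin n → ℝ) :
    ∏ j, ∏ k ∈ Finset.univ.erase j, ‖zpt θ j - zpt θ k‖ = vdm θ ^ 2 := by
  have h := Finset.prod_prod_Ioi_mul_eq_prod_prod_off_diag fun i j : Fin n => ‖zpt θ i - zpt θ j‖
  simp only [Finset.compl_singleton] at h
  have h2 : ∀ i j, ‖zpt θ j - zpt θ i‖ * ‖zpt θ i - zpt θ j‖ = ‖zpt θ j - zpt θ i‖ ^ 2 := by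
    intro i j; rw [norm_sub_rev (zpt θ i), sq]
  simp only [h2, Finset.prod_pow] at h
  rw [vdm, h]
  refine Finset.prod_congr rfl fun j _ => Finset.prod_congr rfl fun k _ => norm_sub_rev _ _

/-- Evaluation at a family of nodes. -/
def evNodes (x : Fin n → ℂ) : (Fin n → ℂ) →ₗ[ℂ] (Fin n → ℂ) :=
  Matrix.toLin' (Matrix.vandermonde x)

lemma evNodes_apply (x c : Fin n → ℂ) (k : Fin n) : evNodes x c k = evc c (x k) := by
  simp only [evNodes, Matrix.toLin'_apply, Matrix.mulVec, dotProduct, Matrix.vandermonde_apply, evc]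
  exact Finset.sum_congr rfl fun _ _ => mul_comm _ _

lemma det_evNodes (x : Fin n → ℂ) :
    LinearMap.det (evNodes x) = ∏ i, ∏ j ∈ Finset.Ioi i, (x j - x i) := by
  rw [evNodes, LinearMap.det_toLin', Matrix.det_vandermonde]

lemma det_evNodes_ne_zero {x : Fin n → ℂ} (hx : Function.Injective x) :
    LinearMap.det (evNodes x) ≠ 0 := by
  rw [evNodes, LinearMap.det_toLin']
  exact Matrix.det_vandermonde_ne_zero_iff.2 hx

lemma eq_of_evc_eq {x : Fin n → ℂ} (hx : Function.Injective x) {c c' : Fin n → ℂ}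
    (h : ∀ k, evc c (x k) = evc c' (x k)) : c = c' := by
  have hu := (LinearEquiv.ofIsUnitDet (f := evNodes x) (v := Pi.basisFun ℂ (Fin n))
    (v' := Pi.basisFun ℂ (Fin n)) (by
      rw [LinearMap.det_toMatrix]; exact (det_evNodes_ne_zero hx).isUnit)).injective
  apply hu
  ext k
  simpa [evNodes_apply] using h k

/-- The coefficients of `qj`. -/
def qcoef (θ : Fin n → ℝ) (j i : Fin n) : ℂ :=
  (Polynomial.C (kap θ) * ∏ k ∈ Finset.univ.erase j,
    (Polynomial.X - Polynomial.C (zpt θ k))).coeff i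

lemma evc_qcoef (θ : Fin n → ℝ) (j : Fin n) (x : ℂ) : evc (qcoef θ j) x = qj θ j x := by
  have hd : (Polynomial.C (kap θ) * ∏ k ∈ Finset.univ.erase j,
      (Polynomial.X - Polynomial.C (zpt θ k))).natDegree < n := by
    rw [Polynomial.natDegree_C_mul (kap_ne_zero θ), Polynomial.natDegree_finsetProd_X_sub_C_eq_card,
      Finset.card_erase_of_mem (Finset.mem_univ j), Finset.card_univ, Fintype.card_fin]
    have := j.2
    omega
  have h := Polynomial.eval_eq_sum_range' hd x
  rw [Finset.sum_range] at h
  rw [evc]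
  simp only [qcoef]
  rw [← h]
  simp [Polynomial.eval_prod, qj]

/-- The linear map sending weights to the coefficients of the weighted sum of the `qj`. -/
def wmap (θ : Fin n → ℝ) : (Fin n → ℂ) →ₗ[ℂ] (Fin n → ℂ) where
  toFun c := fun i => ∑ j, c j * qcoef θ j i
  map_add' c d := by ext i; simp [add_mul, Finset.sum_add_distrib]
  map_smul' a c := by ext i; simp [Finset.mul_sum, mul_assoc]

lemma evc_wmap (θ : Fin n → ℝ) (c : Fin n → ℂ) (x : ℂ) :
    evc (wmap θ c) x = ∑ j, c j * qj θ j x := by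
  simp only [← evc_qcoef, evc, Finset.mul_sum, wmap, LinearMap.coe_mk, AddHom.coe_mk,
    Finset.sum_mul]
  rw [Finset.sum_comm]
  simp only [mul_assoc]

lemma qj_zpt_of_ne (θ : Fin n → ℝ) {j k : Fin n} (h : j ≠ k) : qj θ j (zpt θ k) = 0 := by
  rw [qj, Finset.prod_eq_zero (Finset.mem_erase.2 ⟨h.symm, Finset.mem_univ k⟩) (sub_self _),
    mul_zero]

lemma evc_wmap_zpt (θ : Fin n → ℝ) (c : Fin n → ℂ) (j : Fin n) :
    evc (wmap θ c) (zpt θ j) = c j * qj θ j (zpt θ j) := by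
  rw [evc_wmap, Finset.sum_eq_single j]
  · intro k _ hk; rw [qj_zpt_of_ne θ hk, mul_zero]
  · simp

lemma norm_qj_zpt (θ : Fin n → ℝ) (j : Fin n) :
    ‖qj θ j (zpt θ j)‖ = ∏ k ∈ Finset.univ.erase j, ‖zpt θ j - zpt θ k‖ := by
  rw [qj, norm_mul, norm_kap, one_mul, norm_prod]

lemma vdm_ne_zero {θ : Fin n → ℝ} (h : Function.Injective (zpt θ)) : vdm θ ≠ 0 := by
  refine Finset.prod_ne_zero_iff.2 fun i _ => Finset.prod_ne_zero_iff.2 fun j hj => ?_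
  rw [norm_ne_zero_iff, sub_ne_zero]
  exact fun e => (Finset.mem_Ioi.1 hj).ne' (h e)

lemma vdm_nonneg (θ : Fin n → ℝ) : 0 ≤ vdm θ :=
  Finset.prod_nonneg fun _ _ => Finset.prod_nonneg fun _ _ => norm_nonneg _

lemma norm_det_wmap {θ : Fin n → ℝ} (h : Function.Injective (zpt θ)) :
    ‖LinearMap.det (wmap θ)‖ = vdm θ := by
  have h1 : evNodes (zpt θ) ∘ₗ wmap θ = Matrix.toLin' (Matrix.diagonal fun j => qj θ j (zpt θ j)) := by
    refine LinearMap.ext fun c => funext fun j => ?_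
    rw [LinearMap.comp_apply, evNodes_apply, evc_wmap_zpt, Matrix.toLin'_apply,
      Matrix.mulVec_diagonal, mul_comm]
  have h2 := congrArg (fun L => ‖LinearMap.det L‖) h1
  simp only [LinearMap.det_comp, LinearMap.det_toLin', Matrix.det_diagonal, norm_mul, norm_prod,
    norm_qj_zpt, prod_norm_sub_eq_vdm_sq, det_evNodes] at h2
  have h3 := vdm_ne_zero h
  rw [← vdm, sq] at h2
  exact mul_left_cancel₀ h3 h2

lemma abs_det_wmap {θ : Fin n → ℝ} (h : Function.Injective (zpt θ)) :
    |LinearMap.det ((wmap θ).restrictScalars ℝ)| = vdm θ ^ 2 := by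
  rw [LinearMap.det_restrictScalars, Algebra.norm_complex_eq]
  change |Complex.normSq _| = _
  rw [Complex.normSq_eq_norm_sq, norm_det_wmap h, abs_of_nonneg (by positivity)]

/-- The coefficient vector attached to the points `e^{i Im ζ_j}` and weights `Re ζ_j`. -/
def psi (ζ : Fin n → ℂ) : Fin n → ℂ :=
  wmap (fun j => (ζ j).im) fun j => ((ζ j).re : ℂ)

lemma evc_psi (ζ : Fin n → ℂ) (x : ℂ) :
    evc (psi ζ) x = ∑ j, ((ζ j).re : ℂ) * qj (fun j => (ζ j).im) j x := evc_wmap _ _ _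

end coords

section coords

variable {n : ℕ}

/-- Half the cotangent of half the angle between two circle points, up to sign. -/
def cotc (θ : Fin n → ℝ) (j l : Fin n) : ℝ :=
  (Complex.I * zpt θ l / (zpt θ j - zpt θ l)).re

lemma cotc_eq {θ : Fin n → ℝ} {j l : Fin n} (h : zpt θ j ≠ zpt θ l) :
    (cotc θ j l : ℂ) =
      Complex.I * zpt θ l / (zpt θ j - zpt θ l) + Complex.I / 2 := by
  have hz : ∀ k, zpt θ k ≠ 0 := fun k => Complex.exp_ne_zero _
  have hc : ∀ k, starRingEnd ℂ (zpt θ k) = (zpt θ k)⁻¹ := fun k =>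
    (Complex.inv_eq_conj (norm_zpt θ k)).symm
  have h0 : zpt θ j - zpt θ l ≠ 0 := sub_ne_zero.2 h
  have h0' : zpt θ l - zpt θ j ≠ 0 := sub_ne_zero.2 h.symm
  rw [cotc, Complex.re_eq_add_conj]
  simp only [map_div₀, map_mul, map_sub, Complex.conj_I, hc]
  have e : (zpt θ j)⁻¹ - (zpt θ l)⁻¹ = (zpt θ l - zpt θ j) / (zpt θ j * zpt θ l) := by
    have := hz j; have := hz l
    field_simp
  rw [e, ← neg_sub (zpt θ j)]
  have := hz j; have := hz l
  field_simp
  ring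

/-- The diagonal part of the derivative of `psi`. -/
def dmap (s : ℝ) (n : ℕ) : (Fin n → ℂ) →ₗ[ℝ] (Fin n → ℂ) where
  toFun h := fun j => ((h j).re : ℂ) - Complex.I * (s / 2) * ((h j).im : ℂ)
  map_add' h k := by ext j; simp only [Pi.add_apply, Complex.add_re, Complex.add_im]; push_cast; ring
  map_smul' a h := by
    ext j
    simp only [Pi.smul_apply, Complex.real_smul, Complex.re_ofReal_mul, Complex.im_ofReal_mul,
      RingHom.id_apply]
    push_cast; ring

/-- The nilpotent part of the derivative of `psi`. -/
def nmap (ζ : Fin n → ℂ) : (Fin n → ℂ) →ₗ[ℝ] (Fin n → ℂ) where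
  toFun h := fun j => ((∑ l ∈ Finset.univ.erase j,
    ((ζ l).re * cotc (fun j => (ζ j).im) l j * (h j).im -
      (ζ j).re * cotc (fun j => (ζ j).im) j l * (h l).im) : ℝ) : ℂ)
  map_add' h k := by
    ext j
    simp only [Pi.add_apply, Complex.add_im]
    push_cast
    rw [← Finset.sum_add_distrib]
    refine Finset.sum_congr rfl fun l _ => ?_
    ring
  map_smul' a h := by
    ext j
    simp only [Pi.smul_apply, RingHom.id_apply, Complex.real_smul, Complex.im_ofReal_mul]
    push_cast
    rw [Finset.mul_sum]
    refine Finset.sum_congr rfl fun l _ => ?_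
    ring

/-- The derivative of `psi` in the coordinates given by `wmap`. -/
def tmap (ζ : Fin n → ℂ) : (Fin n → ℂ) →ₗ[ℝ] (Fin n → ℂ) :=
  dmap (∑ j, (ζ j).re) n ∘ₗ (LinearMap.id - (-nmap ζ))

lemma tmap_apply (ζ h : Fin n → ℂ) (j : Fin n) :
    tmap ζ h j = (h j).re - Complex.I * ((∑ j, (ζ j).re : ℝ) / 2) * (h j).im +
      ∑ l ∈ Finset.univ.erase j, (((ζ l).re : ℂ) * cotc (fun j => (ζ j).im) l j * (h j).im -
        ((ζ j).re : ℂ) * cotc (fun j => (ζ j).im) j l * (h l).im) := by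
  simp only [tmap, LinearMap.comp_apply, LinearMap.sub_apply, LinearMap.id_apply, dmap, nmap,
    LinearMap.neg_apply, LinearMap.coe_mk, AddHom.coe_mk, Pi.sub_apply, Pi.neg_apply,
    Complex.sub_re, Complex.sub_im, Complex.neg_re, Complex.neg_im, Complex.ofReal_re,
    Complex.ofReal_im, neg_zero, sub_zero]
  push_cast
  ring

lemma det_id_add_nmap (ζ : Fin n → ℂ) :
    |LinearMap.det (LinearMap.id - (-nmap ζ))| = 1 := by
  let J : (Fin n → ℂ) →ₗ[ℝ] (Fin n → ℂ) :=
    LinearMap.pi fun j => Complex.conjAe.toLinearMap ∘ₗ LinearMap.proj j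
  have hJ : ∀ v j, J v j = starRingEnd ℂ (v j) := fun v j => rfl
  have hJJ : J ∘ₗ J = LinearMap.id := by
    refine LinearMap.ext fun v => funext fun j => ?_
    simp [hJ]
  have h := det_sub_eq_of_anticommute (-nmap ζ) J J hJJ hJJ (by
    refine LinearMap.ext fun v => funext fun j => ?_
    simp only [LinearMap.comp_apply, hJ, LinearMap.neg_apply, nmap, LinearMap.coe_mk,
      AddHom.coe_mk, Pi.neg_apply, map_neg, Complex.conj_ofReal, Complex.conj_im, neg_neg]
    rw [← Complex.ofReal_neg, ← Finset.sum_neg_distrib]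
    congr 1
    refine Finset.sum_congr rfl fun l _ => ?_
    ring)
  have h2 : (-nmap ζ) ∘ₗ (-nmap ζ) = 0 := by
    refine LinearMap.ext fun v => funext fun j => ?_
    simp [LinearMap.comp_apply, nmap]
  rw [h2, sub_zero, LinearMap.det_id] at h
  rw [← sq_abs] at h
  nlinarith [abs_nonneg (LinearMap.det (LinearMap.id - (-nmap ζ)))]

lemma det_dmap (s : ℝ) (hs : 0 ≤ s) : |LinearMap.det (dmap s n)| = (s / 2) ^ n := by
  let d : ℂ →ₗ[ℝ] ℂ :=
    { toFun := fun h => (h.re : ℂ) - Complex.I * (s / 2) * (h.im : ℂ)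
      map_add' := fun h k => by simp only [Complex.add_re, Complex.add_im]; push_cast; ring
      map_smul' := fun a h => by
        simp only [Complex.real_smul, Complex.re_ofReal_mul, Complex.im_ofReal_mul,
          RingHom.id_apply]
        push_cast; ring }
  have h1 : dmap s n = LinearMap.pi fun i => d ∘ₗ LinearMap.proj i := rfl
  have h2 : LinearMap.det d = -(s / 2) := by
    rw [← LinearMap.det_toMatrix Complex.basisOneI, Matrix.det_fin_two]
    simp [LinearMap.toMatrix_apply, d]
  rw [h1, LinearMap.det_pi, Finset.prod_const, h2, Finset.card_univ, Fintype.card_fin, abs_pow,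
    abs_neg, abs_of_nonneg (by positivity)]

lemma det_tmap (ζ : Fin n → ℂ) (hs : 0 ≤ ∑ j, (ζ j).re) :
    |LinearMap.det (tmap ζ)| = ((∑ j, (ζ j).re) / 2) ^ n := by
  rw [tmap, LinearMap.det_comp, abs_mul, det_id_add_nmap, mul_one, det_dmap _ hs]

lemma sum_erase_swap (F : Fin n → Fin n → ℂ) :
    ∑ j, ∑ l ∈ Finset.univ.erase j, F j l = ∑ j, ∑ l ∈ Finset.univ.erase j, F l j := by
  rw [Finset.sum_comm' (t' := Finset.univ) (s' := fun l => Finset.univ.erase l)]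
  intro x y
  simp [eq_comm]

lemma partial_fractions (w d : Fin n → ℂ) (z : Fin n → ℂ) (c : Fin n → Fin n → ℂ) (x : ℂ)
    (hx : ∀ j, x - z j ≠ 0) (hz : Function.Injective z)
    (hc : ∀ j l, j ≠ l → c j l = Complex.I * z l / (z j - z l) + Complex.I / 2) :
    ∑ j, w j * (Complex.I * d j * z j) / (x - z j) ^ 2 +
      (-(∑ l, d l) / 2 * Complex.I - ∑ l, Complex.I * d l * z l / (x - z l)) *
        ∑ j, w j / (x - z j) =
    ∑ j, (- Complex.I * ((∑ l, w l) / 2) * d j +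
      ∑ l ∈ Finset.univ.erase j, (w l * c l j * d j - w j * c j l * d l)) / (x - z j) := by
  have e1 : (-(∑ l, d l) / 2 * Complex.I - ∑ l, Complex.I * d l * z l / (x - z l)) *
        ∑ j, w j / (x - z j) =
      ∑ j, ∑ l, (w j / (x - z j)) * (-(Complex.I / 2) * d l - Complex.I * d l * z l / (x - z l)) := by
    rw [Finset.mul_sum]
    refine Finset.sum_congr rfl fun j _ => ?_
    rw [← Finset.mul_sum, Finset.sum_sub_distrib, ← Finset.mul_sum]
    ring
  have e2 : ∀ j, ∑ l, (w j / (x - z j)) *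
      (-(Complex.I / 2) * d l - Complex.I * d l * z l / (x - z l)) =
      (w j / (x - z j)) * (-(Complex.I / 2) * d j - Complex.I * d j * z j / (x - z j)) +
      ∑ l ∈ Finset.univ.erase j, (w j / (x - z j)) *
      (-(Complex.I / 2) * d l - Complex.I * d l * z l / (x - z l)) := fun j =>
    (Finset.add_sum_erase _ _ (Finset.mem_univ j)).symm
  have e3 : ∀ j, (- Complex.I * ((∑ l, w l) / 2) * d j +
      ∑ l ∈ Finset.univ.erase j, (w l * c l j * d j - w j * c j l * d l)) / (x - z j) =
      - (Complex.I / 2) * w j * d j / (x - z j) +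
      (∑ l ∈ Finset.univ.erase j, (c l j - Complex.I / 2) * w l * d j / (x - z j) -
      ∑ l ∈ Finset.univ.erase j, w j * c j l * d l / (x - z j)) := by
    intro j
    rw [← Finset.add_sum_erase _ w (Finset.mem_univ j), ← Finset.sum_sub_distrib]
    have : ∑ l ∈ Finset.univ.erase j, ((c l j - Complex.I / 2) * w l * d j / (x - z j) -
        w j * c j l * d l / (x - z j)) =
        (∑ l ∈ Finset.univ.erase j, (w l * c l j * d j - w j * c j l * d l) -
          (Complex.I / 2) * d j * ∑ l ∈ Finset.univ.erase j, w l) / (x - z j) := by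
      rw [Finset.mul_sum, ← Finset.sum_sub_distrib, Finset.sum_div]
      refine Finset.sum_congr rfl fun l _ => ?_
      ring
    rw [this]
    ring
  rw [e1, Finset.sum_congr rfl fun j _ => e2 j, Finset.sum_congr rfl fun j _ => e3 j,
    Finset.sum_add_distrib, Finset.sum_add_distrib, Finset.sum_sub_distrib,
    sum_erase_swap fun j l => (c l j - Complex.I / 2) * w l * d j / (x - z j),
    ← Finset.sum_sub_distrib]
  rw [← add_assoc, ← Finset.sum_add_distrib]
  congr 1
  · refine Finset.sum_congr rfl fun j _ => ?_
    have := hx j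
    field_simp
    ring
  · refine Finset.sum_congr rfl fun j _ => ?_
    rw [← Finset.sum_sub_distrib]
    refine Finset.sum_congr rfl fun l hl => ?_
    have hjl : j ≠ l := (Finset.ne_of_mem_erase hl).symm
    have h0 : z j - z l ≠ 0 := sub_ne_zero.2 fun h => hjl (hz h)
    rw [hc j l hjl]
    have := hx j
    have := hx l
    field_simp
    ring

lemma hasDerivAt_zpt (θ d : Fin n → ℝ) (j : Fin n) :
    HasDerivAt (fun t : ℝ => zpt (fun j => θ j + t * d j) j)
      (Complex.I * d j * zpt θ j) 0 := by
  have h1 : HasDerivAt (fun t : ℝ => ((θ j + t * d j : ℝ) : ℂ) * Complex.I)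
      ((d j : ℂ) * Complex.I) 0 := by
    refine HasDerivAt.mul_const ?_ _
    refine HasDerivAt.ofReal_comp ?_
    simpa using ((hasDerivAt_id (0 : ℝ)).mul_const (d j)).const_add (θ j)
  have h2 := h1.cexp
  simp only [zero_mul, add_zero] at h2
  convert! h2 using 1
  rw [zpt]; ring

lemma hasDerivAt_kap (θ d : Fin n → ℝ) :
    HasDerivAt (fun t : ℝ => kap (fun j => θ j + t * d j))
      (kap θ * (-(∑ j, (d j : ℂ)) / 2 * Complex.I)) 0 := by
  have h1 : HasDerivAt (fun t : ℝ => ((-(∑ j, (θ j + t * d j)) / 2 : ℝ) : ℂ) * Complex.I)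
      (((-(∑ j, d j) / 2 : ℝ) : ℂ) * Complex.I) 0 := by
    refine HasDerivAt.mul_const ?_ _
    refine HasDerivAt.ofReal_comp ?_
    refine HasDerivAt.div_const (HasDerivAt.fun_neg ?_) 2
    refine HasDerivAt.fun_sum fun j _ => ?_
    simpa using ((hasDerivAt_id (0 : ℝ)).mul_const (d j)).const_add (θ j)
  have h2 := h1.cexp
  simp only [zero_mul, add_zero] at h2
  convert! h2 using 1
  rw [kap]; push_cast; rfl

lemma qj_eq_div (θ : Fin n → ℝ) (j : Fin n) {x : ℂ} (hx : x - zpt θ j ≠ 0) :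
    qj θ j x = kap θ * (∏ k, (x - zpt θ k)) / (x - zpt θ j) := by
  rw [qj, ← Finset.mul_prod_erase _ _ (Finset.mem_univ j)]
  field_simp

lemma sub_zpt_ne_zero (θ : Fin n → ℝ) (j : Fin n) {x : ℂ} (hx : ‖x‖ ≠ 1) : x - zpt θ j ≠ 0 := by
  intro h
  rw [sub_eq_zero.1 h] at hx
  exact hx (norm_zpt θ j)

lemma hasDerivAt_evc_psi (ζ h : Fin n → ℂ) {x : ℂ} (hx : ‖x‖ ≠ 1)
    (hz : Function.Injective (zpt fun j => (ζ j).im)) :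
    HasDerivAt (fun t : ℝ => evc (psi (ζ + t • h)) x)
      (evc (wmap (fun j => (ζ j).im) (tmap ζ h)) x) 0 := by
  set θ : Fin n → ℝ := fun j => (ζ j).im with hθ
  set d : Fin n → ℝ := fun j => (h j).im with hd
  have him : ∀ t : ℝ, (fun j => ((ζ + t • h) j).im) = fun j => θ j + t * d j := by
    intro t; ext j; simp [hθ, hd]
  have hx0 : ∀ (θ : Fin n → ℝ) j, x - zpt θ j ≠ 0 := fun θ j => sub_zpt_ne_zero θ j hx
  have hf : (fun t : ℝ => evc (psi (ζ + t • h)) x) = fun t : ℝ =>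
      (kap (fun j => θ j + t * d j) * ∏ k, (x - zpt (fun j => θ j + t * d j) k)) *
        ∑ j, (((ζ j).re : ℂ) + t * (h j).re) / (x - zpt (fun j => θ j + t * d j) j) := by
    ext t
    rw [evc_psi, him, Finset.mul_sum]
    refine Finset.sum_congr rfl fun j _ => ?_
    rw [qj_eq_div _ _ (hx0 _ _)]
    simp
    ring
  have hz' := hasDerivAt_zpt θ d
  have h1 : HasDerivAt (fun t : ℝ => ∏ k, (x - zpt (fun j => θ j + t * d j) k))
      ((∏ k, (x - zpt θ k)) * (-∑ l, Complex.I * d l * zpt θ l / (x - zpt θ l))) 0 := by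
    have := HasDerivAt.fun_finsetProd (u := Finset.univ)
      (f := fun k (t : ℝ) => x - zpt (fun j => θ j + t * d j) k)
      (f' := fun k => -(Complex.I * d k * zpt θ k)) (x := (0 : ℝ))
      fun k _ => (hz' k).const_sub x
    convert! this using 1
    rw [mul_neg, Finset.mul_sum, ← Finset.sum_neg_distrib]
    refine Finset.sum_congr rfl fun l _ => ?_
    simp only [zero_mul, add_zero, smul_eq_mul]
    rw [← Finset.mul_prod_erase _ _ (Finset.mem_univ l)]
    have := hx0 θ l
    field_simp
  have h2 : HasDerivAt (fun t : ℝ => ∑ j, (((ζ j).re : ℂ) + t * (h j).re) /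
      (x - zpt (fun j => θ j + t * d j) j))
      (∑ j, (((h j).re : ℂ) * (x - zpt θ j) - (ζ j).re * (-(Complex.I * d j * zpt θ j))) /
        (x - zpt θ j) ^ 2) 0 := by
    refine HasDerivAt.fun_sum fun j _ => ?_
    have hn : HasDerivAt (fun t : ℝ => ((ζ j).re : ℂ) + t * (h j).re) ((h j).re : ℂ) 0 := by
      simpa using ((hasDerivAt_id (0 : ℝ)).ofReal_comp.mul_const ((h j).re : ℂ)).const_add
        ((ζ j).re : ℂ)
    have := hn.fun_div ((hz' j).const_sub x) (hx0 _ j)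
    simpa only [zero_mul, add_zero, Complex.ofReal_zero] using this
  rw [hf]
  convert! ((hasDerivAt_kap θ d).fun_mul h1).fun_mul h2 using 1
  simp only [zero_mul, add_zero, Complex.ofReal_zero]
  have hp := partial_fractions (fun j => ((ζ j).re : ℂ)) (fun j => (d j : ℂ)) (zpt θ)
    (fun j l => (cotc θ j l : ℂ)) x (hx0 θ) hz fun j l hjl => cotc_eq fun e => hjl (hz e)
  have hs : ∑ j, (((h j).re : ℂ) * (x - zpt θ j) - (ζ j).re * (-(Complex.I * d j * zpt θ j))) /
        (x - zpt θ j) ^ 2 = ∑ j, ((h j).re : ℂ) / (x - zpt θ j) +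
      ∑ j, ((ζ j).re : ℂ) * (Complex.I * d j * zpt θ j) / (x - zpt θ j) ^ 2 := by
    rw [← Finset.sum_add_distrib]
    refine Finset.sum_congr rfl fun j _ => ?_
    have := hx0 θ j
    field_simp
    ring
  have ht : ∑ j, tmap ζ h j / (x - zpt θ j) = ∑ j, ((h j).re : ℂ) / (x - zpt θ j) +
      ∑ j, (- Complex.I * ((∑ l, ((ζ l).re : ℂ)) / 2) * d j +
      ∑ l ∈ Finset.univ.erase j, (((ζ l).re : ℂ) * cotc θ l j * d j - (ζ j).re * cotc θ j l * d l)) /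
        (x - zpt θ j) := by
    rw [← Finset.sum_add_distrib]
    refine Finset.sum_congr rfl fun j _ => ?_
    rw [tmap_apply, ← add_div]
    congr 1
    push_cast
    ring
  rw [evc_wmap]
  have hl : ∑ j, tmap ζ h j * qj θ j x =
      kap θ * (∏ k, (x - zpt θ k)) * ∑ j, tmap ζ h j / (x - zpt θ j) := by
    rw [Finset.mul_sum]
    refine Finset.sum_congr rfl fun j _ => ?_
    rw [qj_eq_div _ _ (hx0 _ _)]
    ring
  rw [hl, ht, ← hp, hs]
  ring

end coords

section coords

variable {n : ℕ}

lemma differentiable_re_apply (j : Fin n) :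
    Differentiable ℝ fun ζ : Fin n → ℂ => (((ζ j).re : ℝ) : ℂ) :=
  (Complex.ofRealCLM ∘L Complex.reCLM ∘L
    (ContinuousLinearMap.proj j : (Fin n → ℂ) →L[ℝ] ℂ)).differentiable

lemma differentiable_im_apply (j : Fin n) :
    Differentiable ℝ fun ζ : Fin n → ℂ => (((ζ j).im : ℝ) : ℂ) :=
  (Complex.ofRealCLM ∘L Complex.imCLM ∘L
    (ContinuousLinearMap.proj j : (Fin n → ℂ) →L[ℝ] ℂ)).differentiable

lemma differentiable_evc_psi (x : ℂ) : Differentiable ℝ fun ζ : Fin n → ℂ => evc (psi ζ) x := by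
  have hr := differentiable_re_apply (n := n)
  have hi := differentiable_im_apply (n := n)
  have hz : ∀ k, Differentiable ℝ fun ζ : Fin n → ℂ => zpt (fun j => (ζ j).im) k := fun k => by
    unfold zpt
    exact ((hi k).mul_const _).cexp
  have hk : Differentiable ℝ fun ζ : Fin n → ℂ => kap (fun j => (ζ j).im) := by
    unfold kap
    refine Differentiable.cexp (Differentiable.mul_const ?_ _)
    push_cast
    fun_prop
  simp only [evc_psi, qj]
  fun_prop

lemma hasFDerivAt_psi (ζ : Fin n → ℂ) (hz : Function.Injective (zpt fun j => (ζ j).im)) :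
    HasFDerivAt psi (((wmap fun j => (ζ j).im).restrictScalars ℝ ∘ₗ tmap ζ).toContinuousLinearMap)
      ζ := by
  set x : Fin n → ℂ := fun k => ((k : ℕ) + 2 : ℕ) with hx
  have hxi : Function.Injective x := by
    intro a b h
    simp only [hx, Nat.cast_inj] at h
    exact Fin.ext (by omega)
  have hx1 : ∀ k, ‖x k‖ ≠ 1 := by
    intro k
    simp only [hx, Complex.norm_natCast]
    have : (k : ℕ) + 2 ≠ 1 := by omega
    exact_mod_cast this
  let e : (Fin n → ℂ) ≃ₗ[ℂ] (Fin n → ℂ) := LinearEquiv.ofIsUnitDet (f := evNodes x)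
    (v := Pi.basisFun ℂ (Fin n)) (v' := Pi.basisFun ℂ (Fin n)) (by
      rw [LinearMap.det_toMatrix]; exact (det_evNodes_ne_zero hxi).isUnit)
  have he : ∀ c, e c = evNodes x c := fun c => rfl
  have hG : Differentiable ℝ fun ζ : Fin n → ℂ => e (psi ζ) := by
    rw [differentiable_pi]
    intro k
    simp only [he, evNodes_apply]
    exact differentiable_evc_psi _
  have hd : DifferentiableAt ℝ psi ζ := by
    have h1 : Differentiable ℝ fun c : Fin n → ℂ => e.symm c :=
      ((e.symm.toLinearMap.restrictScalars ℝ).toContinuousLinearMap).differentiable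
    have h2 := (h1.comp hG) ζ
    have h3 : (fun c => e.symm c) ∘ (fun ζ : Fin n → ℂ => e (psi ζ)) = psi := by
      ext1 ζ; simp
    rwa [h3] at h2
  have hD := hd.hasFDerivAt
  convert hD using 1
  refine ContinuousLinearMap.ext fun h => ?_
  refine eq_of_evc_eq hxi fun k => ?_
  have h1 := hasDerivAt_evc_psi ζ h (hx1 k) hz
  have h2 : HasDerivAt (fun t : ℝ => psi (ζ + t • h)) (fderiv ℝ psi ζ h) 0 := by
    have hl : HasDerivAt (fun t : ℝ => ζ + t • h) h 0 := by
      simpa using ((hasDerivAt_id (0 : ℝ)).smul_const h).const_add ζ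
    have hD' : HasFDerivAt psi (fderiv ℝ psi ζ) (ζ + (0 : ℝ) • h) := by simpa using hD
    exact hD'.comp_hasDerivAt (0 : ℝ) hl
  have h3 : HasDerivAt (fun t : ℝ => evc (psi (ζ + t • h)) (x k))
      (evc (fderiv ℝ psi ζ h) (x k)) 0 := by
    unfold evc
    refine HasDerivAt.fun_sum fun i _ => HasDerivAt.mul_const ?_ _
    exact (hasDerivAt_pi.1 h2) i
  exact h1.unique h3

lemma abs_det_fderiv_psi (ζ : Fin n → ℂ) (hz : Function.Injective (zpt fun j => (ζ j).im))
    (hs : 0 ≤ ∑ j, (ζ j).re) :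
    |(((wmap fun j => (ζ j).im).restrictScalars ℝ ∘ₗ tmap ζ).toContinuousLinearMap).det| =
      vdm (fun j => (ζ j).im) ^ 2 * ((∑ j, (ζ j).re) / 2) ^ n := by
  change |LinearMap.det ((wmap fun j => (ζ j).im).restrictScalars ℝ ∘ₗ tmap ζ)| = _
  rw [LinearMap.det_comp, abs_mul, abs_det_wmap hz, det_tmap ζ hs]

end coords

section bijection

variable {m n : ℕ}

/-- Configurations of increasing angles in `(0, 2π)` with positive weights. -/
def dom (n : ℕ) : Set (Fin n → ℂ) :=
  {ζ | StrictMono (fun j => (ζ j).im) ∧ ∀ j, (ζ j).im ∈ Set.Ioo 0 (2 * Real.pi) ∧ 0 < (ζ j).re}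

lemma exp_ofReal_injOn : Set.InjOn (fun x : ℝ => Complex.exp (x * Complex.I))
    (Set.Ioo 0 (2 * Real.pi)) := by
  intro x hx y hy h
  obtain ⟨k, hk⟩ := Complex.exp_eq_exp_iff_exists_int.1 h
  have h1 : x = y + k * (2 * Real.pi) := by
    have := congrArg Complex.im hk
    simpa using this
  have hpi := Real.pi_pos
  have hk0 : k = 0 := by
    have a1 : (-1 : ℝ) < k := by nlinarith [hx.1, hy.2]
    have a2 : (k : ℝ) < 1 := by nlinarith [hx.2, hy.1]
    have a1' : (-1 : ℤ) < k := by exact_mod_cast a1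
    have a2' : k < (1 : ℤ) := by exact_mod_cast a2
    omega
  rw [h1, hk0]; simp

lemma injective_zpt_of_mem {θ : Fin n → ℝ} (h : Function.Injective θ)
    (hθ : ∀ j, θ j ∈ Set.Ioo 0 (2 * Real.pi)) : Function.Injective (zpt θ) :=
  fun _ _ e => h (exp_ofReal_injOn (hθ _) (hθ _) e)

lemma injective_zpt_of_mem_dom {ζ : Fin n → ℂ} (h : ζ ∈ dom n) :
    Function.Injective (zpt fun j => (ζ j).im) :=
  injective_zpt_of_mem h.1.injective fun j => (h.2 j).1

lemma measurableSet_dom (n : ℕ) : MeasurableSet (dom n) := by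
  have h1 : dom n = (⋂ i : Fin n, ⋂ j : Fin n, ⋂ _ : i < j, {ζ : Fin n → ℂ | (ζ i).im < (ζ j).im}) ∩
      ⋂ j : Fin n, ({ζ : Fin n → ℂ | 0 < (ζ j).im} ∩ {ζ | (ζ j).im < 2 * Real.pi} ∩
        {ζ | 0 < (ζ j).re}) := by
    ext ζ
    simp only [dom, StrictMono, Set.mem_ofPred_eq, Set.mem_inter_iff, Set.mem_iInter, Set.mem_Ioo]
  rw [h1]
  refine MeasurableSet.inter ?_ ?_
  · refine MeasurableSet.iInter fun i => MeasurableSet.iInter fun j => MeasurableSet.iInter fun _ => ?_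
    exact measurableSet_lt (by fun_prop) (by fun_prop)
  · refine MeasurableSet.iInter fun j => MeasurableSet.inter (MeasurableSet.inter ?_ ?_) ?_ <;>
    exact measurableSet_lt (by fun_prop) (by fun_prop)

lemma evc_eq_ev (c : Fin (m + 1) → ℂ) (x : ℂ) : evc c x = ev (c (Fin.last m)) (Fin.init c) x := by
  rw [evc, ev, Fin.sum_univ_castSucc, add_comm]
  simp [Fin.init]

lemma exists_prod_sub_eq (x : Fin n → ℂ) :
    ∃ d : Fin n → ℂ, ∀ z, ∏ j, (z - x j) = z ^ n + evc d z := by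
  set f : Polynomial ℂ := ∏ j, (Polynomial.X - Polynomial.C (x j)) with hf
  have hm : f.Monic := Polynomial.monic_prod_of_monic _ _ fun j _ => Polynomial.monic_X_sub_C _
  have hd : f.natDegree = n := by
    rw [hf, Polynomial.natDegree_finsetProd_X_sub_C_eq_card, Finset.card_univ, Fintype.card_fin]
  refine ⟨fun i => f.coeff i, fun z => ?_⟩
  have h := Polynomial.eval_eq_sum_range (p := f) z
  rw [Finset.sum_range_succ, Finset.sum_range, hm.coeff_natDegree] at h
  have h2 : f.eval z = ∏ j, (z - x j) := by simp [hf, Polynomial.eval_prod]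
  rw [← h2, h, one_mul, add_comm, evc]
  simp only [hd]
  congr 1
  exact hd ▸ rfl

lemma ev_eq_prod_of_nodes {p : ℂ} {v x : Fin n → ℂ} (hx : Function.Injective x)
    (h : ∀ j, ev p v (x j) = 0) (z : ℂ) : ev p v z = p * ∏ j, (z - x j) := by
  obtain ⟨d, hd⟩ := exists_prod_sub_eq x
  have h1 : v = p • d := by
    refine eq_of_evc_eq hx fun k => ?_
    have h2 := hd (x k)
    rw [Finset.prod_eq_zero (Finset.mem_univ k) (sub_self _)] at h2
    have h3 := h k
    have h4 : evc (p • d) (x k) = p * evc d (x k) := by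
      simp [evc, Finset.mul_sum, mul_assoc]
    rw [h4]
    change p * x k ^ n + evc v (x k) = 0 at h3
    linear_combination h3 + p * h2
  rw [hd, h1]
  simp [ev, evc, Finset.mul_sum, mul_assoc, mul_add]

lemma qcoef_last (θ : Fin (m + 1) → ℝ) (j : Fin (m + 1)) : qcoef θ j (Fin.last m) = kap θ := by
  set f : Polynomial ℂ := ∏ k ∈ Finset.univ.erase j, (Polynomial.X - Polynomial.C (zpt θ k)) with hf
  have hm : f.Monic := Polynomial.monic_prod_of_monic _ _ fun j _ => Polynomial.monic_X_sub_C _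
  have hd : f.natDegree = m := by
    rw [hf, Polynomial.natDegree_finsetProd_X_sub_C_eq_card,
      Finset.card_erase_of_mem (Finset.mem_univ j), Finset.card_univ, Fintype.card_fin]
    rfl
  have hc : f.coeff m = 1 := by
    have := hm.coeff_natDegree
    rwa [hd] at this
  rw [qcoef, Polynomial.coeff_C_mul, Fin.val_last, ← hf, hc, mul_one]

lemma psi_last (ζ : Fin (m + 1) → ℂ) :
    psi ζ (Fin.last m) = (∑ j, (ζ j).re : ℝ) * kap fun j => (ζ j).im := by
  simp only [psi, wmap, LinearMap.coe_mk, AddHom.coe_mk, qcoef_last]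
  push_cast
  rw [Finset.sum_mul]

lemma kap_sq (θ : Fin n → ℝ) : kap θ ^ 2 * ∏ j, zpt θ j = 1 := by
  rw [kap, ← Complex.exp_nat_mul]
  simp only [zpt]
  rw [← Complex.exp_sum, ← Complex.exp_add, ← Complex.exp_zero, ← Finset.sum_mul]
  congr 1
  push_cast
  ring

lemma conj_zpt (θ : Fin n → ℝ) (j : Fin n) : starRingEnd ℂ (zpt θ j) = (zpt θ j)⁻¹ :=
  (Complex.inv_eq_conj (norm_zpt θ j)).symm

lemma zpt_ne_zero (θ : Fin n → ℝ) (j : Fin n) : zpt θ j ≠ 0 := Complex.exp_ne_zero _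

lemma conj_qj_zpt (θ : Fin (m + 1) → ℝ) (j : Fin (m + 1)) :
    zpt θ j ^ m * starRingEnd ℂ (qj θ j (zpt θ j)) =
      (-1) ^ m * (zpt θ j * qj θ j (zpt θ j)) := by
  have hcard : (Finset.univ.erase j).card = m := by
    rw [Finset.card_erase_of_mem (Finset.mem_univ j), Finset.card_univ, Fintype.card_fin]; rfl
  have hk := kap_ne_zero θ
  have hkc : starRingEnd ℂ (kap θ) = (kap θ)⁻¹ := (Complex.inv_eq_conj (norm_kap θ)).symm
  have h1 : ∀ k, starRingEnd ℂ (zpt θ j - zpt θ k) =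
      -1 * ((zpt θ j)⁻¹ * (zpt θ k)⁻¹ * (zpt θ j - zpt θ k)) := by
    intro k
    rw [map_sub, conj_zpt, conj_zpt]
    have := zpt_ne_zero θ j; have := zpt_ne_zero θ k
    field_simp
    ring
  have h2 := kap_sq θ
  rw [← Finset.mul_prod_erase _ _ (Finset.mem_univ j)] at h2
  rw [qj, map_mul, map_prod, Finset.prod_congr rfl fun k _ => h1 k, Finset.prod_mul_distrib,
    Finset.prod_mul_distrib, Finset.prod_mul_distrib, Finset.prod_const, Finset.prod_const, hcard,
    Finset.prod_inv_distrib, hkc, inv_pow]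
  have hP : ∏ k ∈ Finset.univ.erase j, zpt θ k ≠ 0 :=
    Finset.prod_ne_zero_iff.2 fun k _ => zpt_ne_zero θ k
  have hz := zpt_ne_zero θ j
  field_simp
  linear_combination (-∏ k ∈ Finset.univ.erase j, (zpt θ j - zpt θ k)) * h2

/-- The paraorthogonal polynomial of `psi ζ` vanishes exactly at the points of `ζ`. -/
lemma mul_ev_add_evs_psi (ζ : Fin (m + 1) → ℂ)
    (hz : Function.Injective (zpt fun j => (ζ j).im)) (z : ℂ) :
    z * ev (psi ζ (Fin.last m)) (Fin.init (psi ζ)) z +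
      (-1) ^ (m + 1) * evs (psi ζ (Fin.last m)) (Fin.init (psi ζ)) z =
      psi ζ (Fin.last m) * ∏ j, (z - zpt (fun j => (ζ j).im) j) := by
  have hc : starRingEnd ℂ ((-1 : ℂ) ^ m) = (-1) ^ m := by simp
  have h := ev_szego (p := psi ζ (Fin.last m)) ((-1) ^ m) (Fin.init (psi ζ))
  rw [hc] at h
  have h1 : ∀ z, z * ev (psi ζ (Fin.last m)) (Fin.init (psi ζ)) z +
      (-1) ^ (m + 1) * evs (psi ζ (Fin.last m)) (Fin.init (psi ζ)) z =
      ev (psi ζ (Fin.last m)) (szego (psi ζ (Fin.last m)) ((-1) ^ m) (Fin.init (psi ζ))) z := by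
    intro z; rw [h]; ring
  rw [h1]
  refine ev_eq_prod_of_nodes hz (fun j => ?_) z
  rw [h, evs_eq_of_norm_eq_one _ (norm_zpt _ j), ← evc_eq_ev, psi, evc_wmap_zpt, map_mul,
    Complex.conj_ofReal]
  have hq := conj_qj_zpt (fun j => (ζ j).im) j
  have hs : ((-1 : ℂ) ^ m) * (-1) ^ m = 1 := by rw [← mul_pow]; simp
  linear_combination (-((-1 : ℂ) ^ m) * (ζ j).re) * hq -
    ((ζ j).re : ℂ) * (zpt (fun j => (ζ j).im) j * qj (fun j => (ζ j).im) j (zpt (fun j => (ζ j).im) j)) * hs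

end bijection

section bijection

variable {m n : ℕ}

lemma sum_re_pos {ζ : Fin (m + 1) → ℂ} (h : ζ ∈ dom (m + 1)) : 0 < ∑ j, (ζ j).re :=
  Finset.sum_pos (fun j _ => (h.2 j).2) ⟨0, Finset.mem_univ _⟩

lemma norm_psi_last {ζ : Fin (m + 1) → ℂ} (h : ζ ∈ dom (m + 1)) :
    ‖psi ζ (Fin.last m)‖ = ∑ j, (ζ j).re := by
  rw [psi_last, norm_mul, norm_kap, mul_one, Complex.norm_real, Real.norm_of_nonneg (sum_re_pos h).le]

lemma re_div_sub_pos {z u : ℂ} (hz : 1 ≤ ‖z‖) (hu : ‖u‖ = 1) (h : z ≠ u) : 0 < (z / (z - u)).re := by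
  have h0 : 0 < Complex.normSq (z - u) := Complex.normSq_pos.2 (sub_ne_zero.2 h)
  have hu2 : Complex.normSq u = 1 := by rw [Complex.normSq_eq_norm_sq, hu, one_pow]
  have hz2 : 1 ≤ Complex.normSq z := by rw [Complex.normSq_eq_norm_sq]; nlinarith
  rw [Complex.div_re, ← add_div]
  refine div_pos ?_ h0
  rw [Complex.normSq_apply] at h0 hu2 hz2
  simp only [Complex.sub_re, Complex.sub_im] at h0 ⊢
  nlinarith

lemma isGood_psi {ζ : Fin (m + 1) → ℂ} (h : ζ ∈ dom (m + 1)) :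
    IsGood (psi ζ (Fin.last m)) (Fin.init (psi ζ)) := by
  have hs := sum_re_pos h
  refine ⟨norm_ne_zero_iff.1 (by rw [norm_psi_last h]; exact hs.ne'), fun z hz => ?_⟩
  rw [← evc_eq_ev]
  set θ : Fin (m + 1) → ℝ := fun j => (ζ j).im with hθ
  have hinj : Function.Injective (zpt θ) := injective_zpt_of_mem_dom h
  by_cases hzj : ∃ j, z = zpt θ j
  · obtain ⟨j, rfl⟩ := hzj
    rw [psi, evc_wmap_zpt]
    refine mul_ne_zero (by exact_mod_cast (h.2 j).2.ne') (mul_ne_zero (kap_ne_zero _) ?_)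
    exact Finset.prod_ne_zero_iff.2 fun k hk =>
      sub_ne_zero.2 fun e => Finset.ne_of_mem_erase hk (hinj e).symm
  · push Not at hzj
    have hzj' : ∀ j, z - zpt θ j ≠ 0 := fun j => sub_ne_zero.2 (hzj j)
    have h1 : z * evc (psi ζ) z = (kap θ * ∏ k, (z - zpt θ k)) *
        ∑ j, ((ζ j).re : ℂ) * (z / (z - zpt θ j)) := by
      rw [evc_psi, Finset.mul_sum, Finset.mul_sum]
      refine Finset.sum_congr rfl fun j _ => ?_
      rw [qj_eq_div _ _ (hzj' j)]
      ring
    have h2 : 0 < (∑ j, ((ζ j).re : ℂ) * (z / (z - zpt θ j))).re := by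
      rw [Complex.re_sum]
      refine Finset.sum_pos (fun j _ => ?_) ⟨0, Finset.mem_univ _⟩
      rw [Complex.re_ofReal_mul]
      exact mul_pos (h.2 j).2 (re_div_sub_pos hz (norm_zpt θ j) (hzj j))
    have h3 : z * evc (psi ζ) z ≠ 0 := by
      rw [h1]
      refine mul_ne_zero (mul_ne_zero (kap_ne_zero _)
        (Finset.prod_ne_zero_iff.2 fun k _ => hzj' k)) ?_
      intro h0
      rw [h0] at h2
      simp at h2
    exact right_ne_zero_of_mul h3

lemma prod_re_mul_vdm_sq {ζ : Fin (m + 1) → ℂ} (h : ζ ∈ dom (m + 1)) :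
    (∏ j, (ζ j).re) * vdm (fun j => (ζ j).im) ^ 2 =
      (∑ j, (ζ j).re) ^ (m + 1) * rho (psi ζ (Fin.last m)) m (Fin.init (psi ζ)) := by
  set θ : Fin (m + 1) → ℝ := fun j => (ζ j).im with hθ
  set s := ∑ j, (ζ j).re with hs
  set p := psi ζ (Fin.last m) with hp
  set v := Fin.init (psi ζ) with hv
  have hs0 : 0 < s := sum_re_pos h
  have hg : IsGood p v := isGood_psi h
  have hps : ‖p‖ = s := norm_psi_last h
  have hinj : Function.Injective (zpt θ) := injective_zpt_of_mem_dom h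
  obtain ⟨a, ha, -⟩ := hg.exists_roots
  have hρ := hg.prod_norm_evs ha
  have h1 : ∀ j, ‖ev p v (zpt θ j)‖ = (ζ j).re * ‖qj θ j (zpt θ j)‖ := by
    intro j
    rw [hp, hv, ← evc_eq_ev, psi, evc_wmap_zpt, norm_mul, Complex.norm_real,
      Real.norm_of_nonneg (h.2 j).2.le]
  have h2 : ∏ j, ‖ev p v (zpt θ j)‖ = (∏ j, (ζ j).re) * vdm θ ^ 2 := by
    simp only [h1, Finset.prod_mul_distrib, norm_qj_zpt, prod_norm_sub_eq_vdm_sq]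
  have h3 : ∀ l, ‖evs p v (a l)‖ = s * ∏ j, ‖zpt θ j - a l‖ := by
    intro l
    have e := mul_ev_add_evs_psi ζ hinj (a l)
    have e0 : ev p v (a l) = 0 := by
      rw [ha, Finset.prod_eq_zero (Finset.mem_univ l) (sub_self _), mul_zero]
    rw [← hp, ← hv, e0, mul_zero, zero_add] at e
    have e1 := congrArg norm e
    rw [norm_mul, norm_mul, norm_pow, norm_neg, norm_one, one_pow, one_mul, norm_prod, hps] at e1
    rw [e1]
    simp only [norm_sub_rev (a l)]
    rfl
  have h4 : ∏ j, ‖ev p v (zpt θ j)‖ = s ^ (m + 1) * ∏ l, ∏ j, ‖zpt θ j - a l‖ := by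
    rw [Finset.prod_comm]
    simp only [ha, norm_mul, hps, norm_prod, Finset.prod_mul_distrib, Finset.prod_const,
      Finset.card_univ, Fintype.card_fin]
  have h5 : s ^ m * ∏ l, ∏ j, ‖zpt θ j - a l‖ = s ^ m * rho p m v := by
    rw [← hps, ← hρ, hps]
    simp only [h3, Finset.prod_mul_distrib, Finset.prod_const, Finset.card_univ, Fintype.card_fin]
  rw [← h2, h4, mul_left_cancel₀ (pow_ne_zero m hs0.ne') h5]

lemma psi_eq_smul_psi {ζ ζ' : Fin (m + 1) → ℂ} (h : ζ ∈ dom (m + 1)) (h' : ζ' ∈ dom (m + 1))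
    {σ : ℂ} (hσ : σ = 1 ∨ σ = -1) (e : psi ζ = σ • psi ζ') : σ = 1 ∧ ζ = ζ' := by
  set θ : Fin (m + 1) → ℝ := fun j => (ζ j).im with hθ
  set θ' : Fin (m + 1) → ℝ := fun j => (ζ' j).im with hθ'
  have hinj : Function.Injective (zpt θ) := injective_zpt_of_mem_dom h
  have hinj' : Function.Injective (zpt θ') := injective_zpt_of_mem_dom h'
  have hs := sum_re_pos h
  have hs' := sum_re_pos h'
  have hσ0 : ‖σ‖ = 1 := by rcases hσ with rfl | rfl <;> simp
  have hl : psi ζ (Fin.last m) = σ * psi ζ' (Fin.last m) := by rw [e]; rfl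
  have hss : ∑ j, (ζ j).re = ∑ j, (ζ' j).re := by
    rw [← norm_psi_last h, ← norm_psi_last h', hl, norm_mul, hσ0, one_mul]
  have hp0 : psi ζ (Fin.last m) ≠ 0 := (isGood_psi h).1
  have hp0' : psi ζ' (Fin.last m) ≠ 0 := (isGood_psi h').1
  have hprod : ∀ z, ∏ j, (z - zpt θ j) = ∏ j, (z - zpt θ' j) := by
    intro z
    have e1 := mul_ev_add_evs_psi ζ hinj z
    have e2 := mul_ev_add_evs_psi ζ' hinj' z
    have e3 : z * ev (psi ζ (Fin.last m)) (Fin.init (psi ζ)) z +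
        (-1) ^ (m + 1) * evs (psi ζ (Fin.last m)) (Fin.init (psi ζ)) z = σ *
        (z * ev (psi ζ' (Fin.last m)) (Fin.init (psi ζ')) z +
        (-1) ^ (m + 1) * evs (psi ζ' (Fin.last m)) (Fin.init (psi ζ')) z) := by
      rcases hσ with rfl | rfl
      · rw [one_smul] at e; rw [e, one_mul]
      · have e' : psi ζ = - psi ζ' := by rw [e, neg_smul, one_smul]
        have e'' : Fin.init (psi ζ) = - Fin.init (psi ζ') := by rw [e']; rfl
        have e3 : psi ζ (Fin.last m) = - psi ζ' (Fin.last m) := by rw [e']; rfl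
        rw [e'', e3, ev_neg, evs_neg]
        ring
    rw [e1, e2, ← mul_assoc, ← hl] at e3
    exact mul_left_cancel₀ hp0 e3
  have hsub : ∀ (φ φ' : Fin (m + 1) → ℝ), (∀ j, φ j ∈ Set.Ioo 0 (2 * Real.pi)) →
      (∀ j, φ' j ∈ Set.Ioo 0 (2 * Real.pi)) →
      (∀ z, ∏ j, (z - zpt φ j) = ∏ j, (z - zpt φ' j)) → Set.range φ ⊆ Set.range φ' := by
    rintro φ φ' hφ hφ' hh _ ⟨j, rfl⟩
    have e1 := hh (zpt φ j)
    rw [Finset.prod_eq_zero (Finset.mem_univ j) (sub_self _)] at e1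
    obtain ⟨k, -, hk⟩ := Finset.prod_eq_zero_iff.1 e1.symm
    exact ⟨k, (exp_ofReal_injOn (hφ j) (hφ' k) (sub_eq_zero.1 hk)).symm⟩
  have hr : θ = θ' := (StrictMono.range_inj h.1 h'.1).1 (Set.Subset.antisymm
    (hsub θ θ' (fun j => (h.2 j).1) (fun j => (h'.2 j).1) hprod)
    (hsub θ' θ (fun j => (h'.2 j).1) (fun j => (h.2 j).1) fun z => (hprod z).symm))
  have hσ1 : σ = 1 := by
    rw [psi_last, psi_last, hss] at hl
    change _ * kap θ = σ * (_ * kap θ') at hl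
    rw [hr] at hl
    have : ((∑ j, (ζ' j).re : ℝ) : ℂ) * kap θ' ≠ 0 :=
      mul_ne_zero (by exact_mod_cast hs'.ne') (kap_ne_zero _)
    exact (mul_right_cancel₀ this (by rw [one_mul]; exact hl)).symm
  refine ⟨hσ1, funext fun j => Complex.ext ?_ (congrFun hr j)⟩
  rw [hσ1, one_smul] at e
  have e1 := congrArg (fun c => evc c (zpt θ j)) e
  have e2 : evc (psi ζ) (zpt θ j) = ((ζ j).re : ℂ) * qj θ j (zpt θ j) := evc_wmap_zpt _ _ _
  have e3 : evc (psi ζ') (zpt θ' j) = ((ζ' j).re : ℂ) * qj θ' j (zpt θ' j) := evc_wmap_zpt _ _ _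
  rw [← hr] at e3
  rw [e2, e3] at e1
  have hq : qj θ j (zpt θ j) ≠ 0 := mul_ne_zero (kap_ne_zero _) (Finset.prod_ne_zero_iff.2
    fun k hk => sub_ne_zero.2 fun e => Finset.ne_of_mem_erase hk (hinj e).symm)
  exact_mod_cast mul_right_cancel₀ hq e1

end bijection

section surjection

variable {m : ℕ} {p : ℂ}

lemma hasDerivAt_prod_of_ne_zero {n : ℕ} {f : Fin n → ℂ → ℂ} {f' : Fin n → ℂ} {u : ℂ}
    (hf : ∀ l, HasDerivAt (f l) (f' l) u) (h0 : ∀ l, f l u ≠ 0) :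
    HasDerivAt (fun z => ∏ l, f l z) ((∏ l, f l u) * ∑ l, f' l / f l u) u := by
  have := HasDerivAt.fun_finsetProd (u := Finset.univ) (f := f) (f' := f') (x := u) fun k _ => hf k
  convert! this using 1
  rw [Finset.mul_sum]
  refine Finset.sum_congr rfl fun l _ => ?_
  rw [smul_eq_mul, ← Finset.mul_prod_erase _ _ (Finset.mem_univ l)]
  have := h0 l
  field_simp

/-- At its zeros, the derivative of the paraorthogonal polynomial is a positive multiple of the
orthogonal polynomial. -/
lemma IsGood.exists_hasDerivAt {v : Fin m → ℂ} (h : IsGood p v) {ε u : ℂ} (hu : ‖u‖ = 1)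
    (h0 : u * ev p v u + ε * evs p v u = 0) :
    ∃ δ : ℝ, 0 < δ ∧
      HasDerivAt (fun z => z * ev p v z + ε * evs p v z) (δ * ev p v u) u := by
  obtain ⟨a, ha, ha1⟩ := h.exists_roots
  have hu0 : u ≠ 0 := by rintro rfl; simp at hu
  have hne : ∀ l, u - a l ≠ 0 := fun l e => by
    have := ha1 l
    rw [← sub_eq_zero.1 e, hu] at this
    exact lt_irrefl _ this
  have hconj : ∀ l, 1 - starRingEnd ℂ (a l) * u = u * starRingEnd ℂ (u - a l) := fun l => by
    rw [map_sub, mul_sub, Complex.mul_conj', hu]; push_cast; ring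
  have hne' : ∀ l, 1 - starRingEnd ℂ (a l) * u ≠ 0 := fun l => by
    rw [hconj]
    exact mul_ne_zero hu0 ((map_ne_zero _).2 (hne l))
  have d1 : HasDerivAt (ev p v) (ev p v u * ∑ l, 1 / (u - a l)) u := by
    have := (hasDerivAt_prod_of_ne_zero (f := fun l z => z - a l) (f' := fun _ => 1)
      (fun l => (hasDerivAt_id u).sub_const (a l)) hne).const_mul p
    rw [← mul_assoc, ← ha] at this
    exact this.congr_of_eventuallyEq (Eventually.of_forall ha)
  have d2 : HasDerivAt (evs p v)
      (evs p v u * ∑ l, (-starRingEnd ℂ (a l)) / (1 - starRingEnd ℂ (a l) * u)) u := by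
    have := (hasDerivAt_prod_of_ne_zero (f := fun l z => 1 - starRingEnd ℂ (a l) * z)
      (f' := fun l => -starRingEnd ℂ (a l))
      (fun l => by simpa using ((hasDerivAt_id u).const_mul (starRingEnd ℂ (a l))).const_sub 1)
      hne').const_mul (starRingEnd ℂ p)
    rw [← mul_assoc, ← evs_eq_prod ha] at this
    exact this.congr_of_eventuallyEq (Eventually.of_forall (evs_eq_prod ha))
  have d3 := ((hasDerivAt_id u).fun_mul d1).fun_add (d2.const_mul ε)
  have hterm : ∀ l, u * (1 / (u - a l)) -
      u * ((-starRingEnd ℂ (a l)) / (1 - starRingEnd ℂ (a l) * u)) =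
      (((1 - ‖a l‖ ^ 2) / ‖u - a l‖ ^ 2 : ℝ) : ℂ) := by
    intro l
    have e1 : ((‖u - a l‖ : ℂ)) ^ 2 = (u - a l) * starRingEnd ℂ (u - a l) := by
      rw [Complex.mul_conj']
    have e2 : ((‖a l‖ : ℂ)) ^ 2 = a l * starRingEnd ℂ (a l) := by rw [Complex.mul_conj']
    have e3 : starRingEnd ℂ (u - a l) ≠ 0 := (map_ne_zero _).2 (hne l)
    have e4 : u * starRingEnd ℂ u = 1 := by rw [Complex.mul_conj', hu]; simp
    rw [hconj]
    push_cast
    rw [e1, e2]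
    have := hne l
    field_simp
    rw [map_sub]
    linear_combination e4
  refine ⟨1 + ∑ l, (1 - ‖a l‖ ^ 2) / ‖u - a l‖ ^ 2, ?_, ?_⟩
  · have : 0 ≤ ∑ l, (1 - ‖a l‖ ^ 2) / ‖u - a l‖ ^ 2 := Finset.sum_nonneg fun l _ =>
      div_nonneg (by have := ha1 l; nlinarith [norm_nonneg (a l)]) (by positivity)
    linarith
  · convert! d3 using 1
    rw [Complex.ofReal_add, Complex.ofReal_sum, ← Finset.sum_congr rfl fun l _ => hterm l,
      Finset.sum_sub_distrib, ← Finset.mul_sum, ← Finset.mul_sum]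
    simp only [id]
    push_cast
    linear_combination (-∑ l, (-starRingEnd ℂ (a l)) / (1 - starRingEnd ℂ (a l) * u)) * h0

lemma IsGood.norm_eq_one_of_root {v : Fin m → ℂ} (h : IsGood p v) {ε u : ℂ} (hε : ‖ε‖ = 1)
    (h0 : u * ev p v u + ε * evs p v u = 0) : ‖u‖ = 1 := by
  have e : ‖u‖ * ‖ev p v u‖ = ‖evs p v u‖ := by
    rw [← norm_mul, eq_neg_of_add_eq_zero_left h0, norm_neg, norm_mul, hε, one_mul]
  rcases lt_trichotomy ‖u‖ 1 with hu | hu | hu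
  · have h1 := h.norm_ev_le hu.le
    have h2 : 0 < ‖evs p v u‖ := norm_pos_iff.2 (h.evs_ne_zero hu.le)
    nlinarith [norm_nonneg u, norm_nonneg (ev p v u)]
  · exact hu
  · have h1 := h.norm_evs_le hu.le
    have h2 : 0 < ‖ev p v u‖ := norm_pos_iff.2 (h.2 u hu.le)
    nlinarith [norm_nonneg u, norm_nonneg (ev p v u)]

lemma hasDerivAt_prod_sub {n : ℕ} (c : ℂ) (u : Fin n → ℂ) (j : Fin n) :
    HasDerivAt (fun z => c * ∏ k, (z - u k)) (c * ∏ k ∈ Finset.univ.erase j, (u j - u k)) (u j) := by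
  have h1 : HasDerivAt (fun z => (z - u j) * ∏ k ∈ Finset.univ.erase j, (z - u k))
      (1 * ∏ k ∈ Finset.univ.erase j, (u j - u k) +
        (u j - u j) * deriv (fun z => ∏ k ∈ Finset.univ.erase j, (z - u k)) (u j)) (u j) := by
    refine HasDerivAt.fun_mul ((hasDerivAt_id _).sub_const _) ?_
    refine DifferentiableAt.hasDerivAt ?_
    fun_prop
  have h2 := h1.const_mul c
  have h3 : ∀ z, (z - u j) * ∏ k ∈ Finset.univ.erase j, (z - u k) = ∏ k, (z - u k) := fun z =>
    Finset.mul_prod_erase _ (fun k => z - u k) (Finset.mem_univ j)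
  simp only [h3] at h2
  simpa using h2

lemma exists_exp_eq {u : ℂ} (hu : ‖u‖ = 1) (h1 : u ≠ 1) :
    ∃ x ∈ Set.Ioo 0 (2 * Real.pi), Complex.exp ((x : ℝ) * Complex.I) = u := by
  have hpi := Real.pi_pos
  have e : Complex.exp (Complex.arg u * Complex.I) = u := by
    have := Complex.norm_mul_exp_arg_mul_I u
    rwa [hu, Complex.ofReal_one, one_mul] at this
  have hle := Complex.arg_le_pi u
  have hlt := Complex.neg_pi_lt_arg u
  rcases lt_trichotomy u.arg 0 with h | h | h
  · refine ⟨u.arg + 2 * Real.pi, ⟨by linarith, by linarith⟩, ?_⟩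
    push_cast
    rw [add_mul, Complex.exp_add, Complex.exp_two_pi_mul_I, mul_one, e]
  · rw [h] at e
    simp at e
    exact absurd e.symm h1
  · exact ⟨u.arg, ⟨h, by linarith⟩, e⟩

lemma exists_psi_eq {c : Fin (m + 1) → ℂ} (h : IsGood (c (Fin.last m)) (Fin.init c))
    (h1 : ev (c (Fin.last m)) (Fin.init c) 1 +
      (-1) ^ (m + 1) * evs (c (Fin.last m)) (Fin.init c) 1 ≠ 0) :
    ∃ ζ ∈ dom (m + 1), psi ζ = c ∨ psi ζ = -c := by
  set p := c (Fin.last m) with hp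
  set v := Fin.init c with hv
  set Q : ℂ → ℂ := fun z => z * ev p v z + (-1) ^ (m + 1) * evs p v z with hQ
  have hε : ‖(-1 : ℂ) ^ (m + 1)‖ = 1 := by simp
  obtain ⟨u₀, hu₀⟩ : ∃ u : Fin (m + 1) → ℂ, ∀ z, Q z = p * ∏ j, (z - u j) := by
    obtain ⟨u, hu⟩ := ev_exists_roots h.1 (szego p ((-1) ^ m) v)
    refine ⟨u, fun z => ?_⟩
    rw [← hu, ev_szego, hQ]
    simp only [map_pow, map_neg, map_one]
    ring
  have hroot₀ : ∀ j, Q (u₀ j) = 0 := fun j => by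
    rw [hu₀, Finset.prod_eq_zero (Finset.mem_univ j) (sub_self _), mul_zero]
  have hu1₀ : ∀ j, u₀ j ≠ 1 := fun j e => by
    have := hroot₀ j
    rw [e, hQ] at this
    simp only [one_mul] at this
    exact h1 this
  choose θ₀ hθ₀ hθu₀ using fun j =>
    exists_exp_eq (h.norm_eq_one_of_root hε (hroot₀ j)) (hu1₀ j)
  set θ : Fin (m + 1) → ℝ := fun j => θ₀ (Tuple.sort θ₀ j) with hθ
  have hmono : Monotone θ := Tuple.monotone_sort θ₀
  have hθm : ∀ j, θ j ∈ Set.Ioo 0 (2 * Real.pi) := fun j => hθ₀ _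
  have hprod : ∀ z, Q z = p * ∏ j, (z - zpt θ j) := fun z => by
    rw [hu₀]
    congr 1
    rw [← Equiv.prod_comp (Tuple.sort θ₀)]
    refine Finset.prod_congr rfl fun j _ => ?_
    rw [zpt, hθu₀]
  have hroot : ∀ j, Q (zpt θ j) = 0 := fun j => by
    rw [hprod, Finset.prod_eq_zero (Finset.mem_univ j) (sub_self _), mul_zero]
  choose δ hδ hδd using fun j => h.exists_hasDerivAt (norm_zpt θ j) (hroot j)
  have hder : ∀ j, (δ j : ℂ) * ev p v (zpt θ j) =
      p * ∏ k ∈ Finset.univ.erase j, (zpt θ j - zpt θ k) := fun j => by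
    have e1 := hasDerivAt_prod_sub p (zpt θ) j
    rw [← show Q = fun z => p * ∏ j, (z - zpt θ j) from funext hprod] at e1
    exact (hδd j).unique e1
  have hP0 : ∀ j, ev p v (zpt θ j) ≠ 0 := fun j => h.2 _ (norm_zpt θ j).ge
  have hinj : Function.Injective (zpt θ) := by
    intro j k e
    by_contra hjk
    have h2 := hder j
    rw [Finset.prod_eq_zero (Finset.mem_erase.2 ⟨Ne.symm hjk, Finset.mem_univ k⟩)
      (sub_eq_zero.2 e), mul_zero] at h2
    exact mul_ne_zero (by exact_mod_cast (hδ j).ne') (hP0 j) h2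
  have hθinj : Function.Injective θ := fun j k e => hinj (by rw [zpt, zpt, e])
  have hsm : StrictMono θ := hmono.strictMono_of_injective hθinj
  have hk0 := kap_ne_zero θ
  obtain ⟨r, hr⟩ : ∃ r : ℝ, p = r * kap θ := by
    have e1 := hprod 0
    have e2 : Q 0 = (-1) ^ (m + 1) * starRingEnd ℂ p := by
      simp only [hQ, zero_mul, zero_add, evs_zero]
    have e3 : ∏ j, (0 - zpt θ j) = (-1) ^ (m + 1) * ∏ j, zpt θ j := by
      rw [show (∏ j, (0 - zpt θ j)) = ∏ j, (-1) * zpt θ j from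
        Finset.prod_congr rfl fun j _ => by ring, Finset.prod_mul_distrib, Finset.prod_const,
        Finset.card_univ, Fintype.card_fin]
    rw [e2, e3] at e1
    have e4 : starRingEnd ℂ p = p * ∏ j, zpt θ j := by
      refine mul_left_cancel₀ (pow_ne_zero (m + 1) (neg_ne_zero.2 (one_ne_zero (α := ℂ)))) ?_
      rw [e1]; ring
    have e5 : starRingEnd ℂ (p / kap θ) = p / kap θ := by
      rw [map_div₀, ← Complex.inv_eq_conj (norm_kap θ), e4]
      have := kap_sq θ
      field_simp
      linear_combination p * this
    obtain ⟨r, hr⟩ := Complex.conj_eq_iff_real.1 e5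
    exact ⟨r, by rw [← hr]; field_simp⟩
  have hr0 : r ≠ 0 := fun e => h.1 (by rw [hr, e]; simp)
  set ζ : Fin (m + 1) → ℂ := fun j => ⟨|r| / δ j, θ j⟩ with hζ
  have hζd : ζ ∈ dom (m + 1) := ⟨hsm, fun j => ⟨hθm j, div_pos (abs_pos.2 hr0) (hδ j)⟩⟩
  have hval : ∀ j, (r : ℂ) * evc (psi ζ) (zpt θ j) = |r| * evc c (zpt θ j) := fun j => by
    have e1 : evc (psi ζ) (zpt θ j) = ((|r| / δ j : ℝ) : ℂ) * qj θ j (zpt θ j) :=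
      evc_wmap_zpt _ _ _
    have e2 := hder j
    rw [evc_eq_ev c, ← hp, ← hv, e1, qj]
    have := hδ j
    have hδ0 : (δ j : ℂ) ≠ 0 := by exact_mod_cast this.ne'
    push_cast
    field_simp
    have e3 : (r : ℂ) * kap θ * ∏ k ∈ Finset.univ.erase j, (zpt θ j - zpt θ k) =
      δ j * ev p v (zpt θ j) := by rw [← hr, e2]
    linear_combination ((|r| : ℝ) : ℂ) * e3
  refine ⟨ζ, hζd, ?_⟩
  have hrc : (r : ℂ) ≠ 0 := by exact_mod_cast hr0
  rcases abs_choice r with ha | ha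
  · left
    refine eq_of_evc_eq hinj fun j => mul_left_cancel₀ hrc ?_
    rw [hval, ha]
  · right
    refine eq_of_evc_eq hinj fun j => mul_left_cancel₀ hrc ?_
    rw [hval, ha]
    simp [evc]

end surjection

section total

variable {m : ℕ}

/-- The radial density of the leading coefficient. -/
def radial (β : ℝ) (m : ℕ) (p : ℂ) : ℝ :=
  2 ^ (m + 1) * (‖p‖ ^ ((m + 1 : ℕ) * (β / 2 - 2)) * Real.exp (-‖p‖))

lemma radial_nonneg (β : ℝ) (m : ℕ) (p : ℂ) : 0 ≤ radial β m p := by unfold radial; positivity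

@[fun_prop]
lemma measurable_radial (β : ℝ) (m : ℕ) : Measurable (radial β m) := by unfold radial; fun_prop

/-- The density on coefficient vectors, weighted by a function of the phase. -/
def coefDensity (β t : ℝ) (m : ℕ) (g : ℝ → ENNReal) (p : ℂ) (v : Fin m → ℂ) : ENNReal :=
  ENNReal.ofReal (radial β m p) * (ENNReal.ofReal (wt β p m v) * g (phs p t m v))

lemma coefDensity_neg (β t : ℝ) (g : ℝ → ENNReal) (p : ℂ) (v : Fin m → ℂ) :
    coefDensity β t m g (-p) (-v) = coefDensity β t m g p v := by
  simp only [coefDensity, wt_neg, phs_neg, radial, norm_neg]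

/-- The total mass of the coefficient density. -/
def coefConst (β : ℝ) (m : ℕ) : ℝ :=
  2 ^ (m + 1) * (∏ k ∈ Finset.range m, (Real.pi / ((k + 1 : ℕ) * (β / 2)))) *
    (2 * Real.pi * Real.Gamma ((m + 1 : ℕ) * (β / 2)))

lemma integral_radial_mul_wtConst {β : ℝ} (hβ : 0 < β) (m : ℕ) :
    ∫⁻ p, ENNReal.ofReal (radial β m p) * ENNReal.ofReal (wtConst β p m) =
      ENNReal.ofReal (coefConst β m) := by
  set A : ℝ := 2 ^ (m + 1) * ∏ k ∈ Finset.range m, (Real.pi / ((k + 1 : ℕ) * (β / 2))) with hA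
  set q : ℝ := (m + 1 : ℕ) * (β / 2) - 2 with hq
  have hq2 : -2 < q := by
    have : 0 < ((m + 1 : ℕ) : ℝ) * (β / 2) := by positivity
    linarith
  have hA0 : 0 ≤ A := by positivity
  have hI := Complex.integral_rpow_mul_exp_neg_rpow le_rfl hq2
  simp only [Real.rpow_one, div_one] at hI
  have hG : 0 < Real.Gamma (q + 2) := Real.Gamma_pos_of_pos (by linarith)
  have hint : Integrable fun x : ℂ => ‖x‖ ^ q * Real.exp (-‖x‖) := by
    by_contra h
    rw [integral_undef h] at hI
    have := Real.pi_pos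
    have : 0 < 2 * Real.pi * Real.Gamma (q + 2) := by positivity
    linarith
  have h1 : ∀ p : ℂ, p ≠ 0 → ENNReal.ofReal (radial β m p) * ENNReal.ofReal (wtConst β p m) =
      ENNReal.ofReal (A * (‖p‖ ^ q * Real.exp (-‖p‖))) := by
    intro p hp
    have hp0 : 0 < ‖p‖ := norm_pos_iff.2 hp
    rw [← ENNReal.ofReal_mul (radial_nonneg _ _ _), wtConst, radial, Finset.prod_mul_distrib,
      Finset.prod_const, Finset.card_range, ← pow_mul]
    have e : ‖p‖ ^ q = ‖p‖ ^ (((m + 1 : ℕ) : ℝ) * (β / 2 - 2)) * ‖p‖ ^ (2 * m) := by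
      rw [← Real.rpow_natCast ‖p‖ (2 * m), ← Real.rpow_add hp0]
      congr 1
      rw [hq]; push_cast; ring
    rw [e, hA]
    congr 1
    ring
  rw [lintegral_congr_ae (g := fun p : ℂ => ENNReal.ofReal (A * (‖p‖ ^ q * Real.exp (-‖p‖)))),
    ← ofReal_integral_eq_lintegral_ofReal (hint.const_mul A)
      (Eventually.of_forall fun x => by positivity), integral_const_mul, hI, coefConst, ← hA, hq,
      sub_add_cancel]
  have h0 : ∀ᵐ p : ℂ, p ≠ 0 := by simp [ae_iff]
  filter_upwards [h0] with p hp using h1 p hp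

lemma lintegral_fin_snoc {F : ℂ → (Fin m → ℂ) → ENNReal} (hF : Measurable (Function.uncurry F)) :
    ∫⁻ c : Fin (m + 1) → ℂ, F (c (Fin.last m)) (Fin.init c) = ∫⁻ p, ∫⁻ v, F p v := by
  have h := volume_preserving_piFinSuccAbove (fun _ : Fin (m + 1) => ℂ) (Fin.last m)
  have h2 := h.lintegral_comp hF
  rw [Measure.volume_eq_prod, lintegral_prod _ hF.aemeasurable] at h2
  simp only [Function.uncurry] at h2
  rw [← h2]
  refine lintegral_congr fun c => ?_
  simp only [MeasurableEquiv.piFinSuccAbove_apply, Fin.insertNthEquiv_symm_apply]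
  congr 1
  ext i
  simp [Fin.init, Fin.removeNth]

lemma measurable_coefDensity (β t : ℝ) {g : ℝ → ENNReal} (hg : Measurable g) :
    Measurable (Function.uncurry (coefDensity β t m g)) := by
  have h1 : Measurable fun x : ℂ × (Fin m → ℂ) => wt β x.1 m x.2 :=
    measurable_wt β measurable_fst measurable_snd
  have h2 : Measurable fun x : ℂ × (Fin m → ℂ) => phs x.1 t m x.2 :=
    measurable_phs t measurable_fst measurable_snd
  unfold Function.uncurry coefDensity
  exact (((measurable_radial β m).comp measurable_fst).ennreal_ofReal).mul
    (h1.ennreal_ofReal.mul (hg.comp h2))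

lemma measurable_init : Measurable fun c : Fin (m + 1) → ℂ => (Fin.init c : Fin m → ℂ) :=
  measurable_pi_iff.2 fun _ => measurable_pi_apply _

lemma measurable_coefDensity_comp (β t : ℝ) {g : ℝ → ENNReal} (hg : Measurable g) :
    Measurable fun c : Fin (m + 1) → ℂ => coefDensity β t m g (c (Fin.last m)) (Fin.init c) := by
  have h0 : Measurable fun c : Fin (m + 1) → ℂ => c (Fin.last m) := measurable_pi_apply _
  have h1 : Measurable fun c : Fin (m + 1) → ℂ => wt β (c (Fin.last m)) m (Fin.init c) :=
    measurable_wt β h0 measurable_init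
  have h2 : Measurable fun c : Fin (m + 1) → ℂ => phs (c (Fin.last m)) t m (Fin.init c) :=
    measurable_phs t h0 measurable_init
  unfold coefDensity
  exact (((measurable_radial β m).comp h0).ennreal_ofReal).mul
    (h1.ennreal_ofReal.mul (hg.comp h2))

lemma lintegral_coefDensity {β : ℝ} (hβ : 0 < β) (t : ℝ) {g : ℝ → ENNReal} (hg : Measurable g) :
    ∫⁻ c : Fin (m + 1) → ℂ, coefDensity β t m g (c (Fin.last m)) (Fin.init c) =
      ENNReal.ofReal (coefConst β m) * ∫⁻ x, g x ∂(phaseLaw β t m) := by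
  rw [lintegral_fin_snoc (measurable_coefDensity β t hg), ← integral_radial_mul_wtConst hβ,
    ← lintegral_mul_const]
  · refine lintegral_congr_ae ?_
    have h0 : ∀ᵐ p : ℂ, p ≠ 0 := by simp [ae_iff]
    filter_upwards [h0] with p hp
    unfold coefDensity
    have hm : Measurable fun v : Fin m → ℂ => ENNReal.ofReal (wt β p m v) * g (phs p t m v) :=
      (measurable_wt β measurable_const measurable_id).ennreal_ofReal.mul
        (hg.comp (measurable_phs t measurable_const measurable_id))
    rw [lintegral_const_mul _ hm, lintegral_wt hβ hp t m hg, mul_assoc]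
  · unfold wtConst
    exact (measurable_radial β m).ennreal_ofReal.mul (Measurable.ennreal_ofReal (by fun_prop))

end total

section null

variable {m : ℕ}

lemma ae_last_ne_zero : ∀ᵐ c : Fin (m + 1) → ℂ, c (Fin.last m) ≠ 0 := by
  have h := Measure.addHaar_submodule (volume : Measure (Fin (m + 1) → ℂ))
    (LinearMap.ker (LinearMap.proj (Fin.last m) : (Fin (m + 1) → ℂ) →ₗ[ℝ] ℂ)) (by
      intro h
      have : (fun _ => 1 : Fin (m + 1) → ℂ) ∈
          LinearMap.ker (LinearMap.proj (Fin.last m) : (Fin (m + 1) → ℂ) →ₗ[ℝ] ℂ) := by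
        rw [h]; trivial
      simp at this)
  rw [ae_iff]
  refine measure_mono_null (fun c hc => ?_) h
  simpa using hc

lemma ae_ev_one_add_evs_one_ne_zero : ∀ᵐ c : Fin (m + 1) → ℂ,
    ev (c (Fin.last m)) (Fin.init c) 1 +
      (-1) ^ (m + 1) * evs (c (Fin.last m)) (Fin.init c) 1 ≠ 0 := by
  let S : (Fin (m + 1) → ℂ) →ₗ[ℝ] ℂ := ∑ i, LinearMap.proj i
  let L : (Fin (m + 1) → ℂ) →ₗ[ℝ] ℂ :=
    S + ((-1 : ℝ) ^ (m + 1)) • (Complex.conjAe.toLinearMap ∘ₗ S)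
  have hS : ∀ c, S c = ∑ i, c i := fun c => by simp [S]
  have hL : ∀ c, L c = ev (c (Fin.last m)) (Fin.init c) 1 +
      (-1) ^ (m + 1) * evs (c (Fin.last m)) (Fin.init c) 1 := by
    intro c
    have h1 : ev (c (Fin.last m)) (Fin.init c) 1 = S c := by
      rw [← evc_eq_ev, hS]; simp [evc]
    have h2 : evs (c (Fin.last m)) (Fin.init c) 1 = starRingEnd ℂ (S c) := by
      rw [evs_eq_of_norm_eq_one _ norm_one, h1]; simp
    rw [h1, h2]
    have h3 : L c = S c + ((-1 : ℝ) ^ (m + 1)) • starRingEnd ℂ (S c) := rfl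
    rw [h3, Complex.real_smul]
    push_cast
    rfl
  have h := Measure.addHaar_submodule (volume : Measure (Fin (m + 1) → ℂ)) (LinearMap.ker L) (by
    intro h
    have hm : (Pi.single 0 (1 + Complex.I) : Fin (m + 1) → ℂ) ∈ LinearMap.ker L := by
      rw [h]; trivial
    have h4 : S (Pi.single 0 (1 + Complex.I)) = 1 + Complex.I := by
      rw [hS, Finset.sum_pi_single']; simp
    have h3 : L (Pi.single 0 (1 + Complex.I)) = S (Pi.single 0 (1 + Complex.I)) +
      ((-1 : ℝ) ^ (m + 1)) • starRingEnd ℂ (S (Pi.single 0 (1 + Complex.I))) := rfl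
    rw [h4] at h3
    rw [LinearMap.mem_ker, h3, Complex.ext_iff] at hm
    have h5 := hm.1
    have h6 := hm.2
    rcases neg_one_pow_eq_or ℝ (m + 1) with e | e
    · rw [e] at h5
      simp at h5
    · rw [e] at h6
      simp at h6)
  rw [ae_iff]
  refine measure_mono_null (fun c hc => ?_) h
  simp only [Set.mem_ofPred_eq, not_not] at hc
  change L c = 0
  rw [hL, hc]

end null

section image

variable {m : ℕ}

lemma injOn_psi : Set.InjOn psi (dom (m + 1)) := fun ζ h ζ' h' e =>
  (psi_eq_smul_psi (σ := 1) h h' (Or.inl rfl) (by rw [one_smul]; exact e)).2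

lemma measurableSet_image_psi : MeasurableSet (psi '' dom (m + 1)) :=
  measurable_image_of_fderivWithin (measurableSet_dom _)
    (fun ζ h => (hasFDerivAt_psi ζ (injective_zpt_of_mem_dom h)).hasFDerivWithinAt) injOn_psi

lemma two_mul_setLIntegral_image_psi {β : ℝ} (hβ : 0 < β) (t : ℝ) {g : ℝ → ENNReal}
    (hg : Measurable g) :
    2 * ∫⁻ c in psi '' dom (m + 1), coefDensity β t m g (c (Fin.last m)) (Fin.init c) =
      ENNReal.ofReal (coefConst β m) * ∫⁻ x, g x ∂(phaseLaw β t m) := by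
  set A : Set (Fin (m + 1) → ℂ) := psi '' dom (m + 1) with hA
  set F : (Fin (m + 1) → ℂ) → ENNReal :=
    fun c => coefDensity β t m g (c (Fin.last m)) (Fin.init c) with hF
  have hAm : MeasurableSet A := measurableSet_image_psi
  have hFm : Measurable F := measurable_coefDensity_comp β t hg
  set B : Set (Fin (m + 1) → ℂ) := (fun c => -c) ⁻¹' A with hB
  have hBm : MeasurableSet B := measurable_neg hAm
  have hdisj : Disjoint A B := by
    rw [Set.disjoint_left]
    rintro c ⟨ζ, h, rfl⟩ ⟨ζ', h', e⟩
    have := (psi_eq_smul_psi (σ := -1) h h' (Or.inr rfl) (by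
      rw [neg_smul, one_smul, e, neg_neg])).1
    norm_num at this
  have hFneg : ∀ c, F (-c) = F c := fun c => coefDensity_neg β t g _ _
  have hBint : ∫⁻ c in B, F c = ∫⁻ c in A, F c := by
    rw [← (Measure.measurePreserving_neg
      (volume : Measure (Fin (m + 1) → ℂ))).setLIntegral_comp_preimage hAm hFm]
    simp only [hFneg]
    rfl
  have hsupp : ∫⁻ c, F c = ∫⁻ c in A ∪ B, F c := by
    rw [← lintegral_indicator (hAm.union hBm)]
    refine lintegral_congr_ae ?_
    filter_upwards [ae_last_ne_zero, ae_ev_one_add_evs_one_ne_zero] with c h1 h2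
    by_cases hc : c ∈ A ∪ B
    · rw [Set.indicator_of_mem hc]
    · rw [Set.indicator_of_notMem hc]
      have hng : ¬ IsGood (c (Fin.last m)) (Fin.init c) := by
        intro hgood
        obtain ⟨ζ, hζ, e | e⟩ := exists_psi_eq hgood h2
        · exact hc (Or.inl ⟨ζ, hζ, e⟩)
        · exact hc (Or.inr ⟨ζ, hζ, e⟩)
      simp only [hF, coefDensity, wt_eq_zero β h1 hng, ENNReal.ofReal_zero, zero_mul, mul_zero]
  rw [← lintegral_coefDensity hβ t hg]
  change _ = ∫⁻ c, F c
  rw [hsupp, lintegral_union hBm hdisj, hBint, two_mul]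

/-- The density of angles and weights. -/
def pointDensity {n : ℕ} (β : ℝ) (ζ : Fin n → ℂ) : ℝ :=
  vdm (fun j => (ζ j).im) ^ β * ∏ j, ((ζ j).re ^ (β / 2 - 1) * Real.exp (-(ζ j).re))

lemma det_mul_coefDensity {ζ : Fin (m + 1) → ℂ} (h : ζ ∈ dom (m + 1)) (β t : ℝ)
    (g : ℝ → ENNReal) :
    ENNReal.ofReal (vdm (fun j => (ζ j).im) ^ 2 * ((∑ j, (ζ j).re) / 2) ^ (m + 1)) *
      coefDensity β t m g (psi ζ (Fin.last m)) (Fin.init (psi ζ)) =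
    ENNReal.ofReal (pointDensity β ζ) * g (phs (psi ζ (Fin.last m)) t m (Fin.init (psi ζ))) := by
  have hgood := isGood_psi h
  have hs := sum_re_pos h
  have hn := norm_psi_last h
  have hv : 0 < vdm (fun j => (ζ j).im) :=
    lt_of_le_of_ne (vdm_nonneg _) (vdm_ne_zero (injective_zpt_of_mem_dom h)).symm
  have hρ := hgood.rho_pos
  have hpr := prod_re_mul_vdm_sq h
  rw [coefDensity, ← mul_assoc, ← mul_assoc, ← ENNReal.ofReal_mul (by positivity),
    ← ENNReal.ofReal_mul (mul_nonneg (by positivity) (radial_nonneg _ _ _))]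
  congr 2
  rw [hgood.wt_eq, radial, hn, pointDensity, Finset.prod_mul_distrib, ← Real.exp_sum,
    Finset.sum_neg_distrib, Real.finsetProd_rpow _ _ fun j _ => (h.2 j).2.le]
  set V := vdm (fun j => (ζ j).im)
  set s := ∑ j, (ζ j).re
  set W := ∏ j, (ζ j).re
  set R := rho (psi ζ (Fin.last m)) m (Fin.init (psi ζ))
  have hW : 0 < W := Finset.prod_pos fun j _ => (h.2 j).2
  have e1 : (W * V ^ 2) ^ (β / 2 - 1) = (s ^ (m + 1) * R) ^ (β / 2 - 1) := by rw [hpr]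
  rw [Real.mul_rpow hW.le (by positivity), Real.mul_rpow (by positivity) hρ.le,
    ← Real.rpow_natCast V 2, ← Real.rpow_natCast s (m + 1), ← Real.rpow_mul hv.le,
    ← Real.rpow_mul hs.le] at e1
  have e2 : s ^ (((m + 1 : ℕ) : ℝ) * (β / 2 - 2)) * s ^ (m + 1) =
      s ^ (((m + 1 : ℕ) : ℝ) * (β / 2 - 1)) := by
    rw [← Real.rpow_natCast s (m + 1), ← Real.rpow_add hs]
    congr 1; ring
  have e3 : V ^ β = V ^ 2 * V ^ (((2 : ℕ) : ℝ) * (β / 2 - 1)) := by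
    rw [← Real.rpow_natCast V 2, ← Real.rpow_add hv]
    congr 1; push_cast; ring
  rw [div_pow, e3]
  calc V ^ 2 * (s ^ (m + 1) / 2 ^ (m + 1)) *
      (2 ^ (m + 1) * (s ^ (((m + 1 : ℕ) : ℝ) * (β / 2 - 2)) * Real.exp (-s))) * R ^ (β / 2 - 1)
      = V ^ 2 * ((s ^ (((m + 1 : ℕ) : ℝ) * (β / 2 - 2)) * s ^ (m + 1)) * R ^ (β / 2 - 1)) *
        Real.exp (-s) := by field_simp
    _ = V ^ 2 * (W ^ (β / 2 - 1) * V ^ (((2 : ℕ) : ℝ) * (β / 2 - 1))) * Real.exp (-s) := by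
        rw [e2, e1]
    _ = _ := by ring

lemma setLIntegral_dom {β : ℝ} (hβ : 0 < β) (t : ℝ) {g : ℝ → ENNReal} (hg : Measurable g) :
    ∫⁻ ζ in dom (m + 1), ENNReal.ofReal (pointDensity β ζ) *
        g (phs (psi ζ (Fin.last m)) t m (Fin.init (psi ζ))) =
      ENNReal.ofReal (coefConst β m / 2) * ∫⁻ x, g x ∂(phaseLaw β t m) := by
  have h1 := two_mul_setLIntegral_image_psi (m := m) hβ t hg
  rw [lintegral_image_eq_lintegral_abs_det_fderiv_mul volume (measurableSet_dom _)
    (fun ζ h => (hasFDerivAt_psi ζ (injective_zpt_of_mem_dom h)).hasFDerivWithinAt) injOn_psi] at h1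
  rw [setLIntegral_congr_fun (g := fun ζ : Fin (m + 1) → ℂ => ENNReal.ofReal (pointDensity β ζ) *
        g (phs (psi ζ (Fin.last m)) t m (Fin.init (psi ζ)))) (measurableSet_dom _)
    fun ζ h => by
      simp only [abs_det_fderiv_psi ζ (injective_zpt_of_mem_dom h) (sum_re_pos h).le]
      exact det_mul_coefDensity h β t g] at h1
  have h2 : ENNReal.ofReal (coefConst β m) = 2 * ENNReal.ofReal (coefConst β m / 2) := by
    rw [show (2 : ENNReal) = ENNReal.ofReal 2 by simp, ← ENNReal.ofReal_mul (by norm_num)]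
    congr 1; ring
  rw [h2, mul_assoc] at h1
  exact (ENNReal.mul_right_inj (by norm_num) (by norm_num)).1 h1

end image

section fubini

lemma lintegral_prod_fin {G : ℝ → ENNReal} (hG : Measurable G) :
    ∀ n : ℕ, ∫⁻ w : Fin n → ℝ, ∏ j, G (w j) = (∫⁻ x, G x) ^ n
  | 0 => by simp [volume_pi]
  | n + 1 => by
    have h := volume_preserving_piFinSuccAbove (fun _ : Fin (n + 1) => ℝ) 0
    have hF : Measurable fun q : ℝ × (Fin n → ℝ) => G q.1 * ∏ j, G (q.2 j) := by fun_prop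
    have h2 := h.lintegral_comp hF
    rw [Measure.volume_eq_prod, lintegral_prod_mul (f := G) (g := fun w : Fin n → ℝ => ∏ j, G (w j)) hG.aemeasurable
      (Measurable.aemeasurable (by fun_prop)), lintegral_prod_fin hG n] at h2
    rw [pow_succ', ← h2]
    refine lintegral_congr fun w => ?_
    rw [Fin.prod_univ_succ]
    simp [MeasurableEquiv.piFinSuccAbove_apply]
    rfl

lemma lintegral_im_mul_prod_re {n : ℕ} {F : (Fin n → ℝ) → ENNReal} (hF : Measurable F)
    {G : ℝ → ENNReal} (hG : Measurable G) :
    ∫⁻ ζ : Fin n → ℂ, F (fun j => (ζ j).im) * ∏ j, G (ζ j).re =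
      (∫⁻ θ, F θ) * (∫⁻ x, G x) ^ n := by
  have h1 : MeasurePreserving (fun ζ : Fin n → ℂ => fun j => Complex.measurableEquivRealProd (ζ j)) :=
    volume_preserving_pi fun _ => Complex.volume_preserving_equiv_real_prod
  have h2 := volume_measurePreserving_arrowProdEquivProdArrow ℝ ℝ (Fin n)
  have h3 := h2.comp h1
  have hm : Measurable fun q : (Fin n → ℝ) × (Fin n → ℝ) => F q.2 * ∏ j, G (q.1 j) := by fun_prop
  have h4 := h3.lintegral_comp hm
  rw [Measure.volume_eq_prod] at h4
  have hc : ∀ q : (Fin n → ℝ) × (Fin n → ℝ), F q.2 * ∏ j, G (q.1 j) =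
      (∏ j, G (q.1 j)) * F q.2 := fun q => mul_comm _ _
  simp only [hc] at h4
  rw [lintegral_prod_mul (f := fun w : Fin n → ℝ => ∏ j, G (w j)) (g := F)
      (Measurable.aemeasurable (by fun_prop)) hF.aemeasurable,
    lintegral_prod_fin hG] at h4
  rw [mul_comm (∫⁻ θ, F θ), ← h4]
  refine lintegral_congr fun ζ => ?_
  rw [mul_comm]
  rfl

lemma lintegral_gamma {a : ℝ} (ha : 0 < a) :
    ∫⁻ x in Set.Ioi (0 : ℝ), ENNReal.ofReal (x ^ (a - 1) * Real.exp (-x)) =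
      ENNReal.ofReal (Real.Gamma a) := by
  rw [Real.Gamma_eq_integral ha, ofReal_integral_eq_lintegral_ofReal (Real.GammaIntegral_convergent ha)]
  · simp only [mul_comm]
  · exact (ae_restrict_iff' measurableSet_Ioi).2 (Eventually.of_forall fun x hx => by
      have : (0 : ℝ) < x := hx
      positivity)

end fubini

section symm

variable {n : ℕ}

/-- The open box of angles. -/
def box (n : ℕ) : Set (Fin n → ℝ) := Set.univ.pi fun _ => Set.Ioo 0 (2 * Real.pi)

lemma measurableSet_box : MeasurableSet (box n) :=
  MeasurableSet.univ_pi fun _ => measurableSet_Ioo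

lemma measurableSet_strictMono : MeasurableSet {θ : Fin n → ℝ | StrictMono θ} := by
  have : {θ : Fin n → ℝ | StrictMono θ} =
      ⋂ i : Fin n, ⋂ j : Fin n, ⋂ _ : i < j, {θ : Fin n → ℝ | θ i < θ j} := by
    ext θ
    simp only [StrictMono, Set.mem_ofPred_eq, Set.mem_iInter]
  rw [this]
  exact MeasurableSet.iInter fun i => MeasurableSet.iInter fun j => MeasurableSet.iInter fun _ =>
    measurableSet_lt (measurable_pi_apply _) (measurable_pi_apply _)

lemma ae_injective : ∀ᵐ θ : Fin n → ℝ, Function.Injective θ := by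
  have h : ∀ i j : Fin n, i ≠ j → ∀ᵐ θ : Fin n → ℝ, θ i ≠ θ j := by
    intro i j hij
    let L : (Fin n → ℝ) →ₗ[ℝ] ℝ :=
      (LinearMap.proj i : (Fin n → ℝ) →ₗ[ℝ] ℝ) - (LinearMap.proj j : (Fin n → ℝ) →ₗ[ℝ] ℝ)
    have hL : ∀ θ, L θ = θ i - θ j := fun _ => rfl
    have h := Measure.addHaar_submodule (volume : Measure (Fin n → ℝ)) (LinearMap.ker L) (by
      intro h
      have : (Pi.single i 1 : Fin n → ℝ) ∈ LinearMap.ker L := by rw [h]; trivial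
      simp [hL, hij.symm] at this)
    rw [ae_iff]
    refine measure_mono_null (fun c hc => ?_) h
    change L c = 0
    simpa [hL, sub_eq_zero] using hc
  have h2 : ∀ᵐ θ : Fin n → ℝ, ∀ i j : Fin n, i ≠ j → θ i ≠ θ j := by
    simp only [ae_all_iff]
    exact h
  filter_upwards [h2] with θ hθ i j e
  by_contra hij
  exact hθ i j hij e

lemma measurePreserving_comp_perm (σ : Equiv.Perm (Fin n)) :
    MeasurePreserving (fun θ : Fin n → ℝ => θ ∘ σ) := by
  have h := volume_measurePreserving_piCongrLeft (fun _ : Fin n => ℝ) σ.symm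
  convert! h using 1
  ext θ i
  have := Equiv.piCongrLeft_apply_apply (fun _ : Fin n => ℝ) σ.symm θ (σ i)
  simp only [Equiv.symm_apply_apply] at this
  simp only [Function.comp_apply, MeasurableEquiv.coe_piCongrLeft]
  exact this.symm

/-- Integrals of symmetric functions reduce to the ordered chamber. -/
lemma lintegral_symmetric {f : (Fin n → ℝ) → ENNReal} (hf : Measurable f)
    (hs : ∀ (σ : Equiv.Perm (Fin n)) θ, f (θ ∘ σ) = f θ) :
    ∫⁻ θ, f θ = (n.factorial : ENNReal) * ∫⁻ θ in {θ : Fin n → ℝ | StrictMono θ}, f θ := by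
  have hS := measurableSet_strictMono (n := n)
  have h1 : ∀ᵐ θ : Fin n → ℝ, f θ = ∑ σ : Equiv.Perm (Fin n),
      Set.indicator {θ : Fin n → ℝ | StrictMono θ} f (θ ∘ σ) := by
    filter_upwards [ae_injective] with θ hθ
    have hmono : StrictMono (θ ∘ Tuple.sort θ) :=
      (Tuple.monotone_sort θ).strictMono_of_injective (hθ.comp (Tuple.sort θ).injective)
    rw [Finset.sum_eq_single (Tuple.sort θ)]
    · rw [Set.indicator_of_mem (by exact hmono), hs]
    · intro σ _ hne
      rw [Set.indicator_of_notMem]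
      intro hσ
      apply hne
      have e : θ ∘ σ = θ ∘ Tuple.sort θ := by
        refine (StrictMono.range_inj hσ hmono).1 ?_
        rw [σ.surjective.range_comp, (Tuple.sort θ).surjective.range_comp]
      ext i
      exact congrArg Fin.val (hθ (congrFun e i))
    · simp
  rw [lintegral_congr_ae h1, lintegral_finsetSum]
  · have h2 : ∀ σ : Equiv.Perm (Fin n),
        ∫⁻ θ, Set.indicator {θ : Fin n → ℝ | StrictMono θ} f (θ ∘ σ) =
          ∫⁻ θ in {θ : Fin n → ℝ | StrictMono θ}, f θ := fun σ => by
      rw [(measurePreserving_comp_perm σ).lintegral_comp (hf.indicator hS), lintegral_indicator hS]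
    simp only [h2, Finset.sum_const, Finset.card_univ, Fintype.card_perm, Fintype.card_fin,
      nsmul_eq_mul]
  · exact fun σ _ => (hf.indicator hS).comp (measurePreserving_comp_perm σ).measurable

lemma vdm_comp_perm (σ : Equiv.Perm (Fin n)) (θ : Fin n → ℝ) : vdm (θ ∘ σ) = vdm θ := by
  have h : vdm (θ ∘ σ) ^ 2 = vdm θ ^ 2 := by
    rw [← prod_norm_sub_eq_vdm_sq, ← prod_norm_sub_eq_vdm_sq,
      ← Equiv.prod_comp σ fun j => ∏ k ∈ Finset.univ.erase j, ‖zpt θ j - zpt θ k‖]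
    refine Finset.prod_congr rfl fun j _ => ?_
    refine Finset.prod_bij (fun k _ => σ k) ?_ ?_ ?_ ?_
    · intro k hk; simpa using hk
    · intro a _ b _ h; exact σ.injective h
    · intro b hb
      refine ⟨σ.symm b, ?_, by simp⟩
      simp only [Finset.mem_erase, Finset.mem_univ, and_true] at hb ⊢
      rintro rfl
      simp at hb
    · intro k _; rfl
  exact (sq_eq_sq₀ (vdm_nonneg _) (vdm_nonneg _)).1 h

lemma countIn_comp_perm (a b : ℝ) (σ : Equiv.Perm (Fin n)) (θ : Fin n → ℝ) :
    countIn a b (θ ∘ σ) = countIn a b θ := by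
  unfold countIn
  refine Finset.card_bij (fun k _ => σ k) ?_ ?_ ?_
  · intro k hk; simpa using hk
  · intro a _ b _ h; exact σ.injective h
  · intro b hb
    exact ⟨σ.symm b, by simpa using hb, by simp⟩

lemma measurable_countIn (a b : ℝ) : Measurable fun θ : Fin n → ℝ => countIn a b θ := by
  have : (fun θ : Fin n → ℝ => countIn a b θ) =
      fun θ => ∑ j, Set.indicator (Set.Ico a b) (fun _ => 1) (θ j) := by
    ext θ
    classical
    simp only [countIn, Finset.card_filter, Set.indicator_apply, Set.mem_Ico]
  rw [this]
  exact Finset.measurable_fun_sum _ fun j _ =>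
    (measurable_const.indicator measurableSet_Ico).comp (measurable_pi_apply j)

@[fun_prop]
lemma measurable_vdm : Measurable (vdm : (Fin n → ℝ) → ℝ) := by
  unfold vdm zpt; fun_prop

end symm

section ensemble

variable {n : ℕ}

lemma prod_filter_lt_eq_vdm_rpow (β : ℝ) (y : Fin n → ℝ) :
    ∏ p ∈ Finset.univ.filter (fun p : Fin n × Fin n => p.1 < p.2),
      ‖Complex.exp (Complex.I * (y p.1 : ℂ)) - Complex.exp (Complex.I * (y p.2 : ℂ))‖ ^ β =
      vdm y ^ β := by
  rw [vdm, ← Real.finsetProd_rpow _ _ fun i _ => Finset.prod_nonneg fun _ _ => norm_nonneg _,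
    Finset.prod_filter, Fintype.prod_prod_type]
  refine Finset.prod_congr rfl fun i _ => ?_
  rw [← Real.finsetProd_rpow _ _ fun i _ => norm_nonneg _, ← Finset.prod_filter,
    Finset.filter_lt_eq_Ioi]
  refine Finset.prod_congr rfl fun j _ => ?_
  rw [norm_sub_rev, zpt, zpt, mul_comm, mul_comm Complex.I]

lemma lintegral_cbe (β : ℝ) {f : (Fin n → ℝ) → ENNReal} (hf : Measurable f) :
    ∫⁻ y, f y ∂(cbe β n) = ENNReal.ofReal (1 / cbeConst β n) *
      ∫⁻ y in box n, ENNReal.ofReal (vdm y ^ β) * f y := by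
  have hbox : (Set.univ.pi fun _ => Set.Ico 0 (2 * Real.pi) : Set (Fin n → ℝ)) =ᵐ[volume] box n :=
    Measure.ae_eq_set_pi fun _ _ => Ioo_ae_eq_Ico.symm
  have hd : ∀ y : Fin n → ℝ, 0 ≤ vdm y ^ β := fun y => Real.rpow_nonneg (vdm_nonneg y) β
  simp only [cbe, prod_filter_lt_eq_vdm_rpow]
  rw [lintegral_withDensity_eq_lintegral_mul _ (by fun_prop) hf, Measure.restrict_congr_set hbox,
    ← lintegral_const_mul _ (by fun_prop)]
  refine lintegral_congr fun y => ?_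
  simp only [Pi.mul_apply]
  rw [ENNReal.ofReal_mul' (hd y), mul_assoc]

lemma cbeConst_pos {β : ℝ} (hβ : 0 < β) (n : ℕ) : 0 < cbeConst β n := by
  have h1 : 0 < Real.Gamma (1 + β * n / 2) := Real.Gamma_pos_of_pos (by positivity)
  have h2 : 0 < Real.Gamma (1 + β / 2) := Real.Gamma_pos_of_pos (by positivity)
  unfold cbeConst
  positivity

lemma factorial_mul_coefConst {β : ℝ} (hβ : 0 < β) (m : ℕ) :
    ((m + 1).factorial : ℝ) * (coefConst β m / 2) =
      cbeConst β (m + 1) * Real.Gamma (β / 2) ^ (m + 1) := by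
  have hG : 0 < Real.Gamma (β / 2) := Real.Gamma_pos_of_pos (by positivity)
  have h1 : Real.Gamma (1 + β / 2) = β / 2 * Real.Gamma (β / 2) := by
    rw [add_comm, Real.Gamma_add_one (by positivity)]
  have h2 : Real.Gamma (1 + β * (m + 1 : ℕ) / 2) =
      ((m + 1 : ℕ) * (β / 2)) * Real.Gamma ((m + 1 : ℕ) * (β / 2)) := by
    rw [← Real.Gamma_add_one (by positivity)]
    congr 1; ring
  have h3 : ((m.factorial : ℕ) : ℝ) * ∏ k ∈ Finset.range m, (Real.pi / ((k + 1 : ℕ) * (β / 2))) =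
      (Real.pi / (β / 2)) ^ m := by
    rw [← Finset.prod_range_add_one_eq_factorial, Nat.cast_prod, ← Finset.prod_mul_distrib,
      ← Finset.card_range m, ← Finset.prod_const, Finset.card_range]
    refine Finset.prod_congr rfl fun k _ => ?_
    have : ((k + 1 : ℕ) : ℝ) ≠ 0 := by positivity
    field_simp
  rw [coefConst, cbeConst, h1, h2, Nat.factorial_succ, Nat.cast_mul]
  calc ((m + 1 : ℕ) : ℝ) * (m.factorial : ℝ) * (2 ^ (m + 1) *
        (∏ k ∈ Finset.range m, (Real.pi / ((k + 1 : ℕ) * (β / 2)))) *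
        (2 * Real.pi * Real.Gamma ((m + 1 : ℕ) * (β / 2))) / 2)
      = ((m + 1 : ℕ) : ℝ) * ((m.factorial : ℝ) *
        ∏ k ∈ Finset.range m, (Real.pi / ((k + 1 : ℕ) * (β / 2)))) * 2 ^ (m + 1) *
        (Real.pi * Real.Gamma ((m + 1 : ℕ) * (β / 2))) := by ring
    _ = _ := by
        rw [h3, mul_pow (β / 2), div_pow, mul_pow]
        field_simp
        ring

lemma factorial_mul_setLIntegral_dom {β : ℝ} (hβ : 0 < β) {f : (Fin n → ℝ) → ENNReal}
    (hf : Measurable f) (hs : ∀ (σ : Equiv.Perm (Fin n)) θ, f (θ ∘ σ) = f θ) :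
    (n.factorial : ENNReal) *
      ∫⁻ ζ in dom n, ENNReal.ofReal (pointDensity β ζ) * f (fun j => (ζ j).im) =
    ENNReal.ofReal (cbeConst β n * Real.Gamma (β / 2) ^ n) * ∫⁻ y, f y ∂(cbe β n) := by
  have hC := cbeConst_pos hβ n
  have hΓ : 0 < Real.Gamma (β / 2) := Real.Gamma_pos_of_pos (by positivity)
  set H : (Fin n → ℝ) → ENNReal :=
    (box n).indicator fun y => ENNReal.ofReal (vdm y ^ β) * f y with hH
  have hHm : Measurable H := Measurable.indicator (by fun_prop) measurableSet_box
  have hHs : ∀ (σ : Equiv.Perm (Fin n)) θ, H (θ ∘ σ) = H θ := by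
    intro σ θ
    have hb : θ ∘ σ ∈ box n ↔ θ ∈ box n := by
      simp only [box, Set.mem_univ_pi, Function.comp_apply]
      exact ⟨fun h i => by simpa using h (σ.symm i), fun h i => h _⟩
    by_cases h : θ ∈ box n
    · rw [hH, Set.indicator_of_mem h, Set.indicator_of_mem (hb.2 h), vdm_comp_perm, hs]
    · rw [hH, Set.indicator_of_notMem h, Set.indicator_of_notMem (fun h' => h (hb.1 h'))]
  have h1 := lintegral_symmetric hHm hHs
  set G : ℝ → ENNReal := (Set.Ioi (0 : ℝ)).indicator fun x =>
    ENNReal.ofReal (x ^ (β / 2 - 1) * Real.exp (-x)) with hG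
  have hGm : Measurable G := Measurable.indicator (by fun_prop) measurableSet_Ioi
  have hGi : ∫⁻ x, G x = ENNReal.ofReal (Real.Gamma (β / 2)) := by
    rw [hG, lintegral_indicator measurableSet_Ioi, lintegral_gamma (by positivity)]
  have hSm := measurableSet_strictMono (n := n)
  have h2 := lintegral_im_mul_prod_re (hHm.indicator hSm) hGm
  rw [lintegral_indicator hSm, hGi, ← ENNReal.ofReal_pow hΓ.le] at h2
  have h3 : ∀ ζ : Fin n → ℂ, (dom n).indicator
      (fun ζ => ENNReal.ofReal (pointDensity β ζ) * f (fun j => (ζ j).im)) ζ =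
      Set.indicator {θ : Fin n → ℝ | StrictMono θ} H (fun j => (ζ j).im) * ∏ j, G (ζ j).re := by
    intro ζ
    by_cases hζ : ζ ∈ dom n
    · have hb : (fun j => (ζ j).im) ∈ box n := fun j _ => (hζ.2 j).1
      rw [Set.indicator_of_mem hζ, Set.indicator_of_mem (by exact hζ.1), hH,
        Set.indicator_of_mem hb]
      have e : ∀ j, G (ζ j).re =
          ENNReal.ofReal ((ζ j).re ^ (β / 2 - 1) * Real.exp (-(ζ j).re)) := fun j => by
        rw [hG, Set.indicator_of_mem (by exact (hζ.2 j).2)]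
      rw [Finset.prod_congr rfl fun j _ => e j, ← ENNReal.ofReal_prod_of_nonneg fun j _ =>
        mul_nonneg (Real.rpow_nonneg (hζ.2 j).2.le _) (Real.exp_pos _).le, pointDensity,
        ENNReal.ofReal_mul (Real.rpow_nonneg (vdm_nonneg _) _)]
      ring
    · rw [Set.indicator_of_notMem hζ]
      by_contra hne
      have hne' := Ne.symm hne
      obtain ⟨ha, hp⟩ := mul_ne_zero_iff.1 hne'
      have ha1 : StrictMono fun j => (ζ j).im := by
        by_contra h
        exact ha (Set.indicator_of_notMem h _)
      rw [Set.indicator_of_mem (by exact ha1)] at ha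
      have ha2 : (fun j => (ζ j).im) ∈ box n := by
        by_contra h
        exact ha (Set.indicator_of_notMem h _)
      refine hζ ⟨ha1, fun j => ⟨ha2 j trivial, ?_⟩⟩
      by_contra h
      exact Finset.prod_ne_zero_iff.1 hp j (Finset.mem_univ j) (Set.indicator_of_notMem h _)
  rw [← lintegral_indicator (measurableSet_dom n), lintegral_congr h3, h2, ← mul_assoc, ← h1, hH,
    lintegral_indicator measurableSet_box, lintegral_cbe β hf, ENNReal.ofReal_mul hC.le]
  have e : ENNReal.ofReal (cbeConst β n) * ENNReal.ofReal (1 / cbeConst β n) = 1 := by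
    rw [← ENNReal.ofReal_mul hC.le, mul_one_div_cancel hC.ne', ENNReal.ofReal_one]
  set Y := ∫⁻ y in box n, ENNReal.ofReal (vdm y ^ β) * f y
  calc Y * ENNReal.ofReal (Real.Gamma (β / 2) ^ n)
      = (ENNReal.ofReal (cbeConst β n) * ENNReal.ofReal (1 / cbeConst β n)) *
          (Y * ENNReal.ofReal (Real.Gamma (β / 2) ^ n)) := by rw [e, one_mul]
    _ = _ := by ring

end ensemble

section coupling

variable {m : ℕ}

lemma coefConst_pos {β : ℝ} (hβ : 0 < β) (m : ℕ) : 0 < coefConst β m := by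
  have h1 : 0 < Real.Gamma ((m + 1 : ℕ) * (β / 2)) := Real.Gamma_pos_of_pos (by positivity)
  have h2 : 0 < ∏ k ∈ Finset.range m, (Real.pi / ((k + 1 : ℕ) * (β / 2))) :=
    Finset.prod_pos fun k _ => by positivity
  unfold coefConst
  positivity

lemma setLIntegral_dom_im {β : ℝ} (hβ : 0 < β) {f : (Fin (m + 1) → ℝ) → ENNReal}
    (hf : Measurable f) (hs : ∀ (σ : Equiv.Perm (Fin (m + 1))) θ, f (θ ∘ σ) = f θ) :
    ∫⁻ ζ in dom (m + 1), ENNReal.ofReal (pointDensity β ζ) * f (fun j => (ζ j).im) =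
      ENNReal.ofReal (coefConst β m / 2) * ∫⁻ y, f y ∂(cbe β (m + 1)) := by
  have h := factorial_mul_setLIntegral_dom hβ hf hs
  rw [← factorial_mul_coefConst hβ, ENNReal.ofReal_mul (by positivity), ENNReal.ofReal_natCast,
    mul_assoc] at h
  exact (ENNReal.mul_right_inj (by exact_mod_cast (Nat.factorial_ne_zero _)) (by simp)).1 h

lemma measurable_coeff_prod_X_sub_C {Ω ι : Type*} [MeasurableSpace Ω] {f : ι → Ω → ℂ}
    (hf : ∀ k, Measurable (f k)) (s : Finset ι) : ∀ i : ℕ,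
    Measurable fun ω => (∏ k ∈ s, (Polynomial.X - Polynomial.C (f k ω))).coeff i := by
  classical
  induction s using Finset.induction_on with
  | empty => intro i; simp
  | insert a s ha ih =>
    intro i
    simp only [Finset.prod_insert ha, sub_mul, Polynomial.coeff_sub, Polynomial.coeff_C_mul]
    have h1 := (hf a).mul (ih i)
    cases i with
    | zero =>
      simp only [Polynomial.coeff_X_mul_zero]
      exact measurable_const.sub h1
    | succ i =>
      simp only [Polynomial.coeff_X_mul]
      exact (ih i).sub h1

lemma measurable_psi {n : ℕ} : Measurable (psi : (Fin n → ℂ) → Fin n → ℂ) := by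
  have him : Measurable fun ζ : Fin n → ℂ => fun j => (ζ j).im := by fun_prop
  refine measurable_pi_iff.2 fun i => ?_
  change Measurable fun ζ : Fin n → ℂ => ∑ j, ((ζ j).re : ℂ) * qcoef (fun j => (ζ j).im) j i
  refine Finset.measurable_fun_sum _ fun j _ => Measurable.mul (by fun_prop) ?_
  unfold qcoef
  simp only [Polynomial.coeff_C_mul]
  refine Measurable.mul (by unfold kap; fun_prop) ?_
  exact measurable_coeff_prod_X_sub_C (fun k => by unfold zpt; fun_prop) _ _

@[fun_prop]
lemma measurable_pointDensity {n : ℕ} (β : ℝ) : Measurable (pointDensity β : (Fin n → ℂ) → ℝ) := by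
  unfold pointDensity
  fun_prop

lemma ae_im_ne (t : ℝ) : ∀ᵐ ζ : Fin (m + 1) → ℂ, ∀ j, (ζ j).im ≠ t := by
  rw [ae_all_iff]
  intro j
  have h0 : ∀ᵐ z : ℂ, z.im ≠ t := by
    have h1 : ∀ᵐ x : ℝ × ℝ, x.2 ≠ t := by
      have : ∀ᵐ y : ℝ, y ≠ t := by simp [ae_iff]
      exact Measure.quasiMeasurePreserving_snd.ae this
    exact Complex.volume_preserving_equiv_real_prod.quasiMeasurePreserving.ae h1
  exact (Measure.quasiMeasurePreserving_eval (μ := fun _ : Fin (m + 1) => (volume : Measure ℂ))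
    j).ae h0

/-- The circular ensemble and the phase law can be coupled so that the phase differs from `2π`
times the count by at most `2π`. -/
lemma exists_coupling {β : ℝ} (hβ : 0 < β) (m : ℕ) {t : ℝ} (ht : t ∈ Set.Ioo 0 (2 * Real.pi)) :
    ∃ (ν : Measure (Fin (m + 1) → ℂ)) (X : (Fin (m + 1) → ℂ) → ℝ) (N : (Fin (m + 1) → ℂ) → ℕ),
      Measurable X ∧ Measurable N ∧ ν.map X = phaseLaw β t m ∧
      ν.map N = (cbe β (m + 1)).map (fun y => countIn 0 t y) ∧
      ∀ᵐ ω ∂ν, |X ω - 2 * Real.pi * N ω| ≤ 2 * Real.pi := by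
  have hK : 0 < coefConst β m / 2 := half_pos (coefConst_pos hβ m)
  set k : ENNReal := ENNReal.ofReal (coefConst β m / 2) with hk
  have hk0 : k ≠ 0 := (ENNReal.ofReal_pos.2 hK).ne'
  have hki : k ≠ ⊤ := ENNReal.ofReal_ne_top
  set X : (Fin (m + 1) → ℂ) → ℝ := fun ζ => phs (psi ζ (Fin.last m)) t m (Fin.init (psi ζ))
  set N : (Fin (m + 1) → ℂ) → ℕ := fun ζ => countIn 0 t fun j => (ζ j).im
  have hX : Measurable X := measurable_phs t ((measurable_pi_apply _).comp measurable_psi)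
    (measurable_init.comp measurable_psi)
  have hN : Measurable N := (measurable_countIn 0 t).comp (by fun_prop)
  have hden : Measurable fun ζ : Fin (m + 1) → ℂ => ENNReal.ofReal (pointDensity β ζ) := by
    fun_prop
  have hint : ∀ {f : (Fin (m + 1) → ℂ) → ENNReal}, Measurable f →
      ∫⁻ ζ, f ζ ∂(k⁻¹ • (volume.restrict (dom (m + 1))).withDensity fun ζ =>
        ENNReal.ofReal (pointDensity β ζ)) =
      k⁻¹ * ∫⁻ ζ in dom (m + 1), ENNReal.ofReal (pointDensity β ζ) * f ζ := by
    intro f hf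
    rw [lintegral_smul_measure, lintegral_withDensity_eq_lintegral_mul _ hden hf]
    rfl
  refine ⟨k⁻¹ • (volume.restrict (dom (m + 1))).withDensity
    (fun ζ => ENNReal.ofReal (pointDensity β ζ)), X, N, hX, hN, ?_, ?_, ?_⟩
  · refine Measure.ext_of_lintegral _ fun g hg => ?_
    rw [lintegral_map hg hX, hint (f := fun ζ => g (X ζ)) (hg.comp hX), setLIntegral_dom hβ t hg, ← mul_assoc,
      ENNReal.inv_mul_cancel hk0 hki, one_mul]
  · refine Measure.ext_of_lintegral _ fun g hg => ?_
    rw [lintegral_map hg hN, lintegral_map hg (measurable_countIn 0 t), hint (f := fun ζ => g (N ζ)) (hg.comp hN),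
      setLIntegral_dom_im hβ (f := fun y => g (countIn 0 t y)) (hg.comp (measurable_countIn 0 t))
        (fun σ θ => by rw [countIn_comp_perm]), ← mul_assoc,
      ENNReal.inv_mul_cancel hk0 hki, one_mul]
  · refine Measure.ae_smul_measure ?_ _
    refine (withDensity_absolutelyContinuous _ _).ae_le ?_
    change ∀ᵐ ζ ∂(volume.restrict (dom (m + 1))), |X ζ - 2 * Real.pi * N ζ| ≤ 2 * Real.pi
    rw [ae_restrict_iff' (measurableSet_dom _)]
    filter_upwards [ae_im_ne t] with ζ hne hζ
    refine (isGood_psi hζ).abs_phs_sub_count_le (ε := (-1) ^ (m + 1)) (c := psi ζ (Fin.last m)) ?_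
      (fun j => (hζ.2 j).1) (fun z => ?_) ht hne
    · rw [← mul_pow]; simp
    · exact mul_ev_add_evs_psi ζ (injective_zpt_of_mem_dom hζ) z

end coupling

section limit

lemma norm_exp_mul_I_sub_le (x y : ℝ) :
    ‖Complex.exp (x * Complex.I) - Complex.exp (y * Complex.I)‖ ≤ |x - y| := by
  have h : Complex.exp (x * Complex.I) - Complex.exp (y * Complex.I) =
      Complex.exp (y * Complex.I) * (Complex.exp (Complex.I * (x - y : ℝ)) - 1) := by
    rw [mul_sub, mul_one, ← Complex.exp_add]
    congr 2
    push_cast; ring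
  rw [h, norm_mul, Complex.norm_exp_ofReal_mul_I, one_mul]
  exact Real.norm_exp_I_mul_ofReal_sub_one_le

lemma isProbabilityMeasure_cbe {β : ℝ} (hβ : 0 < β) (m : ℕ) :
    IsProbabilityMeasure (cbe β (m + 1)) := by
  obtain ⟨ν, X, N, hX, hN, h1, h2, -⟩ :=
    exists_coupling hβ m (t := 1) ⟨one_pos, by linarith [Real.pi_gt_three]⟩
  have := isProbabilityMeasure_phaseLaw (t := 1) hβ m
  have e1 : ν Set.univ = 1 := by
    rw [← Set.preimage_univ (f := X), ← Measure.map_apply hX MeasurableSet.univ, h1, measure_univ]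
  have e2 : (cbe β (m + 1)).map (fun y => countIn 0 1 y) Set.univ = 1 := by
    rw [← h2, Measure.map_apply hN MeasurableSet.univ, Set.preimage_univ, e1]
  rw [Measure.map_apply (measurable_countIn 0 1) MeasurableSet.univ, Set.preimage_univ] at e2
  exact ⟨e2⟩

lemma norm_charFun_sub_phaseChar_le {β : ℝ} (hβ : 0 < β) (m : ℕ) {t : ℝ}
    (ht : t ∈ Set.Ioo 0 (2 * Real.pi)) (a ξ : ℝ) :
    ‖charFun ((cbe β (m + 1)).map fun y =>
      a * ((countIn 0 t y : ℝ) - (m + 1 : ℕ) * t / (2 * Real.pi))) ξ -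
      phaseChar β t (ξ * a / (2 * Real.pi)) 0 (m + 1)‖ ≤ |ξ * a| := by
  obtain ⟨ν, X, N, hX, hN, h1, h2, h3⟩ := exists_coupling hβ m ht
  have := isProbabilityMeasure_phaseLaw (t := t) hβ m
  have : IsProbabilityMeasure ν := ⟨by
    rw [← Set.preimage_univ (f := X), ← Measure.map_apply hX MeasurableSet.univ, h1, measure_univ]⟩
  have hπ := Real.pi_pos
  set l := ξ * a / (2 * Real.pi) with hl
  set f : ℕ → ℝ := fun k => a * ((k : ℝ) - (m + 1 : ℕ) * t / (2 * Real.pi)) with hf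
  have hfm : Measurable f := measurable_of_countable f
  have hmap : (cbe β (m + 1)).map (fun y =>
      a * ((countIn 0 t y : ℝ) - (m + 1 : ℕ) * t / (2 * Real.pi))) = (ν.map N).map f := by
    rw [h2, Measure.map_map hfm (measurable_countIn 0 t)]
    rfl
  have hfN : Measurable fun ω => f (N ω) := hfm.comp hN
  have e1 : charFun ((cbe β (m + 1)).map fun y =>
      a * ((countIn 0 t y : ℝ) - (m + 1 : ℕ) * t / (2 * Real.pi))) ξ =
      ∫ ω, Complex.exp ((ξ * f (N ω) : ℝ) * Complex.I) ∂ν := by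
    rw [hmap, charFun_apply_real, Measure.map_map hfm hN,
      integral_map (hfm.comp hN).aemeasurable
        (Measurable.aestronglyMeasurable (by fun_prop))]
    simp
  have e2 : phaseChar β t l 0 (m + 1) =
      ∫ ω, Complex.exp (((l + 0) * X ω - l * (m + 1 : ℕ) * t : ℝ) * Complex.I) ∂ν := by
    rw [phaseChar, Nat.add_sub_cancel, ← h1, integral_map hX.aemeasurable
        (Measurable.aestronglyMeasurable (by fun_prop))]
  rw [e1, e2, ← integral_sub]
  · refine (norm_integral_le_of_norm_le_const (C := |ξ * a|) ?_).trans (by simp)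
    filter_upwards [h3] with ω hω
    refine (norm_exp_mul_I_sub_le _ _).trans ?_
    have : ξ * f (N ω) - ((l + 0) * X ω - l * (m + 1 : ℕ) * t) =
        -(l * (X ω - 2 * Real.pi * N ω)) := by
      rw [hf, hl]; field_simp; ring
    rw [this, abs_neg, abs_mul]
    calc |l| * |X ω - 2 * Real.pi * N ω| ≤ |l| * (2 * Real.pi) := by gcongr
      _ = |ξ * a| := by
        rw [hl, abs_div, abs_of_pos (by positivity : 0 < 2 * Real.pi)]
        field_simp
  · exact integrable_exp_ofReal_mul_I (by fun_prop)
  · exact integrable_exp_ofReal_mul_I (by fun_prop)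

lemma abs_log_ceil_div_add_log_le {t : ℝ} (ht0 : 0 < t) (ht : t ≤ Real.pi) {n : ℕ}
    (hn : 1 ≤ n * t) :
    |Real.log ((⌈1 / t⌉₊ : ℝ) / n) + Real.log (2 + n * t)| ≤ Real.log (3 * (1 + Real.pi)) := by
  have h1 : 1 / t ≤ (⌈1 / t⌉₊ : ℝ) := Nat.le_ceil _
  have h2 : (⌈1 / t⌉₊ : ℝ) < 1 / t + 1 := Nat.ceil_lt_add_one (by positivity)
  set k : ℝ := (⌈1 / t⌉₊ : ℝ)
  have hk : 0 < k := lt_of_lt_of_le (by positivity) h1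
  have hn0 : (0 : ℝ) < n := by
    by_contra h
    have : (n : ℝ) * t ≤ 0 := mul_nonpos_of_nonpos_of_nonneg (not_lt.1 h) ht0.le
    linarith
  have hkt : 1 ≤ k * t := by rwa [div_le_iff₀ ht0] at h1
  have hkt' : k * t ≤ 1 + Real.pi := by
    have : k * t ≤ (1 / t + 1) * t := by gcongr
    rw [add_mul, one_mul, one_div_mul_cancel ht0.ne'] at this
    linarith
  have e : k / n * (2 + n * t) = (k * t) * ((2 + n * t) / (n * t)) := by field_simp
  have h3 : 1 ≤ (2 + n * t) / (n * t) := by rw [one_le_div (by linarith)]; linarith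
  have h4 : (2 + n * t) / (n * t) ≤ 3 := by rw [div_le_iff₀ (by linarith)]; linarith
  rw [← Real.log_mul (by positivity) (by positivity), e, abs_of_nonneg]
  · refine Real.log_le_log (by positivity) ?_
    calc k * t * ((2 + n * t) / (n * t)) ≤ (1 + Real.pi) * 3 := by gcongr
      _ = _ := by ring
  · exact Real.log_nonneg (one_le_mul_of_one_le_of_one_le hkt h3)

lemma tendsto_charFun_counting {β : ℝ} (hβ : 0 < β) {θ : ℕ → ℝ}
    (hθ : ∀ n, θ n ∈ Set.Ioc 0 Real.pi)
    (hlim : Tendsto (fun n : ℕ => (n : ℝ) * θ n) atTop atTop) (ξ : ℝ) :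
    Tendsto (fun m : ℕ => charFun ((cbe β (m + 1)).map fun y =>
      Real.sqrt (Real.pi ^ 2 * β / (2 * Real.log (2 + (m + 1 : ℕ) * θ (m + 1)))) *
        ((countIn 0 (θ (m + 1)) y : ℝ) - (m + 1 : ℕ) * θ (m + 1) / (2 * Real.pi))) ξ)
      atTop (nhds (Complex.exp (-(ξ ^ 2 / 2 : ℝ)))) := by
  have hπ := Real.pi_pos
  obtain ⟨C, hC, hmain⟩ := exists_norm_phaseChar_sub_rpow_le hβ
  set s : ℕ → ℝ := fun m => ((m + 1 : ℕ) : ℝ) * θ (m + 1) with hs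
  have hst : Tendsto s atTop atTop := (tendsto_add_atTop_iff_nat 1).2 hlim
  set L : ℕ → ℝ := fun m => Real.log (2 + s m) with hL
  have hLt : Tendsto L atTop atTop :=
    Real.tendsto_log_atTop.comp (tendsto_atTop_add_const_left _ _ hst)
  set a : ℕ → ℝ := fun m => Real.sqrt (Real.pi ^ 2 * β / (2 * L m)) with ha
  have hat : Tendsto a atTop (nhds 0) := by
    have h1 : Tendsto (fun m => Real.pi ^ 2 * β / (2 * L m)) atTop (nhds 0) :=
      (hLt.const_mul_atTop (by norm_num : (0 : ℝ) < 2)).const_div_atTop _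
    have h2 := (Real.continuous_sqrt.tendsto 0).comp h1
    rw [Real.sqrt_zero] at h2
    exact h2
  set l : ℕ → ℝ := fun m => ξ * a m / (2 * Real.pi) with hl
  have hlt : Tendsto l atTop (nhds 0) := by
    simpa using (hat.const_mul ξ).div_const (2 * Real.pi)
  have hlabs : Tendsto (fun m => |l m|) atTop (nhds 0) := by simpa using hlt.abs
  set k : ℕ → ℕ := fun m => ⌈1 / θ (m + 1)⌉₊ with hk
  set D := Real.log (3 * (1 + Real.pi)) with hD
  have hbound : ∀ᶠ m in atTop, ‖charFun ((cbe β (m + 1)).map fun y =>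
      a m * ((countIn 0 (θ (m + 1)) y : ℝ) - (m + 1 : ℕ) * θ (m + 1) / (2 * Real.pi))) ξ -
      (((k m : ℝ) / (m + 1 : ℕ)) ^ (4 * l m ^ 2 / β) : ℝ)‖ ≤
      |ξ * a m| + (2 * |l m| * (1 + Real.pi) + C * l m ^ 2) := by
    filter_upwards [hst.eventually_ge_atTop 1, hlabs.eventually_le_const one_pos] with m hm hl1
    obtain ⟨ht0, ht⟩ := hθ (m + 1)
    have h1 := norm_charFun_sub_phaseChar_le hβ m (t := θ (m + 1)) ⟨ht0, by linarith⟩ (a m) ξ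
    have hk1 : 1 ≤ k m := Nat.one_le_ceil_iff.2 (by positivity)
    have hkn : k m ≤ m + 1 := Nat.ceil_le.2 (by rw [div_le_iff₀ ht0]; exact hm)
    have hkt : (k m : ℝ) * θ (m + 1) ≤ 1 + Real.pi := by
      have h2 : (k m : ℝ) < 1 / θ (m + 1) + 1 := Nat.ceil_lt_add_one (by positivity)
      have : (k m : ℝ) * θ (m + 1) ≤ (1 / θ (m + 1) + 1) * θ (m + 1) := by gcongr
      rw [add_mul, one_mul, one_div_mul_cancel ht0.ne'] at this
      linarith
    have h2 := hmain (θ (m + 1)) (l m) ht0 ht hl1 (k m) (m + 1) hk1 (Nat.le_ceil _) hkn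
    refine (norm_sub_le_norm_sub_add_norm_sub _ (phaseChar β (θ (m + 1)) (l m) 0 (m + 1)) _).trans ?_
    refine add_le_add h1 (h2.trans ?_)
    gcongr
  have hzero : Tendsto (fun m => |ξ * a m| + (2 * |l m| * (1 + Real.pi) + C * l m ^ 2))
      atTop (nhds 0) := by
    have h1 := (hat.const_mul ξ).abs
    have h2 := ((hlabs.const_mul 2).mul_const (1 + Real.pi)).add ((hlt.pow 2).const_mul C)
    simpa using h1.add h2
  have hmainterm : Tendsto (fun m => ((k m : ℝ) / (m + 1 : ℕ)) ^ (4 * l m ^ 2 / β)) atTop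
      (nhds (Real.exp (-(ξ ^ 2 / 2)))) := by
    have hexp : Tendsto (fun m => Real.log ((k m : ℝ) / (m + 1 : ℕ)) * (4 * l m ^ 2 / β)) atTop
        (nhds (-(ξ ^ 2 / 2))) := by
      rw [tendsto_iff_norm_sub_tendsto_zero]
      refine squeeze_zero' (Eventually.of_forall fun _ => norm_nonneg _)
        (g := fun m => D * (ξ ^ 2 / 2) / L m) ?_ (hLt.const_div_atTop _)
      filter_upwards [hst.eventually_ge_atTop 1, hLt.eventually_gt_atTop 0] with m hm hLm
      obtain ⟨ht0, ht⟩ := hθ (m + 1)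
      have h1 := abs_log_ceil_div_add_log_le ht0 ht hm
      have h2 : a m ^ 2 = Real.pi ^ 2 * β / (2 * L m) := Real.sq_sqrt (by positivity)
      have h3 : 4 * l m ^ 2 / β = ξ ^ 2 / 2 / L m := by
        rw [hl]
        simp only
        rw [div_pow, mul_pow, h2]
        field_simp
        ring
      have h4 : Real.log ((k m : ℝ) / (m + 1 : ℕ)) * (4 * l m ^ 2 / β) - -(ξ ^ 2 / 2) =
          (Real.log ((k m : ℝ) / (m + 1 : ℕ)) + L m) * (ξ ^ 2 / 2 / L m) := by
        rw [h3]; field_simp; ring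
      rw [h4, Real.norm_eq_abs, abs_mul, abs_of_nonneg (by positivity : 0 ≤ ξ ^ 2 / 2 / L m),
        mul_div_assoc]
      gcongr
    refine ((Real.continuous_exp.tendsto _).comp hexp).congr fun m => ?_
    obtain ⟨ht0, ht⟩ := hθ (m + 1)
    have hk1 : 0 < k m := Nat.ceil_pos.2 (by positivity)
    rw [Function.comp_apply, Real.rpow_def_of_pos (by positivity)]
  have hdiff := squeeze_zero_norm' hbound hzero
  have hfin := hdiff.add ((Complex.continuous_ofReal.tendsto _).comp hmainterm)
  simp only [Function.comp_apply, sub_add_cancel, zero_add, Complex.ofReal_exp,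
    Complex.ofReal_neg] at hfin
  exact hfin

end limit

theorem clt_counting_cbe (β : ℝ) (hβ : 0 < β) (θseq : ℕ → ℝ)
    (hθ : ∀ n, θseq n ∈ Set.Ioc 0 Real.pi)
    (hlim : Tendsto (fun n : ℕ => (n : ℝ) * θseq n) atTop atTop) :
    ∀ h : BoundedContinuousFunction ℝ ℝ,
      Tendsto (fun n : ℕ =>
          ∫ y, h (Real.sqrt (Real.pi ^ 2 * β / (2 * Real.log (2 + n * θseq n))) *
            ((countIn 0 (θseq n) y : ℝ) - n * θseq n / (2 * Real.pi))) ∂(cbe β n))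
        atTop (nhds (∫ t, h t ∂(gaussianReal 0 1))) := by
  intro h
  rw [← tendsto_add_atTop_iff_nat 1]
  set Y : (m : ℕ) → (Fin (m + 1) → ℝ) → ℝ := fun m y =>
    Real.sqrt (Real.pi ^ 2 * β / (2 * Real.log (2 + (m + 1 : ℕ) * θseq (m + 1)))) *
      ((countIn 0 (θseq (m + 1)) y : ℝ) - (m + 1 : ℕ) * θseq (m + 1) / (2 * Real.pi)) with hY
  have hYm : ∀ m, Measurable (Y m) := fun m =>
    (((measurable_from_top (f := fun k : ℕ => (k : ℝ))).comp
      (measurable_countIn 0 (θseq (m + 1)))).sub_const _).const_mul _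
  have hprob : ∀ m, IsProbabilityMeasure ((cbe β (m + 1)).map (Y m)) := fun m => by
    have := isProbabilityMeasure_cbe hβ m
    exact Measure.isProbabilityMeasure_map (hYm m).aemeasurable
  let P : ℕ → ProbabilityMeasure ℝ := fun m => ⟨(cbe β (m + 1)).map (Y m), hprob m⟩
  let Q : ProbabilityMeasure ℝ := ⟨gaussianReal 0 1, inferInstance⟩
  have hPQ : Tendsto P atTop (nhds Q) := by
    refine ProbabilityMeasure.tendsto_iff_tendsto_charFun.2 fun ξ => ?_
    have h1 := tendsto_charFun_counting hβ hθ hlim ξ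
    have h2 : charFun (gaussianReal 0 1) ξ = Complex.exp (-(ξ ^ 2 / 2 : ℝ)) := by
      rw [charFun_gaussianReal]
      congr 1
      push_cast
      simp
    change Tendsto _ atTop (nhds (charFun (gaussianReal 0 1) ξ))
    rw [h2]
    exact h1
  have h3 := ProbabilityMeasure.tendsto_iff_forall_integral_tendsto.1 hPQ h
  refine h3.congr fun m => ?_
  change ∫ x, h x ∂((cbe β (m + 1)).map (Y m)) = _
  rw [integral_map (hYm m).aemeasurable h.continuous.aestronglyMeasurable]
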